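/- arXiv:2308.05742 — 3 statements merged into one kernel-verified Lean document; each statement's English description precedes it below -/
import Mathlib

section
/- Let W be an abelian group with a translation-invariant partial order (x ≤ y implies x + z ≤ y + z for all z) that is integrally closed. Let G = {(log q, r) : q ∈ ℚ, q > 0, r ∈ ℝ}, a subgroup of ℝ × ℝ with the componentwise order. Then for every baseless entropy H with values in W there exists a unique order-preserving group homomorphism F : G → W such that H(P) = F(H₀(P), H₁(P)) for every finite probability space P. -/
open scoped Classical NNReal
open Finset

/-- A finite probability space: a finite type with a strictly positive
probability mass function summing to one. -/
structure FinProb : Type 1 where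
  α : Type
  [fin : Fintype α]
  p : α → ℝ
  pos : ∀ x, 0 < p x
  sum_one : ∑ x, p x = 1

attribute [instance] FinProb.fin

namespace FinProb

/-- `f : P.α → Q.α` is a measure-preserving map from `P` to `Q`. -/
def IsMP (P Q : FinProb) (f : P.α → Q.α) : Prop :=
  ∀ y, Q.p y = ∑ x ∈ Finset.univ.filter fun x => f x = y, P.p x

/-- The pushforward of `P` along `f`, a finite probability space on the image of `f`. -/
noncomputable def push (P : FinProb) {β : Type} (f : P.α → β) : FinProb where
  α := Set.range f
  fin := Set.fintypeRange f
  p := fun y => ∑ x ∈ Finset.univ.filter fun x => f x = (y : β), P.p x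
  pos := fun y => by
    obtain ⟨x, hx⟩ := y.2
    exact Finset.sum_pos' (fun i _ => (P.pos i).le)
      ⟨x, Finset.mem_filter.mpr ⟨Finset.mem_univ x, hx⟩, P.pos x⟩
  sum_one := by
    have h := Finset.sum_fiberwise_of_maps_to
      (g := fun x => (⟨f x, Set.mem_range_self x⟩ : Set.range f))
      (fun x (_ : x ∈ Finset.univ) => Finset.mem_univ _) P.p
    rw [P.sum_one] at h
    rw [← h]
    refine Finset.sum_congr rfl fun y _ => ?_
    refine Finset.sum_congr ?_ fun _ _ => rfl
    refine Finset.filter_congr fun x _ => ?_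
    simp [Subtype.ext_iff]

/-- The product (independent coupling) of two finite probability spaces. -/
noncomputable def prod (P Q : FinProb) : FinProb where
  α := P.α × Q.α
  fin := inferInstance
  p := fun z => P.p z.1 * Q.p z.2
  pos := fun z => mul_pos (P.pos z.1) (Q.pos z.2)
  sum_one := by
    rw [Fintype.sum_prod_type]
    simp_rw [← Finset.mul_sum, Q.sum_one, mul_one]
    exact P.sum_one

/-- Shannon entropy. -/
noncomputable def H1 (P : FinProb) : ℝ := -∑ x, P.p x * Real.log (P.p x)

/-- Hartley entropy. -/
noncomputable def H0 (P : FinProb) : ℝ := Real.log (Fintype.card P.α)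

/-- The maximum of `∑ x ∈ A, P.p x` over subsets `A` of cardinality at most `k`. -/
noncomputable def topSum (P : FinProb) (k : ℕ) : ℝ :=
  (Finset.univ.powerset.filter fun A : Finset P.α => A.card ≤ k).sup'
    ⟨∅, by simp⟩ fun A => ∑ x ∈ A, P.p x

/-- `Majorizes Q P` means that `Q` majorizes `P`. -/
def Majorizes (Q P : FinProb) : Prop := ∀ k : ℕ, topSum P k ≤ topSum Q k

end FinProb

open FinProb

/-- A baseless entropy: monotone under measure-preserving maps, additive on
products, and subadditive on joint pushforwards. -/
def IsBaselessEntropy {W : Type} [AddCommMonoid W] [PartialOrder W]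
    (H : FinProb → W) : Prop :=
  (∀ P Q : FinProb, (∃ f : P.α → Q.α, IsMP P Q f) → H Q ≤ H P) ∧
  (∀ P Q : FinProb, H (P.prod Q) = H P + H Q) ∧
  (∀ (P : FinProb) (β γ : Type) (f : P.α → β) (g : P.α → γ),
    H (P.push fun x => (f x, g x)) ≤ H (P.push f) + H (P.push g))

/-- The subgroup `G = {(log q, r) : q ∈ ℚ, q > 0, r ∈ ℝ}` of `ℝ × ℝ`. -/
def logQR : AddSubgroup (ℝ × ℝ) where
  carrier := {x : ℝ × ℝ | ∃ q : ℚ, 0 < q ∧ x.1 = Real.log (q : ℝ)}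
  zero_mem' := ⟨1, one_pos, by simp⟩
  add_mem' := by
    rintro x y ⟨q1, hq1, h1⟩ ⟨q2, hq2, h2⟩
    refine ⟨q1 * q2, mul_pos hq1 hq2, ?_⟩
    push_cast
    rw [Real.log_mul (Rat.cast_pos.mpr hq1).ne' (Rat.cast_pos.mpr hq2).ne']
    simp [Prod.fst_add, h1, h2]
  neg_mem' := by
    rintro x ⟨q, hq, h⟩
    refine ⟨q⁻¹, by positivity, ?_⟩
    push_cast
    rw [Real.log_inv]
    simp [h]

theorem FinProb.card_pos (P : FinProb) : 0 < Fintype.card P.α := by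
  rcases Nat.eq_zero_or_pos (Fintype.card P.α) with h | h
  · have hemp : IsEmpty P.α := Fintype.card_eq_zero_iff.mp h
    have h1 := P.sum_one
    rw [Finset.univ_eq_empty, Finset.sum_empty] at h1
    norm_num at h1
  · exact h

theorem mem_logQR (P : FinProb) : ((H0 P, H1 P) : ℝ × ℝ) ∈ logQR :=
  ⟨(Fintype.card P.α : ℚ), by exact_mod_cast P.card_pos, by simp [FinProb.H0]⟩


section BaselessProof

set_option linter.unusedSectionVars false

namespace FinProb

/-- Transport along measure preserving maps and pushforwards. -/
theorem isMP_surj {R Q : FinProb} {g : R.α → Q.α} (hg : IsMP R Q g) : Function.Surjective g := by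
  intro y
  by_contra hcon
  push Not at hcon
  have h := hg y
  rw [Finset.filter_false_of_mem (fun x _ => hcon x), Finset.sum_empty] at h
  exact (Q.pos y).ne' h

theorem isMP_of_equiv {P Q : FinProb} (e : P.α ≃ Q.α) (he : ∀ x, Q.p (e x) = P.p x) :
    IsMP P Q e := by
  intro y
  have h2 : (Finset.univ.filter fun z => e z = y) = {e.symm y} := by
    ext z
    simp [Equiv.eq_symm_apply]
  rw [h2, Finset.sum_singleton, ← he]
  simp

theorem exists_isMP_to_push {R Q : FinProb} {g : R.α → Q.α} (hg : IsMP R Q g) :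
    ∃ f, IsMP Q (R.push g) f := by
  let e : Q.α → (R.push g).α := fun y => (⟨y, isMP_surj hg y⟩ : Set.range g)
  have he : Function.Bijective e := by
    constructor
    · intro y y' h
      exact congrArg (fun z : Set.range g => z.1) h
    · intro z
      exact ⟨z.1, rfl⟩
  exact ⟨_, isMP_of_equiv (Equiv.ofBijective e he) (fun x => (hg x).symm)⟩

theorem exists_isMP_of_push_inj {R : FinProb} {β : Type} {f : R.α → β}
    (hf : Function.Injective f) : ∃ g, IsMP (R.push f) R g := by
  let e : R.α → (R.push f).α := fun x => (⟨f x, Set.mem_range_self x⟩ : Set.range f)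
  have he : Function.Bijective e := by
    constructor
    · intro y y' h
      exact hf (congrArg (fun z : Set.range f => z.1) h)
    · rintro ⟨_, x, rfl⟩
      exact ⟨x, rfl⟩
  have h1 : ∀ x, (R.push f).p (e x) = R.p x := by
    intro x
    show ∑ z ∈ Finset.univ.filter fun z => f z = f x, R.p z = R.p x
    have h2 : (Finset.univ.filter fun z => f z = f x) = {x} := by
      ext z
      simp [hf.eq_iff]
    rw [h2, Finset.sum_singleton]
  refine ⟨_, isMP_of_equiv (Equiv.ofBijective e he).symm (fun x => ?_)⟩
  rw [← h1]
  congr 1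
  exact (Equiv.ofBijective e he).apply_symm_apply x

end FinProb

section
variable {W : Type} [AddCommGroup W] [PartialOrder W] [IsOrderedAddMonoid W]
  {H : FinProb → W}

theorem BE_iso (hH : IsBaselessEntropy H) {P Q : FinProb} (e : P.α ≃ Q.α)
    (he : ∀ x, Q.p (e x) = P.p x) : H P = H Q := by
  apply le_antisymm
  · exact hH.1 Q P ⟨e.symm, isMP_of_equiv e.symm (fun x => by rw [← he]; simp)⟩
  · exact hH.1 P Q ⟨e, isMP_of_equiv e he⟩

theorem BE_sub (hH : IsBaselessEntropy H) {R Q1 Q2 : FinProb} {f : R.α → Q1.α} {g : R.α → Q2.α}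
    (hf : IsMP R Q1 f) (hg : IsMP R Q2 g)
    (hinj : Function.Injective fun x => (f x, g x)) : H R ≤ H Q1 + H Q2 :=
  calc H R ≤ H (R.push fun x => (f x, g x)) := hH.1 _ _ (exists_isMP_of_push_inj hinj)
    _ ≤ H (R.push f) + H (R.push g) := hH.2.2 R _ _ f g
    _ ≤ H Q1 + H Q2 := add_le_add (hH.1 _ _ (exists_isMP_to_push hf)) (hH.1 _ _ (exists_isMP_to_push hg))

/-- One-point space. -/
noncomputable def ptSpace : FinProb where
  α := Unit
  p := fun _ => 1
  pos := fun _ => one_pos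
  sum_one := by simp

theorem BE_pt (hH : IsBaselessEntropy H) : H ptSpace = 0 := by
  have h1 := hH.2.1 ptSpace ptSpace
  have h2 : H (ptSpace.prod ptSpace) = H ptSpace :=
    BE_iso hH (Equiv.prodPUnit Unit) (by intro x; simp [ptSpace, FinProb.prod])
  rw [h2] at h1
  simpa using h1

theorem BE_nonneg (hH : IsBaselessEntropy H) (P : FinProb) : 0 ≤ H P := by
  rw [← BE_pt hH]
  refine hH.1 P ptSpace ⟨fun _ => (), ?_⟩
  intro y
  refine Eq.trans P.sum_one.symm (Finset.sum_congr ?_ fun _ _ => rfl)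
  symm
  apply Finset.filter_true_of_mem
  intro _ _
  rfl

theorem BE_card_one (hH : IsBaselessEntropy H) (P : FinProb) (h : Fintype.card P.α = 1) :
    H P = 0 := by
  rw [← BE_pt hH]
  obtain ⟨x0, hx0⟩ := Fintype.card_eq_one_iff.mp h
  have hu : Unique P.α := ⟨⟨x0⟩, hx0⟩
  refine BE_iso hH (P := P) (Q := ptSpace) (Equiv.ofUnique P.α Unit) ?_
  intro x
  have h1 := P.sum_one
  have h2 : (Finset.univ : Finset P.α) = {x} := by
    ext z; simp only [Finset.mem_univ, Finset.mem_singleton, true_iff]; rw [hx0 z, hx0 x]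
  rw [h2, Finset.sum_singleton] at h1
  rw [h1]
  rfl

/-- Random injections increase a baseless entropy. -/
theorem BE_mix (hH : IsBaselessEntropy H) (P Q B : FinProb) (f : B.α → P.α → Q.α)
    (hf : ∀ b, Function.Injective (f b))
    (hq : ∀ y, Q.p y = ∑ x, ∑ b, if f b x = y then P.p x * B.p b else 0) : H P ≤ H Q := by
  have h1 : H (P.prod B) ≤ H Q + H B := by
    refine BE_sub hH (R := P.prod B) (Q1 := Q) (Q2 := B) (f := fun z => f z.2 z.1)
      (g := fun z => z.2) ?_ ?_ ?_
    · intro y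
      rw [hq, Finset.sum_filter]
      exact (Fintype.sum_prod_type
        (f := fun z : P.α × B.α => if f z.2 z.1 = y then P.p z.1 * B.p z.2 else 0)).symm
    · intro b
      rw [Finset.sum_filter]
      have h3 := Fintype.sum_prod_type
        (f := fun z : P.α × B.α => if z.2 = b then P.p z.1 * B.p z.2 else 0)
      refine Eq.trans ?_ h3.symm
      simp only [Finset.sum_ite_eq', Finset.mem_univ, if_true]
      rw [← Finset.sum_mul, P.sum_one, one_mul]
    · rintro ⟨x, b⟩ ⟨x', b'⟩ h
      simp only [Prod.mk.injEq] at h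
      obtain ⟨h4, rfl⟩ := h
      rw [hf _ h4]
  rw [hH.2.1] at h1
  exact le_of_add_le_add_right h1

theorem BE_doubly (hH : IsBaselessEntropy H) (P Q : FinProb) (e : P.α → Q.α)
    (he : Function.Injective e) (M : Matrix Q.α Q.α ℝ) (hM : M ∈ doublyStochastic ℝ Q.α)
    (hq : ∀ y, Q.p y = ∑ x, M y (e x) * P.p x) : H P ≤ H Q := by
  obtain ⟨w, hw0, hw1, hwM⟩ := exists_eq_sum_perm_of_mem_doublyStochastic hM
  have key : ∀ F : Equiv.Perm Q.α → ℝ, (∀ σ, w σ = 0 → F σ = 0) →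
      ∑ x : {σ : Equiv.Perm Q.α // 0 < w σ}, F x.1 = ∑ σ, F σ := by
    intro F hF
    rw [← Finset.sum_subtype (Finset.univ.filter fun σ => 0 < w σ) (by simp) F]
    rw [Finset.sum_filter_of_ne]
    intro σ _ h
    refine lt_of_le_of_ne (hw0 σ) (fun h' => h (hF σ h'.symm))
  let B : FinProb :=
    { α := {σ : Equiv.Perm Q.α // 0 < w σ}
      fin := inferInstance
      p := fun σ => w σ.1
      pos := fun σ => σ.2
      sum_one := by rw [key w (fun _ h => h), hw1] }
  refine BE_mix hH P Q B (fun σ x => σ.1.symm (e x))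
    (fun σ => σ.1.symm.injective.comp he) ?_
  intro y
  rw [hq]
  refine Finset.sum_congr rfl fun x _ => ?_
  have h1 := key (fun σ => if σ.symm (e x) = y then P.p x * w σ else 0)
    (fun σ h => by simp [h])
  refine Eq.trans ?_ h1.symm
  rw [← hwM, Matrix.sum_apply, Finset.sum_mul]
  refine Finset.sum_congr rfl fun σ _ => ?_
  simp only [Matrix.smul_apply, Equiv.Perm.permMatrix, PEquiv.toMatrix_apply,
    Equiv.toPEquiv_apply, Option.mem_some_iff, smul_eq_mul]
  by_cases h : σ y = e x
  · have h' : σ.symm (e x) = y := by rw [← h]; simp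
    simp [h, h', mul_comm]
  · have h' : σ.symm (e x) ≠ y := by rintro rfl; simp at h
    simp [h, h']

end

end BaselessProof

section BaselessProof2

set_option linter.unusedSectionVars false

variable {W : Type} [AddCommGroup W] [PartialOrder W] [IsOrderedAddMonoid W]
  {H : FinProb → W}

theorem sum_ite_two {ι : Type} [Fintype ι] (K : Finset ι) (a b : ℝ) :
    ∑ z, (if z ∈ K then a else b) = K.card * a + ((Fintype.card ι : ℝ) - K.card) * b := by
  have h : ∀ z, (if z ∈ K then a else b) = (if z ∈ K then a - b else 0) + b := by
    intro z; split_ifs <;> ring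
  simp_rw [h]
  rw [Finset.sum_add_distrib, Finset.sum_ite_mem, Finset.univ_inter]
  simp
  ring

/-- The majorization criterion used throughout: `Q` lies between the two averaged levels of `P`. -/
theorem BE_maj (hH : IsBaselessEntropy H) (P Q : FinProb) (S : ℕ) (hS : 0 < S)
    (hSN : S < Fintype.card Q.α) (hc : Fintype.card P.α ≤ Fintype.card Q.α)
    (G : Finset P.α) (hG : G.card ≤ S)
    (hhi : ∀ y, Q.p y ≤ (∑ x ∈ G, P.p x) / S)
    (hlo : ∀ y, (1 - ∑ x ∈ G, P.p x) / ((Fintype.card Q.α : ℝ) - S) ≤ Q.p y) : H P ≤ H Q := by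
  obtain ⟨e⟩ := Function.Embedding.nonempty_of_card_le hc
  obtain ⟨K, hK1, hK2⟩ := Finset.exists_superset_card_eq (s := G.map e) (n := S)
    (by simpa using hG) hSN.le
  set N : ℝ := (Fintype.card Q.α : ℝ) with hN
  have hSpos : (0 : ℝ) < S := by exact_mod_cast hS
  have hNS : (0 : ℝ) < N - S := by
    have : (S : ℝ) < N := by rw [hN]; exact_mod_cast hSN
    linarith
  set m : ℝ := ∑ x ∈ G, P.p x with hm
  set m' : ℝ := ∑ x, if e x ∈ K then P.p x else 0 with hm'
  have hmm : m ≤ m' := by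
    rw [hm, hm', ← Finset.sum_filter]
    refine Finset.sum_le_sum_of_subset_of_nonneg ?_ (fun x _ _ => (P.pos x).le)
    intro x hx
    simp only [Finset.mem_filter, Finset.mem_univ, true_and]
    exact hK1 (Finset.mem_map_of_mem e hx)
  set hi : ℝ := m' / S with hhid
  set lo : ℝ := (1 - m') / (N - S) with hlod
  have hhi' : ∀ y, Q.p y ≤ hi := fun y => (hhi y).trans (by rw [hhid]; gcongr)
  have hlo' : ∀ y, lo ≤ Q.p y := fun y => le_trans (by rw [hlod]; gcongr) (hlo y)
  have hi_mul : S * hi = m' := by rw [hhid]; field_simp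
  have lo_mul : (N - S) * lo = 1 - m' := by rw [hlod]; field_simp
  have hNpos : 0 < N := by linarith
  obtain ⟨v, hv0, hv1, hvs, hvq⟩ : ∃ v : Q.α → ℝ, (∀ y, 0 ≤ v y) ∧ (∀ y, v y ≤ 1) ∧
      ∑ y, v y = S ∧ ∀ y, v y * hi + (1 - v y) * lo = Q.p y := by
    by_cases heq : hi = lo
    · refine ⟨fun _ => S / N, fun _ => by positivity, fun _ => ?_, ?_, ?_⟩
      · rw [div_le_one hNpos]; linarith
      · simp only [Finset.sum_const, Finset.card_univ, nsmul_eq_mul]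
        rw [← hN]; field_simp
      · intro y
        have h1 := hhi' y
        have h2 := hlo' y
        rw [← heq] at h2 ⊢
        have h3 : Q.p y = hi := le_antisymm h1 h2
        rw [h3]; ring
    · obtain ⟨y0⟩ : Nonempty Q.α := Fintype.card_pos_iff.mp Q.card_pos
      have hlt : lo < hi := lt_of_le_of_ne ((hlo' y0).trans (hhi' y0)) (Ne.symm heq)
      have hpos : 0 < hi - lo := by linarith
      refine ⟨fun y => (Q.p y - lo) / (hi - lo), fun y => ?_, fun y => ?_, ?_, ?_⟩
      · exact div_nonneg (by linarith [hlo' y]) hpos.le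
      · rw [div_le_one hpos]; linarith [hhi' y]
      · rw [← Finset.sum_div, Finset.sum_sub_distrib, Q.sum_one]
        simp only [Finset.sum_const, Finset.card_univ, nsmul_eq_mul]
        rw [← hN, div_eq_iff hpos.ne']
        linarith
      · intro y
        field_simp
        ring
  refine BE_doubly hH P Q e e.injective
    (Matrix.of fun y z => if z ∈ K then v y / S else (1 - v y) / (N - S)) ?_ ?_
  · rw [mem_doublyStochastic_iff_sum]
    refine ⟨?_, ?_, ?_⟩
    · intro y z
      simp only [Matrix.of_apply]
      split_ifs
      · exact div_nonneg (hv0 y) hSpos.le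
      · exact div_nonneg (by linarith [hv1 y]) hNS.le
    · intro y
      simp only [Matrix.of_apply]
      rw [sum_ite_two, hK2, ← hN]
      field_simp
      ring
    · intro z
      by_cases hz : z ∈ K
      · simp only [Matrix.of_apply, hz, if_true]
        rw [← Finset.sum_div, hvs]; field_simp
      · simp only [Matrix.of_apply, hz, if_false]
        rw [← Finset.sum_div, Finset.sum_sub_distrib, hvs]
        simp only [Finset.sum_const, Finset.card_univ, nsmul_eq_mul, mul_one]
        rw [← hN]; field_simp
  · intro y
    have h1 : ∀ x, (if e x ∈ K then v y / S else (1 - v y) / (N - S)) * P.p x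
        = (v y / S - (1 - v y) / (N - S)) * (if e x ∈ K then P.p x else 0)
          + (1 - v y) / (N - S) * P.p x := by
      intro x; split_ifs <;> ring
    simp only [Matrix.of_apply]
    simp_rw [h1]
    rw [Finset.sum_add_distrib, ← Finset.mul_sum, ← Finset.mul_sum, P.sum_one, ← hm', ← hvq y,
      hhid, hlod]
    field_simp
    ring

/-- The two-level space `(1-ε) δ₀ + ε · uniform` on `k` points. -/
noncomputable def TSp (k : ℕ) (hk : 0 < k) (ε : ℝ) (hε : 0 < ε ∧ ε ≤ 1) : FinProb where
  α := Fin k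
  p := fun i => ε / k + if i = ⟨0, hk⟩ then 1 - ε else 0
  pos := fun i => by
    have hk' : (0 : ℝ) < k := by exact_mod_cast hk
    have : 0 < ε / k := div_pos hε.1 hk'
    split_ifs
    · linarith [hε.2]
    · linarith
  sum_one := by
    have hk' : (0 : ℝ) < k := by exact_mod_cast hk
    rw [Finset.sum_add_distrib]
    simp
    field_simp
    ring

@[simp] theorem TSp_card (k : ℕ) (hk : 0 < k) (ε : ℝ) (hε : 0 < ε ∧ ε ≤ 1) :
    Fintype.card (TSp k hk ε hε).α = k := Fintype.card_fin k

@[simp] theorem prod_card (P Q : FinProb) :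
    Fintype.card (P.prod Q).α = Fintype.card P.α * Fintype.card Q.α :=
  Fintype.card_prod P.α Q.α

theorem TSp_zero (k : ℕ) (hk : 0 < k) (ε : ℝ) (hε : 0 < ε ∧ ε ≤ 1) :
    ∃ x0 : (TSp k hk ε hε).α, 1 - ε ≤ (TSp k hk ε hε).p x0 := by
  refine ⟨(⟨0, hk⟩ : Fin k), ?_⟩
  have hk' : (0 : ℝ) < k := by exact_mod_cast hk
  have : 0 < ε / k := div_pos hε.1 hk'
  simp only [TSp, if_true]
  linarith

theorem p_le_one (P : FinProb) (x : P.α) : P.p x ≤ 1 := by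
  rw [← P.sum_one]
  exact Finset.single_le_sum (fun i _ => (P.pos i).le) (Finset.mem_univ x)

theorem exists_min (P : FinProb) : ∃ μ : ℝ, 0 < μ ∧ ∀ x, μ ≤ P.p x := by
  obtain ⟨y0⟩ : Nonempty P.α := Fintype.card_pos_iff.mp P.card_pos
  obtain ⟨x, -, hx⟩ := Finset.exists_min_image Finset.univ P.p ⟨y0, Finset.mem_univ _⟩
  exact ⟨P.p x, P.pos x, fun y => hx y (Finset.mem_univ y)⟩

/-- Uniform space. -/
noncomputable abbrev USp (k : ℕ) (hk : 0 < k) : FinProb := TSp k hk 1 ⟨one_pos, le_rfl⟩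

theorem USp_p (k : ℕ) (hk : 0 < k) (x : (USp k hk).α) : (USp k hk).p x = 1 / k := by
  simp [USp, TSp]

/-- Step D: very peaked spaces have small entropy (given their cardinality). -/
theorem BE_peak (hH : IsBaselessEntropy H) (P Q : FinProb)
    (hc : Fintype.card P.α ≤ Fintype.card Q.α) (h2 : 2 ≤ Fintype.card Q.α)
    (x0 : P.α) (μ : ℝ) (hμ : ∀ y, μ ≤ Q.p y) (hx0 : 1 - μ ≤ P.p x0) : H P ≤ H Q := by
  have hN : (2 : ℝ) ≤ Fintype.card Q.α := by exact_mod_cast h2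
  refine BE_maj hH P Q 1 one_pos h2 hc {x0} (by simp) ?_ ?_
  · intro y
    rw [Finset.sum_singleton]
    simp only [Nat.cast_one, div_one]
    refine le_trans ?_ hx0
    have : Nontrivial Q.α := Fintype.one_lt_card_iff_nontrivial.mp h2
    obtain ⟨z, hz⟩ := exists_ne y
    have h3 : Q.p y + Q.p z ≤ 1 := by
      rw [← Finset.sum_pair hz.symm, ← Q.sum_one]
      exact Finset.sum_le_sum_of_subset_of_nonneg (Finset.subset_univ _)
        (fun i _ _ => (Q.pos i).le)
    linarith [hμ z]
  · intro y
    rw [Finset.sum_singleton, Nat.cast_one]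
    refine le_trans ?_ (hμ y)
    have h1 := p_le_one P x0
    rw [div_le_iff₀ (by linarith)]
    have : 0 ≤ μ := by linarith
    nlinarith

theorem BE_uni_mono (hH : IsBaselessEntropy H) {k l : ℕ} (hk : 0 < k) (hl : 0 < l) (h : k ≤ l) :
    H (USp k hk) ≤ H (USp l hl) := by
  rcases h.lt_or_eq with h | rfl
  · refine BE_maj hH _ _ k hk (by simpa using h) (by simpa using h.le) Finset.univ
      (by rw [Finset.card_univ]; simp) ?_ ?_
    · intro y
      rw [USp_p, (USp k hk).sum_one]
      have : (0 : ℝ) < k := by exact_mod_cast hk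
      have h' : (k : ℝ) ≤ l := by exact_mod_cast h.le
      gcongr
    · intro y
      rw [(USp k hk).sum_one, sub_self, zero_div]
      exact ((USp l hl).pos y).le
  · rfl

theorem exists_rect (P Q : FinProb) (G : Finset P.α) (t0 : Q.α) :
    ∃ G' : Finset (P.prod Q).α, G'.card = G.card ∧
      ∑ z ∈ G', (P.prod Q).p z = (∑ x ∈ G, P.p x) * Q.p t0 := by
  let G0 : Finset (P.α × Q.α) := G ×ˢ {t0}
  have h1 : G0.card = G.card := by simp [G0]
  have h2 : ∑ z ∈ G0, P.p z.1 * Q.p z.2 = (∑ x ∈ G, P.p x) * Q.p t0 := by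
    rw [Finset.sum_mul]
    simp [G0, Finset.sum_product]
  exact ⟨G0, h1, h2⟩

/-- Step A. -/
theorem BE_stepA (hH : IsBaselessEntropy H) (X : FinProb) (hX : 2 ≤ Fintype.card X.α)
    (S : ℕ) (hS : 0 < S) (G : Finset X.α) (hG : G.card ≤ S) (ε : ℝ) (hε : 0 < ε ∧ ε ≤ 1)
    (hε' : 0 < ε / 4 ∧ ε / 4 ≤ 1) (hGm : 1 - ε / 4 ≤ ∑ x ∈ G, X.p x) :
    H X + H (TSp S hS (ε / 4) hε') ≤
      H (USp S hS) + H (TSp (Fintype.card X.α) X.card_pos ε hε) := by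
  set A := Fintype.card X.α with hA
  rw [← hH.2.1, ← hH.2.1]
  obtain ⟨t0, ht0⟩ := TSp_zero S hS (ε / 4) hε'
  have hSr : (1 : ℝ) ≤ S := by exact_mod_cast hS
  have hAr : (2 : ℝ) ≤ A := by exact_mod_cast hX
  obtain ⟨G', hG'c, hG'm⟩ := exists_rect X (TSp S hS (ε / 4) hε') G t0
  have hmass : 1 - ε / 2 ≤ ∑ z ∈ G', (X.prod (TSp S hS (ε / 4) hε')).p z := by
    rw [hG'm]
    nlinarith
  refine BE_maj hH _ _ S hS ?_ ?_ G' ?_ ?_ ?_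
  · simp; nlinarith
  · simp [← hA, mul_comm]
  · rw [hG'c]; exact hG
  · rintro ⟨s, x⟩
    show (USp S hS).p s * (TSp A X.card_pos ε hε).p x ≤ _
    rw [USp_p, div_mul_eq_mul_div, one_mul]
    gcongr
    refine le_trans ?_ hmass
    simp only [TSp]
    have h1 : ε / A ≤ ε / 2 := by gcongr; exact hε.1.le
    split_ifs <;> linarith [hε.2, hε.1]
  · rintro ⟨s, x⟩
    show _ ≤ (USp S hS).p s * (TSp A X.card_pos ε hε).p x
    have h0 : ε / A ≤ (TSp A X.card_pos ε hε).p x := by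
      simp only [TSp]
      split_ifs <;> linarith [hε.2]
    rw [USp_p]
    refine le_trans ?_ (mul_le_mul_of_nonneg_left h0 (by positivity))
    rw [prod_card, TSp_card, TSp_card]
    push_cast
    have h1 : (0 : ℝ) < S * A - S := by nlinarith
    rw [div_le_iff₀ h1]
    have h2 : 1 / (S : ℝ) * (ε / A) * (S * A - S) = ε * (1 - 1 / A) := by field_simp
    rw [h2]
    have h3 : 1 / (A : ℝ) ≤ 1 / 2 := by gcongr
    have h4 : ε * (1 / 2) ≤ ε * (1 - 1 / A) := mul_le_mul_of_nonneg_left (by linarith) hε.1.le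
    linarith

/-- Step B. -/
theorem BE_stepB (hH : IsBaselessEntropy H) (X : FinProb) (hX : 2 ≤ Fintype.card X.α)
    (S : ℕ) (hS : 0 < S) (hmax : ∀ x, X.p x ≤ 1 / (2 * S)) (ε : ℝ) (hε : 0 < ε ∧ ε ≤ 1) :
    ∃ (ε' : ℝ) (hε' : 0 < ε' ∧ ε' ≤ 1),
      H (USp S hS) + H (TSp (Fintype.card X.α) X.card_pos ε' hε') ≤ H X + H (TSp S hS ε hε) := by
  obtain ⟨μ, hμ0, hμ⟩ := exists_min (X.prod (TSp S hS ε hε))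
  have hε' : 0 < min μ (1 / 2) ∧ min μ (1 / 2) ≤ 1 :=
    ⟨by positivity, (min_le_right _ _).trans (by norm_num)⟩
  refine ⟨min μ (1 / 2), hε', ?_⟩
  rw [← hH.2.1, ← hH.2.1]
  set A := Fintype.card X.α with hA
  set ε' := min μ (1 / 2) with hε'd
  have h1' : ε' ≤ μ := min_le_left _ _
  have h2' : ε' ≤ 1 / 2 := min_le_right _ _
  obtain ⟨t0, ht0⟩ := TSp_zero A X.card_pos ε' hε'
  have hSr : (1 : ℝ) ≤ S := by exact_mod_cast hS
  have hAr : (2 : ℝ) ≤ A := by exact_mod_cast hX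
  obtain ⟨G', hG'c, hmass⟩ := exists_rect (USp S hS) (TSp A X.card_pos ε' hε') Finset.univ t0
  rw [(USp S hS).sum_one, one_mul] at hmass
  refine BE_maj hH _ _ S hS ?_ ?_ G' ?_ ?_ ?_
  · simp; nlinarith
  · simp [← hA, mul_comm]
  · rw [hG'c, Finset.card_univ, TSp_card]
  · rintro ⟨x, s⟩
    show X.p x * (TSp S hS ε hε).p s ≤ _
    rw [hmass]
    have h3 : X.p x * (TSp S hS ε hε).p s ≤ X.p x :=
      mul_le_of_le_one_right (X.pos x).le (p_le_one _ s)
    refine (h3.trans (hmax x)).trans ?_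
    rw [div_le_div_iff₀ (by positivity) (by positivity)]
    nlinarith
  · intro z
    refine le_trans ?_ (hμ z)
    rw [hmass, prod_card, TSp_card]
    push_cast
    have h1 : (1 : ℝ) ≤ A * S - S := by nlinarith
    rw [← hA, div_le_iff₀ (by linarith)]
    nlinarith

end BaselessProof2

section BaselessProof3

set_option linter.unusedSectionVars false

variable {W : Type} [AddCommGroup W] [PartialOrder W] [IsOrderedAddMonoid W]
  {H : FinProb → W}

/-- Powers of a finite probability space. -/
noncomputable def powSp (P : FinProb) : ℕ → FinProb
  | 0 => ptSpace
  | n + 1 => P.prod (powSp P n)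

theorem BE_pow (hH : IsBaselessEntropy H) (P : FinProb) (n : ℕ) : H (powSp P n) = n • H P := by
  induction n with
  | zero => show H ptSpace = _; rw [zero_nsmul]; exact BE_pt hH
  | succ n ih =>
    show H (P.prod (powSp P n)) = _
    rw [hH.2.1, ih, succ_nsmul, add_comm]

theorem pow_card (P : FinProb) (n : ℕ) :
    Fintype.card (powSp P n).α = Fintype.card P.α ^ n := by
  induction n with
  | zero => exact Fintype.card_unit
  | succ n ih =>
    show Fintype.card (P.prod (powSp P n)).α = _
    rw [prod_card, ih, pow_succ, mul_comm]

theorem sum_prod_eq (P Q : FinProb) (F : P.α → Q.α → ℝ) :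
    ∑ z : (P.prod Q).α, F z.1 z.2 = ∑ x, ∑ y, F x y :=
  Fintype.sum_prod_type (f := fun z : P.α × Q.α => F z.1 z.2)

theorem H1_prod (P Q : FinProb) : H1 (P.prod Q) = H1 P + H1 Q := by
  unfold H1
  have h1 : ∑ z : (P.prod Q).α, (P.prod Q).p z * Real.log ((P.prod Q).p z)
      = ∑ x, ∑ y, (P.p x * Q.p y) * Real.log (P.p x * Q.p y) :=
    sum_prod_eq P Q (fun x y => (P.p x * Q.p y) * Real.log (P.p x * Q.p y))
  have h2 : ∀ x y, (P.p x * Q.p y) * Real.log (P.p x * Q.p y)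
      = P.p x * Real.log (P.p x) * Q.p y + P.p x * (Q.p y * Real.log (Q.p y)) := by
    intro x y
    rw [Real.log_mul (P.pos x).ne' (Q.pos y).ne']; ring
  rw [h1]
  simp_rw [h2, Finset.sum_add_distrib, ← Finset.mul_sum, ← Finset.sum_mul]
  rw [Q.sum_one, P.sum_one]
  ring

theorem H0_prod (P Q : FinProb) : H0 (P.prod Q) = H0 P + H0 Q := by
  unfold H0
  rw [prod_card]
  push_cast
  rw [Real.log_mul]
  · exact_mod_cast P.card_pos.ne'
  · exact_mod_cast Q.card_pos.ne'

/-- Varentropy. -/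
noncomputable def V1 (P : FinProb) : ℝ := ∑ x, P.p x * (-Real.log (P.p x) - H1 P) ^ 2

theorem V1_centered (P : FinProb) : ∑ x, P.p x * (-Real.log (P.p x) - H1 P) = 0 := by
  have h : ∀ x, P.p x * (-Real.log (P.p x) - H1 P)
      = -(P.p x * Real.log (P.p x)) - P.p x * H1 P := by intro x; ring
  simp_rw [h, Finset.sum_sub_distrib, Finset.sum_neg_distrib, ← Finset.sum_mul, P.sum_one]
  unfold H1
  ring

theorem V1_prod (P Q : FinProb) : V1 (P.prod Q) = V1 P + V1 Q := by
  have h1 : V1 (P.prod Q)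
      = ∑ x, ∑ y, (P.p x * Q.p y) * (-Real.log (P.p x * Q.p y) - H1 (P.prod Q)) ^ 2 :=
    sum_prod_eq P Q
      (fun x y => (P.p x * Q.p y) * (-Real.log (P.p x * Q.p y) - H1 (P.prod Q)) ^ 2)
  have h2 : ∀ x y, (P.p x * Q.p y) * (-Real.log (P.p x * Q.p y) - H1 (P.prod Q)) ^ 2
      = P.p x * (-Real.log (P.p x) - H1 P) ^ 2 * Q.p y
        + (2 * (P.p x * (-Real.log (P.p x) - H1 P))) * (Q.p y * (-Real.log (Q.p y) - H1 Q))
        + P.p x * (Q.p y * (-Real.log (Q.p y) - H1 Q) ^ 2) := by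
    intro x y
    rw [Real.log_mul (P.pos x).ne' (Q.pos y).ne', H1_prod]; ring
  rw [h1]
  simp_rw [h2, Finset.sum_add_distrib, ← Finset.mul_sum, V1_centered, ← Finset.sum_mul]
  rw [Q.sum_one, P.sum_one]
  unfold V1
  ring

theorem H1_pow (P : FinProb) (n : ℕ) : H1 (powSp P n) = n * H1 P := by
  induction n with
  | zero => simp [H1, powSp, ptSpace]
  | succ n ih =>
    show H1 (P.prod (powSp P n)) = _
    rw [H1_prod, ih]; push_cast; ring

theorem V1_pow (P : FinProb) (n : ℕ) : V1 (powSp P n) = n * V1 P := by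
  induction n with
  | zero => simp [V1, H1, powSp, ptSpace]
  | succ n ih =>
    show V1 (P.prod (powSp P n)) = _
    rw [V1_prod, ih]; push_cast; ring

theorem H1_nonneg (P : FinProb) : 0 ≤ H1 P := by
  unfold H1
  rw [neg_nonneg]
  refine Finset.sum_nonpos fun x _ => ?_
  exact mul_nonpos_of_nonneg_of_nonpos (P.pos x).le (Real.log_nonpos (P.pos x).le (p_le_one P x))

theorem cheb (P : FinProb) (t : ℝ) (ht : 0 < t) :
    ∃ G : Finset P.α, 1 - V1 P / t ^ 2 ≤ ∑ x ∈ G, P.p x ∧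
      ((G.card : ℝ) ≤ Real.exp (H1 P + t)) ∧ ∀ x ∈ G, P.p x ≤ Real.exp (-(H1 P - t)) := by
  refine ⟨Finset.univ.filter fun x => |-Real.log (P.p x) - H1 P| < t, ?_, ?_, ?_⟩
  · have h1 := Finset.sum_filter_add_sum_filter_not Finset.univ
      (fun x => |-Real.log (P.p x) - H1 P| < t) P.p
    rw [P.sum_one] at h1
    have h2 : ∑ x ∈ Finset.univ.filter (fun x => ¬ |-Real.log (P.p x) - H1 P| < t), P.p x
        ≤ V1 P / t ^ 2 := by
      rw [le_div_iff₀ (by positivity), Finset.sum_mul]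
      unfold V1
      refine (Finset.sum_le_sum ?_).trans (Finset.sum_le_sum_of_subset_of_nonneg
        (Finset.filter_subset _ _) (fun x _ _ => mul_nonneg (P.pos x).le (sq_nonneg _)))
      intro x hx
      simp only [Finset.mem_filter, Finset.mem_univ, true_and, not_lt] at hx
      refine mul_le_mul_of_nonneg_left ?_ (P.pos x).le
      rw [← sq_abs (-Real.log (P.p x) - H1 P)]
      gcongr
    linarith
  · set G := Finset.univ.filter fun x => |-Real.log (P.p x) - H1 P| < t with hG
    have h1 : ∑ x ∈ G, Real.exp (-(H1 P + t)) ≤ ∑ x ∈ G, P.p x := by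
      refine Finset.sum_le_sum fun x hx => ?_
      simp only [hG, Finset.mem_filter, Finset.mem_univ, true_and] at hx
      rw [← Real.le_log_iff_exp_le (P.pos x)]
      linarith [(abs_lt.mp hx).2]
    have h2 : ∑ x ∈ G, P.p x ≤ 1 := by
      rw [← P.sum_one]
      exact Finset.sum_le_sum_of_subset_of_nonneg (Finset.subset_univ _)
        (fun x _ _ => (P.pos x).le)
    rw [Finset.sum_const, nsmul_eq_mul, Real.exp_neg] at h1
    have h3 := h1.trans h2
    rwa [mul_inv_le_iff₀ (Real.exp_pos _), one_mul] at h3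
  · intro x hx
    simp only [Finset.mem_filter, Finset.mem_univ, true_and] at hx
    rw [← Real.log_le_iff_le_exp (P.pos x)]
    linarith [(abs_lt.mp hx).1]

theorem aep (P : FinProb) (δ θ : ℝ) (hδ : 0 < δ) (hθ : 0 < θ) :
    ∃ n0 : ℕ, ∀ n : ℕ, n0 ≤ n → ∃ G : Finset (powSp P n).α,
      1 - θ ≤ ∑ x ∈ G, (powSp P n).p x ∧
      ((G.card : ℝ) ≤ Real.exp (n * (H1 P + δ))) ∧
      ∀ x ∈ G, (powSp P n).p x ≤ Real.exp (-(n * (H1 P - δ))) := by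
  obtain ⟨n0, hn0⟩ := exists_nat_ge (V1 P / (δ ^ 2 * θ))
  refine ⟨n0 + 1, fun n hn => ?_⟩
  have hn1 : (0 : ℝ) < n := by exact_mod_cast (by omega : 0 < n)
  have hn2 : V1 P / (δ ^ 2 * θ) ≤ n := hn0.trans (by exact_mod_cast (by omega : n0 ≤ n))
  obtain ⟨G, h1, h2, h3⟩ := cheb (powSp P n) (n * δ) (by positivity)
  refine ⟨G, ?_, ?_, ?_⟩
  · refine le_trans ?_ h1
    rw [V1_pow]
    have : n * V1 P / (n * δ) ^ 2 ≤ θ := by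
      rw [div_le_iff₀ (by positivity)] at hn2 ⊢
      nlinarith
    linarith
  · rw [H1_pow] at h2
    rwa [mul_add]
  · rw [H1_pow] at h3
    rwa [mul_sub]

theorem negMul_le (x : ℝ) (hx : 0 < x) : -(x * Real.log x) ≤ 1 := by
  have h := Real.one_sub_inv_le_log_of_pos hx
  have h2 : x * (1 - x⁻¹) ≤ x * Real.log x := mul_le_mul_of_nonneg_left h hx.le
  have h3 : x * (1 - x⁻¹) = x - 1 := by field_simp
  linarith

theorem H1_TSp_le (k : ℕ) (hk : 0 < k) (ε : ℝ) (hε : 0 < ε ∧ ε ≤ 1) :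
    H1 (TSp k hk ε hε) ≤ 2 + ε * Real.log k := by
  have hk' : (1 : ℝ) ≤ k := by exact_mod_cast hk
  have hlog := Real.log_nonneg hk'
  unfold H1
  rw [← Finset.sum_neg_distrib]
  have key : ∀ x : Fin k, -((TSp k hk ε hε).p x * Real.log ((TSp k hk ε hε).p x))
      ≤ (ε / k * Real.log k + 1 / k) + if x = ⟨0, hk⟩ then 1 else 0 := by
    intro x
    by_cases hx : x = ⟨0, hk⟩
    · rw [if_pos hx]
      have := negMul_le _ ((TSp k hk ε hε).pos x)
      have h2 : 0 ≤ ε / k * Real.log k := mul_nonneg (div_nonneg hε.1.le (by linarith)) hlog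
      have h3 : (0 : ℝ) ≤ 1 / k := by positivity
      linarith
    · have h1 : (TSp k hk ε hε).p x = ε / k := by simp [TSp, hx]
      rw [h1, if_neg hx, Real.log_div hε.1.ne' (by linarith)]
      have h2 := negMul_le ε hε.1
      have h3 : -(ε / k * (Real.log ε - Real.log k))
          = ε / k * Real.log k + (-(ε * Real.log ε)) / k := by ring
      rw [h3, add_zero]
      gcongr
  refine (Finset.sum_le_sum fun x _ => key x).trans ?_
  show ∑ x : Fin k, _ ≤ _
  rw [Finset.sum_add_distrib]
  simp
  field_simp
  linarith

theorem BE_T_mul (hH : IsBaselessEntropy H) (k l : ℕ) (hk : 0 < k) (hl : 0 < l) (hkl : 0 < k * l)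
    (ε : ℝ) (hε : 0 < ε ∧ ε ≤ 1) :
    H (TSp (k * l) hkl ε hε) ≤ H (TSp k hk ε hε) + H (TSp l hl ε hε) := by
  have hk' : (0 : ℝ) < k := by exact_mod_cast hk
  have hl' : (0 : ℝ) < l := by exact_mod_cast hl
  let e : Fin k × Fin l ≃ Fin (k * l) := finProdFinEquiv
  have he0 : e (⟨0, hk⟩, ⟨0, hl⟩) = ⟨0, hkl⟩ := by
    apply Fin.ext; simp [e, finProdFinEquiv]
  have hval : ∀ a b, (TSp (k * l) hkl ε hε).p (e (a, b))
      = ε / (k * l) + if a = ⟨0, hk⟩ then (if b = ⟨0, hl⟩ then 1 - ε else 0) else 0 := by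
    intro a b
    show ε / ((k * l : ℕ) : ℝ) + (if e (a, b) = ⟨0, hkl⟩ then 1 - ε else 0) = _
    rw [← he0]
    simp only [EmbeddingLike.apply_eq_iff_eq, Prod.mk.injEq]
    push_cast
    congr 1
    by_cases h1 : a = ⟨0, hk⟩ <;> by_cases h2 : b = ⟨0, hl⟩ <;> simp [h1, h2]
  have s1 : ∀ i : Fin k, ε / (k : ℝ) + (if i = (⟨0, hk⟩ : Fin k) then 1 - ε else 0)
      = ∑ z : Fin k × Fin l, if (e.symm (e z)).1 = i then (TSp (k * l) hkl ε hε).p (e z) else 0 := by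
    intro i
    rw [Fintype.sum_prod_type, Finset.sum_comm]
    simp only [Equiv.symm_apply_apply, hval]
    simp only [Finset.sum_ite_eq', Finset.mem_univ, if_true]
    rw [Finset.sum_add_distrib]
    by_cases hi : i = (⟨0, hk⟩ : Fin k)
    · simp [hi]; field_simp
    · simp [hi]; field_simp
  have s2 : ∀ i : Fin l, ε / (l : ℝ) + (if i = (⟨0, hl⟩ : Fin l) then 1 - ε else 0)
      = ∑ z : Fin k × Fin l, if (e.symm (e z)).2 = i then (TSp (k * l) hkl ε hε).p (e z) else 0 := by
    intro i
    rw [Fintype.sum_prod_type]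
    simp only [Equiv.symm_apply_apply, hval]
    simp only [Finset.sum_ite_eq', Finset.mem_univ, if_true]
    rw [Finset.sum_add_distrib]
    by_cases hi : i = (⟨0, hl⟩ : Fin l)
    · simp [hi]; field_simp
    · simp [hi]; field_simp
  refine BE_sub hH (R := TSp (k * l) hkl ε hε) (Q1 := TSp k hk ε hε) (Q2 := TSp l hl ε hε)
    (f := fun z => (e.symm z).1) (g := fun z => (e.symm z).2) ?_ ?_ ?_
  · intro i
    rw [Finset.sum_filter]
    have h1 := Equiv.sum_comp e (fun z : Fin (k * l) =>
      if (e.symm z).1 = i then (TSp (k * l) hkl ε hε).p z else 0)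
    refine Eq.trans ?_ h1
    exact Eq.trans (s1 i) (Finset.sum_congr rfl fun z _ => by congr)
  · intro i
    rw [Finset.sum_filter]
    have h1 := Equiv.sum_comp e (fun z : Fin (k * l) =>
      if (e.symm z).2 = i then (TSp (k * l) hkl ε hε).p z else 0)
    refine Eq.trans ?_ h1
    exact Eq.trans (s2 i) (Finset.sum_congr rfl fun z _ => by congr)
  · intro z z' h
    exact e.symm.injective (Prod.ext (congrArg Prod.fst h) (congrArg Prod.snd h))

theorem BE_T_pow (hH : IsBaselessEntropy H) (N : ℕ) (hN : 0 < N) (ε : ℝ) (hε : 0 < ε ∧ ε ≤ 1)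
    (m : ℕ) : ∀ (k : ℕ) (hk : 0 < k), k = N ^ m →
    H (TSp k hk ε hε) ≤ m • H (TSp N hN ε hε) := by
  induction m with
  | zero =>
    intro k hk h
    rw [BE_card_one hH _ (by simpa using h)]
    simp
  | succ m ih =>
    intro k hk h
    rw [pow_succ] at h
    subst h
    refine (BE_T_mul hH (N ^ m) N (pow_pos hN m) hN hk ε hε).trans ?_
    rw [succ_nsmul]
    gcongr
    exact ih _ _ rfl

theorem BE_uni_mul (hH : IsBaselessEntropy H) (k l : ℕ) (hk : 0 < k) (hl : 0 < l)
    (hkl : 0 < k * l) : H (USp (k * l) hkl) = H (USp k hk) + H (USp l hl) := by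
  rw [← hH.2.1]
  symm
  refine BE_iso hH (P := (USp k hk).prod (USp l hl)) (Q := USp (k * l) hkl)
    (finProdFinEquiv : Fin k × Fin l ≃ Fin (k * l)) ?_
  rintro ⟨a, b⟩
  rw [USp_p]
  show _ = (USp k hk).p a * (USp l hl).p b
  rw [USp_p, USp_p]
  push_cast
  rw [div_mul_div_comm, one_mul]

theorem BE_uni_two_pow (hH : IsBaselessEntropy H) (j : ℕ) :
    H (USp (2 ^ j) (pow_pos two_pos j)) = j • H (USp 2 two_pos) := by
  induction j with
  | zero => rw [BE_card_one hH _ (by simp)]; simp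
  | succ j ih =>
    rw [succ_nsmul, ← ih]
    exact BE_uni_mul hH (2 ^ j) 2 (pow_pos two_pos j) two_pos _

end BaselessProof3

section BaselessProof4

set_option linter.unusedSectionVars false

variable {W : Type} [AddCommGroup W] [PartialOrder W] [IsOrderedAddMonoid W]
  {H : FinProb → W}

/-- `x ≤ y` up to an asymptotic slack of `s` nats, measured by the one-bit element `u`. -/
def Slk (u : W) (s : ℝ) (x y : W) : Prop :=
  ∀ δ : ℝ, 0 < δ → ∃ n j : ℕ, 0 < n ∧ (j : ℝ) * Real.log 2 ≤ n * (s + δ) ∧ n • x ≤ n • y + j • u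

theorem Slk.mono {u : W} {s t : ℝ} {x y : W} (h : Slk u s x y) (hst : s ≤ t) : Slk u t x y := by
  intro δ hδ
  obtain ⟨n, j, hn, hj, hx⟩ := h δ hδ
  exact ⟨n, j, hn, hj.trans (by gcongr), hx⟩

theorem Slk.add {u : W} {s t : ℝ} {x y z w : W} (h : Slk u s x y) (h' : Slk u t z w) :
    Slk u (s + t) (x + z) (y + w) := by
  intro δ hδ
  obtain ⟨n, j, hn, hj, hx⟩ := h (δ / 2) (by linarith)
  obtain ⟨m, i, hm, hi, hy⟩ := h' (δ / 2) (by linarith)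
  refine ⟨m * n, m * j + n * i, Nat.mul_pos hm hn, ?_, ?_⟩
  · push_cast
    have hn' : (0 : ℝ) < n := by exact_mod_cast hn
    have hm' : (0 : ℝ) < m := by exact_mod_cast hm
    nlinarith [mul_le_mul_of_nonneg_left hj hm'.le, mul_le_mul_of_nonneg_left hi hn'.le]
  · have h1 := nsmul_le_nsmul_right hx m
    have h2 := nsmul_le_nsmul_right hy n
    have h3 := add_le_add h1 h2
    calc (m * n) • (x + z) = m • (n • x) + n • (m • z) := by
          rw [nsmul_add, mul_nsmul', mul_comm m n, mul_nsmul']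
      _ ≤ _ := h3
      _ = _ := by
          simp only [nsmul_add, add_nsmul, mul_nsmul']
          rw [show n • m • w = m • n • w by rw [← mul_nsmul', ← mul_nsmul', mul_comm]]
          abel

theorem Slk.of_diff {u : W} {s : ℝ} {x y x' y' : W} (h : Slk u s x y) (hd : x' + y ≤ x + y') :
    Slk u s x' y' := by
  intro δ hδ
  obtain ⟨n, j, hn, hj, hx⟩ := h δ hδ
  refine ⟨n, j, hn, hj, ?_⟩
  have h1 := nsmul_le_nsmul_right hd n
  rw [nsmul_add, nsmul_add] at h1
  have h2 : n • x' + n • y ≤ (n • y' + j • u) + n • y :=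
    h1.trans ((add_le_add_left hx _).trans (le_of_eq (by abel)))
  exact le_of_add_le_add_right h2

theorem Slk.scale {u : W} {s : ℝ} {x y : W} (m : ℕ) (hm : 0 < m)
    (h : Slk u (m * s) (m • x) (m • y)) : Slk u s x y := by
  intro δ hδ
  have hm' : (0 : ℝ) < m := by exact_mod_cast hm
  obtain ⟨n, j, hn, hj, hx⟩ := h (m * δ) (by positivity)
  refine ⟨n * m, j, Nat.mul_pos hn hm, ?_, ?_⟩
  · push_cast
    refine hj.trans (le_of_eq (by ring))
  · rwa [mul_nsmul', mul_nsmul']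

theorem nsmul_cancel (hIC : ∀ x y a b : W, (∀ n : ℕ, 0 < n → n • x + a ≤ n • y + b) → x ≤ y)
    {a b : W} (ha : 0 ≤ a) (hb : 0 ≤ b) (n : ℕ) (hn : 0 < n) (h : n • a ≤ n • b) : a ≤ b := by
  refine hIC a b 0 (n • a) fun m _ => ?_
  have e := Nat.div_add_mod m n
  have hr := (Nat.mod_lt m hn).le
  have h1 : m • a = (m / n) • (n • a) + (m % n) • a := by
    rw [← mul_nsmul', ← add_nsmul, mul_comm (m / n), e]
  have h2 : (m / n) • (n • b) ≤ m • b := by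
    rw [← mul_nsmul']
    exact nsmul_le_nsmul_left hb (Nat.div_mul_le_self m n)
  rw [add_zero, h1]
  exact add_le_add ((nsmul_le_nsmul_right h _).trans h2) (nsmul_le_nsmul_left ha hr)

theorem Slk.le (hIC : ∀ x y a b : W, (∀ n : ℕ, 0 < n → n • x + a ≤ n • y + b) → x ≤ y)
    {u x y : W} (hu : 0 ≤ u) (hx : 0 ≤ x) (hy : 0 ≤ y) (h : ∀ s : ℝ, 0 < s → Slk u s x y) :
    x ≤ y := by
  refine hIC x y 0 u fun k hk => ?_
  have hk' : (0 : ℝ) < k := by exact_mod_cast hk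
  have hl : 0 < Real.log 2 := Real.log_pos (by norm_num)
  obtain ⟨n, j, hn, hj, hxy⟩ := h (Real.log 2 / (2 * k)) (by positivity)
    (Real.log 2 / (2 * k)) (by positivity)
  have h1 : k * j ≤ n := by
    have h2 : (n : ℝ) * (Real.log 2 / (2 * k) + Real.log 2 / (2 * k)) = n / k * Real.log 2 := by
      field_simp; ring
    rw [h2] at hj
    have h3 := le_of_mul_le_mul_right hj hl
    rw [le_div_iff₀ hk'] at h3
    have : ((k * j : ℕ) : ℝ) ≤ n := by push_cast; linarith
    exact_mod_cast this
  rw [add_zero]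
  refine nsmul_cancel hIC (nsmul_nonneg hx k) (add_nonneg (nsmul_nonneg hy k) hu) n hn ?_
  have h4 := nsmul_le_nsmul_right hxy k
  calc n • k • x = k • n • x := by rw [← mul_nsmul', ← mul_nsmul', mul_comm]
    _ ≤ k • (n • y + j • u) := h4
    _ = n • k • y + (k * j) • u := by
        rw [nsmul_add, mul_nsmul', ← mul_nsmul', ← mul_nsmul' y, mul_comm]
    _ ≤ n • k • y + n • u := by
        gcongr
    _ = _ := by rw [nsmul_add]

theorem BE_stepC (hH : IsBaselessEntropy H) (N : ℕ) (hN : 0 < N) (ε : ℝ) (hε : 0 < ε ∧ ε ≤ 1)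
    (ε' : ℝ) (hε' : 0 < ε' ∧ ε' ≤ 1) :
    Slk (H (USp 2 two_pos)) (H1 (TSp N hN ε hε)) (H (TSp N hN ε hε)) (H (TSp N hN ε' hε')) := by
  intro δ hδ
  rcases Nat.lt_or_ge N 2 with hN1 | hN2
  · have hN1 : N = 1 := by omega
    refine ⟨1, 0, one_pos, ?_, ?_⟩
    · have := H1_nonneg (TSp N hN ε hε)
      push_cast; linarith
    · rw [BE_card_one hH (TSp N hN ε hε) (by rw [TSp_card, hN1])]
      rw [BE_card_one hH (TSp N hN ε' hε') (by rw [TSp_card, hN1])]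
      simp
  have hl : 0 < Real.log 2 := Real.log_pos (by norm_num)
  set P := TSp N hN ε hε with hP
  have hh := H1_nonneg P
  obtain ⟨n0, hn0⟩ := aep P (δ / 2) (ε' / 4) (by linarith) (by linarith [hε'.1])
  obtain ⟨n1, hn1⟩ := exists_nat_ge (Real.log 2 / (δ / 2))
  set m := n0 + n1 + 1 with hm
  have hm1 : (n1 : ℝ) ≤ m := by exact_mod_cast (by omega : n1 ≤ m)
  obtain ⟨G, hG1, hG2, _⟩ := hn0 m (by omega)
  have hmpos : (0 : ℝ) < m := by exact_mod_cast (by omega : 0 < m)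
  set j := ⌈m * (H1 P + δ / 2) / Real.log 2⌉₊ with hj
  have hj1 : (j : ℝ) < m * (H1 P + δ / 2) / Real.log 2 + 1 := Nat.ceil_lt_add_one (by positivity)
  have hj2 : m * (H1 P + δ / 2) / Real.log 2 ≤ j := Nat.le_ceil _
  rw [div_le_iff₀ hl] at hj2
  have hcard : Fintype.card (powSp P m).α = N ^ m := by rw [pow_card, TSp_card]
  refine ⟨m, j, by omega, ?_, ?_⟩
  · have h1 : (j : ℝ) * Real.log 2 ≤ (m * (H1 P + δ / 2) / Real.log 2 + 1) * Real.log 2 := by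
      gcongr
    have h2 : (m * (H1 P + δ / 2) / Real.log 2 + 1) * Real.log 2
      = m * (H1 P + δ / 2) + Real.log 2 := by field_simp
    have h3 := hn1.trans hm1
    rw [div_le_iff₀ (by linarith)] at h3
    linarith
  · have hX : 2 ≤ Fintype.card (powSp P m).α := by
      rw [hcard]
      calc 2 ≤ N := hN2
        _ = N ^ 1 := (pow_one N).symm
        _ ≤ N ^ m := Nat.pow_le_pow_right hN (by omega)
    have hGc : G.card ≤ 2 ^ j := by
      have h4 : ((2 ^ j : ℕ) : ℝ) = Real.exp (j * Real.log 2) := by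
        rw [Real.exp_nat_mul, Real.exp_log (by norm_num)]; push_cast; rfl
      have h5 : (G.card : ℝ) ≤ ((2 ^ j : ℕ) : ℝ) := by
        rw [h4]
        exact hG2.trans (Real.exp_le_exp.mpr hj2)
      exact_mod_cast h5
    have hA := BE_stepA hH (powSp P m) hX (2 ^ j) (pow_pos two_pos j) G hGc ε' hε'
      ⟨by linarith [hε'.1], by linarith [hε'.2]⟩ hG1
    rw [BE_pow hH, BE_uni_two_pow hH] at hA
    have hB := BE_T_pow hH N hN ε' hε' m _ (powSp P m).card_pos hcard
    have hC := BE_nonneg hH (TSp (2 ^ j) (pow_pos two_pos j) (ε' / 4)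
      ⟨by linarith [hε'.1], by linarith [hε'.2]⟩)
    calc m • H P ≤ m • H P + H (TSp (2 ^ j) (pow_pos two_pos j) (ε' / 4)
          ⟨by linarith [hε'.1], by linarith [hε'.2]⟩) := le_add_of_nonneg_right hC
      _ ≤ _ := hA
      _ ≤ j • H (USp 2 two_pos) + m • H (TSp N hN ε' hε') := by gcongr
      _ = _ := add_comm _ _

end BaselessProof4

section BaselessProof5

set_option linter.unusedSectionVars false

variable {W : Type} [AddCommGroup W] [PartialOrder W] [IsOrderedAddMonoid W]
  {H : FinProb → W}

theorem sum_T (S : ℕ) (hS : 0 < S) (η : ℝ) :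
    ∑ c : Fin S, (η / S + if c = (⟨0, hS⟩ : Fin S) then 1 - η else 0) = 1 := by
  have hS' : (0 : ℝ) < S := by exact_mod_cast hS
  rw [Finset.sum_add_distrib]
  simp
  field_simp
  ring

/-- Smoothing: remove the atypical atoms of `Y` by coupling with a peaked space. -/
theorem BE_smooth (hH : IsBaselessEntropy H) (Y : FinProb) (S : ℕ) (hS : 0 < S)
    (G : Finset Y.α) (hG : ∀ y ∈ G, Y.p y ≤ 1 / (2 * S)) (ε : ℝ) (hε : 0 < ε ∧ ε ≤ 1)
    (hGm : 1 - ε / 4 ≤ ∑ x ∈ G, Y.p x) :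
    ∃ (J : FinProb) (η : ℝ) (hη : 0 < η ∧ η ≤ 1), η ≤ ε ∧
      Fintype.card J.α = Fintype.card Y.α * S ∧ (∀ z, J.p z ≤ 1 / (2 * S)) ∧
      H J ≤ H Y + H (TSp S hS η hη) := by
  have hS' : (1 : ℝ) ≤ S := by exact_mod_cast hS
  let ηf : Y.α → ℝ := fun y => if y ∈ G then ε / 4 else 1
  have hηf0 : ∀ y, 0 < ηf y := by
    intro y; simp only [ηf]; split_ifs
    · linarith [hε.1]
    · exact one_pos
  have hηf1 : ∀ y, ηf y ≤ 1 := by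
    intro y; simp only [ηf]; split_ifs
    · linarith [hε.2]
    · exact le_rfl
  let T : ℝ → Fin S → ℝ := fun η c => η / S + if c = (⟨0, hS⟩ : Fin S) then 1 - η else 0
  have hTpos : ∀ η c, 0 < η → η ≤ 1 → 0 < T η c := by
    intro η c h0 h1
    have : 0 < η / S := div_pos h0 (by linarith)
    simp only [T]; split_ifs <;> linarith
  have hTsum : ∀ η, ∑ c, T η c = 1 := fun η => sum_T S hS η
  have hTle : ∀ η c, 0 < η → η ≤ 1 → T η c ≤ 1 := by
    intro η c h0 h1
    rw [← hTsum η]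
    exact Finset.single_le_sum (f := T η) (fun c _ => (hTpos η c h0 h1).le) (Finset.mem_univ c)
  let J : FinProb :=
    { α := Y.α × Fin S
      p := fun z => Y.p z.1 * T (ηf z.1) z.2
      pos := fun z => mul_pos (Y.pos _) (hTpos _ _ (hηf0 _) (hηf1 _))
      sum_one := by
        rw [Fintype.sum_prod_type]
        simp_rw [← Finset.mul_sum, hTsum, mul_one]
        exact Y.sum_one }
  have hηs : ∑ y, Y.p y * ηf y = (∑ y ∈ G, Y.p y) * (ε / 4) + (1 - ∑ y ∈ G, Y.p y) := by
    have h1 : ∀ y, Y.p y * ηf y = (if y ∈ G then Y.p y else 0) * (ε / 4 - 1) + Y.p y := by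
      intro y; simp only [ηf]; split_ifs <;> ring
    simp_rw [h1, Finset.sum_add_distrib, ← Finset.sum_mul, Y.sum_one]
    rw [Finset.sum_ite_mem, Finset.univ_inter]; ring
  have hg1 : ∑ y ∈ G, Y.p y ≤ 1 := by
    rw [← Y.sum_one]
    exact Finset.sum_le_sum_of_subset_of_nonneg (Finset.subset_univ _) fun x _ _ => (Y.pos x).le
  obtain ⟨y0⟩ : Nonempty Y.α := Fintype.card_pos_iff.mp Y.card_pos
  have hη0 : 0 < ∑ y, Y.p y * ηf y :=
    Finset.sum_pos (fun y _ => mul_pos (Y.pos y) (hηf0 y)) ⟨y0, Finset.mem_univ _⟩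
  have hηε : ∑ y, Y.p y * ηf y ≤ ε := by
    rw [hηs]
    nlinarith [hε.1]
  refine ⟨J, ∑ y, Y.p y * ηf y, ⟨hη0, hηε.trans hε.2⟩, hηε, ?_, ?_, ?_⟩
  · show Fintype.card (Y.α × Fin S) = _
    rw [Fintype.card_prod, Fintype.card_fin]
  · intro z
    show Y.p z.1 * T (ηf z.1) z.2 ≤ _
    by_cases hz : z.1 ∈ G
    · refine le_trans ?_ (hG _ hz)
      exact mul_le_of_le_one_right (Y.pos _).le (hTle _ _ (hηf0 _) (hηf1 _))
    · have h1 : T (ηf z.1) z.2 = 1 / S := by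
        simp only [T, ηf, if_neg hz]; simp
      have h2 : Y.p z.1 + ∑ y ∈ G, Y.p y ≤ 1 := by
        rw [← Finset.sum_insert hz, ← Y.sum_one]
        exact Finset.sum_le_sum_of_subset_of_nonneg (Finset.subset_univ _)
          fun x _ _ => (Y.pos x).le
      have h3 : Y.p z.1 ≤ 1 / 2 := by linarith [hε.2]
      rw [h1]
      calc Y.p z.1 * (1 / S) ≤ 1 / 2 * (1 / S) := by gcongr
        _ = _ := by field_simp
  · have s1 : ∀ y : Y.α, Y.p y
        = ∑ z : Y.α × Fin S, if z.1 = y then Y.p z.1 * T (ηf z.1) z.2 else 0 := by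
      intro y
      rw [Fintype.sum_prod_type, Finset.sum_comm]
      simp only [Finset.sum_ite_eq', Finset.mem_univ, if_true]
      rw [← Finset.mul_sum, hTsum, mul_one]
    have s2 : ∀ c : Fin S, T (∑ y, Y.p y * ηf y) c
        = ∑ z : Y.α × Fin S, if z.2 = c then Y.p z.1 * T (ηf z.1) z.2 else 0 := by
      intro c
      rw [Fintype.sum_prod_type]
      simp only [Finset.sum_ite_eq', Finset.mem_univ, if_true]
      simp only [T]
      split_ifs
      · simp_rw [mul_add, mul_sub, Finset.sum_add_distrib, Finset.sum_sub_distrib, mul_one,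
          Y.sum_one, ← mul_div_assoc]
        rw [Finset.sum_div]
      · simp only [add_zero, ← mul_div_assoc]
        rw [Finset.sum_div]
    refine BE_sub hH (R := J) (f := fun z => z.1) (g := fun z => z.2) ?_ ?_ ?_
    · intro y
      rw [Finset.sum_filter]
      exact Eq.trans (s1 y) (Finset.sum_congr rfl fun z _ => by congr)
    · intro c
      rw [Finset.sum_filter]
      exact Eq.trans (s2 c) (Finset.sum_congr rfl fun z _ => by congr)
    · intro z z' h
      exact Prod.ext (congrArg Prod.fst h) (congrArg Prod.snd h)

theorem BE_core (hH : IsBaselessEntropy H) (X Y : FinProb) (hXY : Fintype.card X.α ≤ Fintype.card Y.α)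
    (hX : 2 ≤ Fintype.card X.α) (S : ℕ) (hS : 0 < S) (ε : ℝ) (hε : 0 < ε ∧ ε ≤ 1)
    (G : Finset X.α) (hG : G.card ≤ S) (hGm : 1 - ε / 4 ≤ ∑ x ∈ G, X.p x)
    (G' : Finset Y.α) (hG' : ∀ y ∈ G', Y.p y ≤ 1 / (2 * S))
    (hGm' : 1 - ε / 4 ≤ ∑ x ∈ G', Y.p x) :
    Slk (H (USp 2 two_pos)) (6 + ε * (Real.log (Fintype.card X.α) + 2 * Real.log S))
      (H X) (H Y) := by
  have hS' : (1 : ℝ) ≤ S := by exact_mod_cast hS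
  have hlS := Real.log_nonneg hS'
  have hε4 : 0 < ε / 4 ∧ ε / 4 ≤ 1 := ⟨by linarith [hε.1], by linarith [hε.2]⟩
  have hA := BE_stepA hH X hX S hS G hG ε hε hε4 hGm
  obtain ⟨J, η, hη, hηε, hJc, hJm, hJ⟩ := BE_smooth hH Y S hS G' hG' ε hε hGm'
  have hJ2 : 2 ≤ Fintype.card J.α := by rw [hJc]; nlinarith
  obtain ⟨ε3, hε3, hB⟩ := BE_stepB hH J hJ2 S hS hJm ε hε
  obtain ⟨μ, hμ0, hμ⟩ := exists_min
    ((TSp S hS (ε / 4) hε4).prod (TSp (Fintype.card J.α) J.card_pos ε3 hε3))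
  have hε5 : 0 < min (μ / 3) 1 ∧ min (μ / 3) 1 ≤ 1 := ⟨by positivity, min_le_right _ _⟩
  set ε5 := min (μ / 3) 1 with hε5d
  have h53 : 3 * ε5 ≤ μ := by linarith [min_le_left (μ / 3) 1]
  set A := Fintype.card X.α with hAd
  obtain ⟨x1, hx1⟩ := TSp_zero A X.card_pos ε5 hε5
  obtain ⟨x2, hx2⟩ := TSp_zero S hS ε5 hε5
  have hP : H (((TSp A X.card_pos ε5 hε5).prod (TSp S hS ε5 hε5)).prod (TSp S hS ε5 hε5)) ≤
      H ((TSp S hS (ε / 4) hε4).prod (TSp (Fintype.card J.α) J.card_pos ε3 hε3)) := by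
    refine BE_peak hH _ _ ?_ ?_ ((x1, x2), x2) μ hμ ?_
    · simp only [prod_card, TSp_card]
      rw [hJc]
      calc A * S * S ≤ Fintype.card Y.α * S * S := by gcongr
        _ = _ := by ring
    · simp only [prod_card, TSp_card]
      nlinarith
    · show _ ≤ ((TSp A X.card_pos ε5 hε5).p x1 * (TSp S hS ε5 hε5).p x2) * (TSp S hS ε5 hε5).p x2
      have h0 : 0 ≤ 1 - ε5 := by linarith [hε5.2]
      have h1 : (1 - ε5) * (1 - ε5) * (1 - ε5) ≤
          ((TSp A X.card_pos ε5 hε5).p x1 * (TSp S hS ε5 hε5).p x2) * (TSp S hS ε5 hε5).p x2 := by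
        gcongr
        · exact mul_nonneg ((TSp A X.card_pos ε5 hε5).pos x1).le ((TSp S hS ε5 hε5).pos x2).le
        · exact ((TSp A X.card_pos ε5 hε5).pos x1).le
      refine le_trans ?_ h1
      nlinarith [hε5.1, hε5.2, mul_nonneg (mul_nonneg hε5.1.le hε5.1.le) (by linarith [hε5.2] : 0 ≤ 3 - ε5)]
  rw [hH.2.1, hH.2.1, hH.2.1] at hP
  have c1 := BE_stepC hH A X.card_pos ε hε ε5 hε5
  have c2 := BE_stepC hH S hS η hη ε5 hε5
  have c3 := BE_stepC hH S hS ε hε ε5 hε5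
  have c := (c1.add c2).add c3
  have hs : H1 (TSp A X.card_pos ε hε) + H1 (TSp S hS η hη) + H1 (TSp S hS ε hε)
      ≤ 6 + ε * (Real.log A + 2 * Real.log S) := by
    have b1 := H1_TSp_le A X.card_pos ε hε
    have b2 := H1_TSp_le S hS η hη
    have b3 := H1_TSp_le S hS ε hε
    have b4 : η * Real.log S ≤ ε * Real.log S := by gcongr
    linarith
  refine (c.mono hs).of_diff ?_
  have hsum := add_le_add (add_le_add (add_le_add hA hJ) hB) hP
  generalize H (TSp A X.card_pos ε5 hε5) = a1 at *
  generalize H (TSp S hS ε5 hε5) = a2 at *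
  generalize H (TSp A X.card_pos ε hε) = a3 at *
  generalize H (TSp S hS (ε / 4) hε4) = a4 at *
  generalize H (TSp (Fintype.card J.α) J.card_pos ε3 hε3) = a5 at *
  generalize H (TSp S hS η hη) = a6 at *
  generalize H (TSp S hS ε hε) = a7 at *
  refine le_of_add_le_add_right (a := a4 + a5 + H (USp S hS) + H J) ?_
  calc _ = _ := ?_
    _ ≤ _ := hsum
    _ = _ := ?_
  · abel
  · abel

end BaselessProof5

section BaselessProof6

set_option linter.unusedSectionVars false

variable {W : Type} [AddCommGroup W] [PartialOrder W] [IsOrderedAddMonoid W]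
  {H : FinProb → W}

theorem BE_strict (hIC : ∀ x y a b : W, (∀ n : ℕ, 0 < n → n • x + a ≤ n • y + b) → x ≤ y)
    (hH : IsBaselessEntropy H) (P Q : FinProb) (hc : Fintype.card P.α ≤ Fintype.card Q.α)
    (h : H1 P < H1 Q) : H P ≤ H Q := by
  rcases Nat.lt_or_ge (Fintype.card P.α) 2 with ha | ha
  · rw [BE_card_one hH P (by have := P.card_pos; omega)]
    exact BE_nonneg hH Q
  refine Slk.le hIC (BE_nonneg hH (USp 2 two_pos)) (BE_nonneg hH P) (BE_nonneg hH Q) fun κ hκ => ?_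
  have hh := H1_nonneg P
  set δ := (H1 Q - H1 P) / 4 with hδd
  have hδ : 0 < δ := by linarith
  set L := Real.log (Fintype.card P.α) with hL
  have hL0 : 0 ≤ L := Real.log_nonneg (by exact_mod_cast P.card_pos)
  have hD : 0 < L + 2 * H1 Q + 1 := by linarith
  set ε := min 1 (κ / (2 * (L + 2 * H1 Q + 1))) with hεd
  have hε : 0 < ε ∧ ε ≤ 1 := ⟨by positivity, min_le_left _ _⟩
  have hεκ : ε * (L + 2 * H1 Q) ≤ κ / 2 := by
    have h1 : ε ≤ κ / (2 * (L + 2 * H1 Q + 1)) := min_le_right _ _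
    rw [le_div_iff₀ (by positivity)] at h1
    nlinarith [hε.1]
  obtain ⟨n0, hn0⟩ := aep P δ (ε / 4) hδ (by linarith [hε.1])
  obtain ⟨n1, hn1⟩ := aep Q δ (ε / 4) hδ (by linarith [hε.1])
  obtain ⟨n2, hn2⟩ := exists_nat_ge (12 / κ)
  obtain ⟨n3, hn3⟩ := exists_nat_ge (Real.log 4 / (2 * δ))
  obtain ⟨n, h0n, h1n, h2n, h3n, hn⟩ : ∃ n : ℕ, n0 ≤ n ∧ n1 ≤ n ∧ n2 ≤ n ∧ n3 ≤ n ∧ 0 < n :=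
    ⟨n0 + n1 + n2 + n3 + 1, by omega, by omega, by omega, by omega, by omega⟩
  have hnr : (0 : ℝ) < n := by exact_mod_cast hn
  have hn2' : 12 / κ ≤ n := hn2.trans (by exact_mod_cast h2n)
  have hn3' : Real.log 4 / (2 * δ) ≤ n := hn3.trans (by exact_mod_cast h3n)
  rw [div_le_iff₀ hκ] at hn2'
  rw [div_le_iff₀ (by positivity)] at hn3'
  obtain ⟨G, hG1, hG2, -⟩ := hn0 n h0n
  obtain ⟨G', hG1', -, hG3'⟩ := hn1 n h1n
  set E := Real.exp (n * (H1 P + δ)) with hE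
  have hE1 : 1 ≤ E := Real.one_le_exp (by positivity)
  set S := ⌈E⌉₊ with hSd
  have hS : 0 < S := Nat.ceil_pos.mpr (by linarith)
  have hSr : (0 : ℝ) < S := by exact_mod_cast hS
  have hS1 : (S : ℝ) < E + 1 := Nat.ceil_lt_add_one (by linarith)
  have hS2 : E ≤ S := Nat.le_ceil _
  have h2S : (2 * S : ℝ) ≤ Real.exp (n * (H1 Q - δ)) := by
    have e1 : Real.exp (n * (H1 Q - δ)) = E * Real.exp (n * (2 * δ)) := by
      rw [hE, ← Real.exp_add]
      congr 1
      rw [hδd]; ring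
    have e2 : 4 ≤ Real.exp (n * (2 * δ)) := by
      rw [← Real.log_le_iff_le_exp (by norm_num)]; exact hn3'
    rw [e1]
    nlinarith
  have hlS : Real.log S ≤ n * H1 Q := by
    rw [Real.log_le_iff_le_exp hSr]
    have : Real.exp (n * (H1 Q - δ)) ≤ Real.exp (n * H1 Q) :=
      Real.exp_le_exp.mpr (by nlinarith)
    linarith
  have hcard : Fintype.card (powSp P n).α ≤ Fintype.card (powSp Q n).α := by
    rw [pow_card, pow_card]; gcongr
  have hX : 2 ≤ Fintype.card (powSp P n).α := by
    rw [pow_card]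
    calc 2 ≤ Fintype.card P.α := ha
      _ = Fintype.card P.α ^ 1 := (pow_one _).symm
      _ ≤ _ := Nat.pow_le_pow_right P.card_pos hn
  have core := BE_core hH (powSp P n) (powSp Q n) hcard hX S hS ε hε G
    (by exact_mod_cast hG2.trans hS2) hG1 G' (fun y hy => by
      refine (hG3' y hy).trans ?_
      rw [Real.exp_neg, one_div]
      exact inv_anti₀ (by positivity) h2S) hG1'
  rw [BE_pow hH, BE_pow hH] at core
  refine Slk.scale n hn (core.mono ?_)
  rw [pow_card]
  push_cast
  rw [Real.log_pow, ← hL]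
  have : ε * (n * L + 2 * Real.log S) ≤ ε * (n * L + 2 * (n * H1 Q)) := by
    have := hε.1
    gcongr
  nlinarith

/-- The explicit entropy of the spaces `TSp`. -/
noncomputable def fT (k : ℕ) (hk : 0 < k) (ε : ℝ) : ℝ :=
  ∑ i : Fin k, Real.negMulLog (ε / k + if i = (⟨0, hk⟩ : Fin k) then 1 - ε else 0)

theorem H1_TSp (k : ℕ) (hk : 0 < k) (ε : ℝ) (hε : 0 < ε ∧ ε ≤ 1) :
    H1 (TSp k hk ε hε) = fT k hk ε := by
  unfold H1 fT
  rw [← Finset.sum_neg_distrib]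
  refine Finset.sum_congr rfl fun i _ => ?_
  rw [Real.negMulLog, neg_mul]
  rfl

theorem fT_one (k : ℕ) (hk : 0 < k) : fT k hk 1 = Real.log k := by
  have hk' : (0 : ℝ) < k := by exact_mod_cast hk
  unfold fT
  simp [Real.negMulLog]
  field_simp

theorem fT_zero (k : ℕ) (hk : 0 < k) : fT k hk 0 = 0 := by
  unfold fT
  refine Finset.sum_eq_zero fun i _ => ?_
  split_ifs <;> simp

theorem exists_H1 (k : ℕ) (hk : 0 < k) (r : ℝ) (h0 : 0 < r) (h1 : r ≤ Real.log k) :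
    ∃ P : FinProb, Fintype.card P.α = k ∧ H1 P = r := by
  have hcont : Continuous (fT k hk) := by
    unfold fT
    refine continuous_finsetSum _ fun i _ => Real.continuous_negMulLog.comp ?_
    split_ifs <;> fun_prop
  have := intermediate_value_Icc (zero_le_one' ℝ) hcont.continuousOn
  rw [fT_zero, fT_one] at this
  obtain ⟨ε, ⟨hε0, hε1⟩, he⟩ := this ⟨h0.le, h1⟩
  have hpos : 0 < ε := by
    rcases hε0.lt_or_eq with h | h
    · exact h
    · rw [← h, fT_zero] at he; linarith
  exact ⟨TSp k hk ε ⟨hpos, hε1⟩, TSp_card _ _ _ _, by rw [H1_TSp, he]⟩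

theorem BE_key (hIC : ∀ x y a b : W, (∀ n : ℕ, 0 < n → n • x + a ≤ n • y + b) → x ≤ y)
    (hH : IsBaselessEntropy H) (P Q : FinProb) (hc : H0 P ≤ H0 Q)
    (h : H1 P ≤ H1 Q) : H P ≤ H Q := by
  have hc' : Fintype.card P.α ≤ Fintype.card Q.α := by
    unfold H0 at hc
    rw [Real.log_le_log_iff (by exact_mod_cast P.card_pos) (by exact_mod_cast Q.card_pos)] at hc
    exact_mod_cast hc
  refine hIC _ _ 0 (H (USp 2 two_pos)) fun n _ => ?_
  rw [add_zero, ← BE_pow hH, ← BE_pow hH, ← hH.2.1]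
  refine BE_strict hIC hH _ _ ?_ ?_
  · rw [prod_card, pow_card, pow_card, TSp_card]
    calc Fintype.card P.α ^ n ≤ Fintype.card Q.α ^ n := by gcongr
      _ ≤ _ := Nat.le_mul_of_pos_right _ two_pos
  · rw [H1_prod, H1_pow, H1_pow, H1_TSp, fT_one]
    have : (n : ℝ) * H1 P ≤ n * H1 Q := by gcongr
    have h2 : 0 < Real.log ((2 : ℕ) : ℝ) := Real.log_pos (by norm_num)
    linarith

theorem exists_real (g : logQR) : ∃ PQ : FinProb × FinProb,
    H0 PQ.1 = (g : ℝ × ℝ).1 + H0 PQ.2 ∧ H1 PQ.1 = (g : ℝ × ℝ).2 + H1 PQ.2 := by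
  obtain ⟨⟨x, r⟩, q, hq, hx⟩ := g
  simp only at hx ⊢
  obtain ⟨m, hm⟩ := exists_nat_ge (Real.exp (|r| + 1))
  have hmr : (0 : ℝ) < m := (Real.exp_pos _).trans_le hm
  have hmpos : 0 < m := by exact_mod_cast hmr
  have hlm : |r| + 1 ≤ Real.log m := (Real.le_log_iff_exp_le hmr).mpr hm
  obtain ⟨a, b, ha, hb, hqab⟩ : ∃ a b : ℕ, 0 < a ∧ 0 < b ∧ (q : ℝ) = a / b := by
    refine ⟨q.num.toNat, q.den, by have := Rat.num_pos.mpr hq; omega, q.den_pos, ?_⟩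
    have h1 : ((q.num.toNat : ℤ) : ℝ) = (q.num : ℝ) := by
      rw [Int.toNat_of_nonneg (Rat.num_pos.mpr hq).le]
    rw [← Int.cast_natCast (R := ℝ) q.num.toNat, h1, Rat.cast_def]
  have har : (0 : ℝ) < a := by exact_mod_cast ha
  have hbr : (0 : ℝ) < b := by exact_mod_cast hb
  have hla : 0 ≤ Real.log a := Real.log_nonneg (by exact_mod_cast ha)
  have hlb : 0 ≤ Real.log b := Real.log_nonneg (by exact_mod_cast hb)
  have la : Real.log ((a * m : ℕ) : ℝ) = Real.log a + Real.log m := by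
    push_cast; exact Real.log_mul har.ne' hmr.ne'
  have lb : Real.log ((b * m : ℕ) : ℝ) = Real.log b + Real.log m := by
    push_cast; exact Real.log_mul hbr.ne' hmr.ne'
  have r1 : max r 0 ≤ |r| := max_le (le_abs_self r) (abs_nonneg r)
  have r2 : max (-r) 0 ≤ |r| := max_le (neg_le_abs r) (abs_nonneg r)
  obtain ⟨P, hP0, hP1⟩ := exists_H1 (a * m) (Nat.mul_pos ha hmpos) (max r 0 + 1)
    (by positivity) (by rw [la]; linarith)
  obtain ⟨Q, hQ0, hQ1⟩ := exists_H1 (b * m) (Nat.mul_pos hb hmpos) (max (-r) 0 + 1)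
    (by positivity) (by rw [lb]; linarith)
  refine ⟨(P, Q), ?_, ?_⟩
  · simp only [H0]
    rw [hP0, hQ0, la, lb, hx, hqab, Real.log_div har.ne' hbr.ne']
    ring
  · simp only
    rw [hP1, hQ1]
    rcases le_total 0 r with h | h
    · rw [max_eq_left h, max_eq_right (by linarith)]; ring
    · rw [max_eq_right h, max_eq_left (by linarith)]; ring

end BaselessProof6


/-- Universal property: every baseless entropy `H` with values in an integrally closed
partially ordered abelian group factors uniquely through the pairing `P ↦ (H₀ P, H₁ P)`
via an order-preserving group homomorphism on `G = (log ℚ₊) × ℝ`. -/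
theorem baselessEntropy_factors_through_logQR {W : Type} [AddCommGroup W] [PartialOrder W]
    (hord : ∀ x y z : W, x ≤ y → x + z ≤ y + z)
    (hIC : ∀ x y a b : W, (∀ n : ℕ, 0 < n → n • x + a ≤ n • y + b) → x ≤ y)
    (H : FinProb → W) (hH : IsBaselessEntropy H) :
    ∃! F : logQR → W,
      (∀ a b : logQR, F (a + b) = F a + F b) ∧
      (∀ a b : logQR, (a : ℝ × ℝ) ≤ (b : ℝ × ℝ) → F a ≤ F b) ∧
      ∀ P : FinProb, H P = F ⟨(H0 P, H1 P), mem_logQR P⟩ := by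
  haveI : IsOrderedAddMonoid W :=
    { add_le_add_left := fun a b h c => hord a b c h }
  choose R hR0 hR1 using exists_real
  have key : ∀ P Q : FinProb, H0 P ≤ H0 Q → H1 P ≤ H1 Q → H P ≤ H Q := BE_key hIC hH
  have hmono : ∀ P Q P' Q' : FinProb, H0 P + H0 Q' ≤ H0 P' + H0 Q → H1 P + H1 Q' ≤ H1 P' + H1 Q →
      H P - H Q ≤ H P' - H Q' := by
    intro P Q P' Q' h0 h1
    have := key (P.prod Q') (P'.prod Q) (by rw [H0_prod, H0_prod]; exact h0)
      (by rw [H1_prod, H1_prod]; exact h1)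
    rw [hH.2.1, hH.2.1] at this
    rw [sub_le_sub_iff]
    exact this
  have hadd : ∀ a b : logQR, H (R (a + b)).1 - H (R (a + b)).2
      = (H (R a).1 - H (R a).2) + (H (R b).1 - H (R b).2) := by
    intro a b
    have e : (H (R a).1 - H (R a).2) + (H (R b).1 - H (R b).2)
        = H ((R a).1.prod (R b).1) - H ((R a).2.prod (R b).2) := by
      rw [hH.2.1, hH.2.1]; abel
    have k0 := hR0 (a + b)
    have k1 := hR1 (a + b)
    have c0 : ((a + b : logQR) : ℝ × ℝ).1 = (a : ℝ × ℝ).1 + (b : ℝ × ℝ).1 := rfl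
    have c1 : ((a + b : logQR) : ℝ × ℝ).2 = (a : ℝ × ℝ).2 + (b : ℝ × ℝ).2 := rfl
    have a0 := hR0 a
    have a1 := hR1 a
    have b0 := hR0 b
    have b1 := hR1 b
    rw [e]
    refine le_antisymm (hmono _ _ _ _ ?_ ?_) (hmono _ _ _ _ ?_ ?_) <;>
      simp only [H0_prod, H1_prod] <;> linarith
  refine ⟨fun g => H (R g).1 - H (R g).2, ⟨hadd, ?_, ?_⟩, ?_⟩
  · intro a b hab
    have a0 := hR0 a
    have a1 := hR1 a
    have b0 := hR0 b
    have b1 := hR1 b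
    have l0 : (a : ℝ × ℝ).1 ≤ (b : ℝ × ℝ).1 := hab.1
    have l1 : (a : ℝ × ℝ).2 ≤ (b : ℝ × ℝ).2 := hab.2
    exact hmono _ _ _ _ (by linarith) (by linarith)
  · intro P
    have a0 := hR0 ⟨(H0 P, H1 P), mem_logQR P⟩
    have a1 := hR1 ⟨(H0 P, H1 P), mem_logQR P⟩
    have e : H P = H (P.prod P) - H P := by rw [hH.2.1]; abel
    rw [e]
    simp only at a0 a1 ⊢
    refine le_antisymm (hmono _ _ _ _ ?_ ?_) (hmono _ _ _ _ ?_ ?_) <;>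
      simp only [H0_prod, H1_prod] <;> linarith
  · rintro F ⟨hFa, -, hFH⟩
    funext g
    have e : (⟨(H0 (R g).1, H1 (R g).1), mem_logQR _⟩ : logQR)
        = g + ⟨(H0 (R g).2, H1 (R g).2), mem_logQR _⟩ :=
      Subtype.ext (Prod.ext (hR0 g) (hR1 g))
    have h1 := hFH (R g).1
    have h2 := hFH (R g).2
    rw [e, hFa, ← h2] at h1
    exact eq_sub_of_add_eq h1.symm
end

section
/- Let p be a prime number and α, β : ℕ → ℕ finitely supported functions. Suppose the finite abelian group B = ⊕_{j ≥ 1} (ZMod (p^j))^{β(j)} is isomorphic to a subgroup of A = ⊕_{j ≥ 1} (ZMod (p^j))^{α(j)}. Then for every k ≥ 1, ∑_{j ≥ k} β(j) ≤ ∑_{j ≥ k} α(j). -/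
open DirectSum

namespace SubMult

/-- The index set of the layers `j` (shifted by one) with `k ≤ j + 1`. -/
def J (a : ℕ →₀ ℕ) (k : ℕ) : Finset ℕ :=
  (a.support.filter (fun j => k ≤ j)).image (fun j => j - 1)

lemma mem_J (a : ℕ →₀ ℕ) (k : ℕ) (hk : 1 ≤ k) (j : ℕ) :
    j ∈ J a k ↔ a (j + 1) ≠ 0 ∧ k ≤ j + 1 := by
  simp only [J, Finset.mem_image, Finset.mem_filter, Finsupp.mem_support_iff]
  constructor
  · rintro ⟨i, ⟨h1, h2⟩, rfl⟩
    have : i - 1 + 1 = i := by omega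
    rw [this]
    exact ⟨h1, h2⟩
  · intro h
    exact ⟨j + 1, h, by omega⟩

lemma sum_J (a : ℕ →₀ ℕ) (k : ℕ) (hk : 1 ≤ k) :
    ∑ j ∈ a.support.filter (fun j => k ≤ j), a j = ∑ j ∈ J a k, a (j + 1) := by
  rw [J, Finset.sum_image]
  · apply Finset.sum_congr rfl
    intro i hi
    have h2 := (Finset.mem_filter.mp hi).2
    have : i - 1 + 1 = i := by omega
    rw [this]
  · intro x hx y hy hxy
    have h1 := (Finset.mem_filter.mp (Finset.mem_coe.mp hx)).2
    have h2 := (Finset.mem_filter.mp (Finset.mem_coe.mp hy)).2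
    simp only at hxy
    omega

lemma card_idx (p : ℕ) (a : ℕ →₀ ℕ) (k : ℕ) (hk : 1 ≤ k) :
    Fintype.card ((Σ j : J a k, Fin (a (j.1 + 1))) → Fin p) =
      p ^ ∑ j ∈ a.support.filter (fun j => k ≤ j), a j := by
  rw [sum_J a k hk, Fintype.card_fun, Fintype.card_sigma, Fintype.card_fin]
  simp only [Fintype.card_fin]
  rw [Finset.sum_coe_sort (J a k) (fun j => a (j + 1))]

lemma torsion_eq (p : ℕ) (hp : p.Prime) (j : ℕ) (x y : ZMod (p ^ (j + 1)))
    (hx : p • x = 0) (hy : p • y = 0) (h : x.val / p ^ j = y.val / p ^ j) : x = y := by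
  have : NeZero (p ^ (j + 1)) := ⟨pow_ne_zero _ hp.ne_zero⟩
  have key : ∀ z : ZMod (p ^ (j + 1)), p • z = 0 → p ^ j ∣ z.val := by
    intro z hz
    have h1 : ((p * z.val : ℕ) : ZMod (p ^ (j + 1))) = 0 := by
      rw [Nat.cast_mul, ZMod.natCast_zmod_val, ← nsmul_eq_mul, hz]
    rw [ZMod.natCast_eq_zero_iff] at h1
    have h2 : p * p ^ j ∣ p * z.val := (dvd_of_eq (pow_succ' p j).symm).trans h1
    exact Nat.dvd_of_mul_dvd_mul_left hp.pos h2
  apply ZMod.val_injective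
  rw [← Nat.div_mul_cancel (key x hx), ← Nat.div_mul_cancel (key y hy), h]

/-- The element with coordinates `p ^ (j - m) * g (j, i)`. -/
noncomputable def elt (p : ℕ) (b : ℕ →₀ ℕ) (k m : ℕ)
    (g : (Σ j : J b k, Fin (b (j.1 + 1))) → Fin p) :
    ⨁ j : ℕ, (Fin (b (j + 1)) → ZMod (p ^ (j + 1))) :=
  DFinsupp.mk (J b k) (fun j i => ((p ^ (j.1 - m) * (g ⟨j, i⟩).1 : ℕ) : ZMod (p ^ (j.1 + 1))))

lemma elt_apply (p : ℕ) (b : ℕ →₀ ℕ) (k m : ℕ)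
    (g : (Σ j : J b k, Fin (b (j.1 + 1))) → Fin p) (j : ℕ) (hj : j ∈ J b k)
    (i : Fin (b (j + 1))) :
    elt p b k m g j i = ((p ^ (j - m) * (g ⟨⟨j, hj⟩, i⟩).1 : ℕ) : ZMod (p ^ (j + 1))) := by
  have : elt p b k m g j = _ := DFinsupp.mk_of_mem hj
  rw [this]

lemma elt_apply_not (p : ℕ) (b : ℕ →₀ ℕ) (k m : ℕ)
    (g : (Σ j : J b k, Fin (b (j.1 + 1))) → Fin p) (j : ℕ) (hj : j ∉ J b k) :
    elt p b k m g j = 0 := DFinsupp.mk_of_notMem hj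

lemma smul_coord (p : ℕ) (b : ℕ →₀ ℕ) (n : ℕ)
    (x : ⨁ j : ℕ, (Fin (b (j + 1)) → ZMod (p ^ (j + 1)))) (j : ℕ) (i : Fin (b (j + 1))) :
    (n • x) j i = n • (x j i) := by
  have : (n • x) j = n • x j := DFinsupp.smul_apply n x j
  rw [this, Pi.smul_apply]

lemma elt_torsion (p : ℕ) (b : ℕ →₀ ℕ) (k m : ℕ) (hk : k = m + 1)
    (g : (Σ j : J b k, Fin (b (j.1 + 1))) → Fin p) :
    p • (p ^ m • elt p b k m g) = 0 := by
  refine DFinsupp.ext fun j => funext fun i => ?_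
  rw [smul_coord, smul_coord]
  change _ = (0 : ZMod (p ^ (j + 1)))
  by_cases hj : j ∈ J b k
  · rw [elt_apply p b k m g j hj]
    have hj2 := ((mem_J b k (by omega) j).mp hj).2
    rw [nsmul_eq_mul, nsmul_eq_mul, ← Nat.cast_mul, ← Nat.cast_mul, ZMod.natCast_eq_zero_iff]
    refine ⟨(g ⟨⟨j, hj⟩, i⟩).1, ?_⟩
    have : j + 1 = 1 + m + (j - m) := by omega
    rw [this, pow_add, pow_add]
    ring
  · rw [elt_apply_not p b k m g j hj]
    simp

lemma elt_inj (p : ℕ) (hp : p.Prime) (b : ℕ →₀ ℕ) (k m : ℕ) (hk : k = m + 1)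
    (g g' : (Σ j : J b k, Fin (b (j.1 + 1))) → Fin p)
    (h : p ^ m • elt p b k m g = p ^ m • elt p b k m g') : g = g' := by
  funext ⟨⟨j, hj⟩, i⟩
  have hj2 := ((mem_J b k (by omega) j).mp hj).2
  have h1 : (p ^ m • elt p b k m g) j i = (p ^ m • elt p b k m g') j i := by rw [h]
  have hpm : p ^ m * p ^ (j - m) = p ^ j := by rw [← pow_add]; congr 1; omega
  have hlt : ∀ c : Fin p, p ^ j * c.1 < p ^ (j + 1) := fun c => by
    rw [pow_succ]; exact Nat.mul_lt_mul_of_pos_left c.2 (pow_pos hp.pos j)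
  rw [smul_coord, smul_coord, elt_apply p b k m g j hj, elt_apply p b k m g' j hj,
    nsmul_eq_mul, nsmul_eq_mul, ← Nat.cast_mul, ← Nat.cast_mul, ← mul_assoc, ← mul_assoc, hpm,
    ZMod.natCast_eq_natCast_iff] at h1
  have h2 := Nat.ModEq.eq_of_lt_of_lt h1 (hlt _) (hlt _)
  exact Fin.ext (Nat.eq_of_mul_eq_mul_left (pow_pos hp.pos j) h2)

end SubMult

/-- If the finite abelian `p`-group `⊕_{j ≥ 1} (ZMod (p^j))^{β j}` embeds into
`⊕_{j ≥ 1} (ZMod (p^j))^{α j}`, then for every `k ≥ 1`,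
`∑_{j ≥ k} β j ≤ ∑_{j ≥ k} α j`. -/
theorem subgroup_multiplicity_ineq (p : ℕ) (hp : p.Prime) (a b : ℕ →₀ ℕ)
    (h : ∃ f : (⨁ j : ℕ, (Fin (b (j + 1)) → ZMod (p ^ (j + 1)))) →+
        (⨁ j : ℕ, (Fin (a (j + 1)) → ZMod (p ^ (j + 1)))), Function.Injective f) :
    ∀ k : ℕ, 1 ≤ k →
      ∑ j ∈ b.support.filter (fun j => k ≤ j), b j ≤
        ∑ j ∈ a.support.filter (fun j => k ≤ j), a j := by
  obtain ⟨f, hf⟩ := h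
  intro k hk
  obtain ⟨m, hm⟩ : ∃ m, k = m + 1 := ⟨k - 1, by omega⟩
  have hlt : ∀ (j : ℕ) (x : ZMod (p ^ (j + 1))), x.val / p ^ j < p := by
    intro j x
    have : NeZero (p ^ (j + 1)) := ⟨pow_ne_zero _ hp.ne_zero⟩
    apply Nat.div_lt_of_lt_mul
    rw [← pow_succ]
    exact ZMod.val_lt x
  let Φ : ((Σ j : SubMult.J b k, Fin (b (j.1 + 1))) → Fin p) →
      ((Σ j : SubMult.J a k, Fin (a (j.1 + 1))) → Fin p) :=
    fun g s => ⟨(f (p ^ m • SubMult.elt p b k m g) s.1.1 s.2).val / p ^ s.1.1, hlt _ _⟩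
  have hΦ : Function.Injective Φ := by
    intro g g' hg
    apply SubMult.elt_inj p hp b k m hm
    apply hf
    refine DFinsupp.ext fun j => funext fun i => ?_
    have tor : ∀ g, p • (f (p ^ m • SubMult.elt p b k m g) j i) = 0 := by
      intro g
      rw [← SubMult.smul_coord, ← map_nsmul, SubMult.elt_torsion p b k m hm g, map_zero]
      rfl
    by_cases hj : j ∈ SubMult.J a k
    · apply SubMult.torsion_eq p hp j _ _ (tor g) (tor g')
      exact congrArg Fin.val (congrFun hg ⟨⟨j, hj⟩, i⟩)
    · have ha : a (j + 1) ≠ 0 := fun h0 => by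
        have := i.2
        omega
      have hjm : j + 1 ≤ m := by
        by_contra hc
        exact hj ((SubMult.mem_J a k hk j).mpr ⟨ha, by omega⟩)
      have zero : ∀ g, f (p ^ m • SubMult.elt p b k m g) j i = 0 := by
        intro g
        rw [map_nsmul, SubMult.smul_coord, nsmul_eq_mul,
          (ZMod.natCast_eq_zero_iff _ _).mpr (pow_dvd_pow p hjm), zero_mul]
      exact (zero g).trans (zero g').symm
  have hc := Fintype.card_le_of_injective Φ hΦ
  rw [SubMult.card_idx p b k hk, SubMult.card_idx p a k hk] at hc
  exact (Nat.pow_le_pow_iff_right hp.one_lt).mp hc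
end

section
/- Let P and Q be finite probability spaces with H₀(P) ≥ H₀(Q) and H₁(P) > H₁(Q). Then there exist a finite probability space (δ,r) and functions x₁ : δ → σ₁, x₂ : δ → σ₂, x₃ : δ → σ₃ (for some finite types σ₁, σ₂, σ₃) such that the finite probability space Q ⊗ (x₁⋆r) ⊗ (x₂⋆r) ⊗ (x₃⋆r) majorizes the finite probability space P ⊗ ((fun u ↦ (x₁ u, x₂ u, x₃ u))⋆r). -/
open scoped Classical NNReal
open Finset

open FinProb

namespace CatProof

/-- the normalized indicator of the first `N ^ t` indices -/
noncomputable def U (N t u : ℕ) : ℝ := if u < N ^ t then ((N : ℝ) ^ t)⁻¹ else 0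

lemma U_nonneg (N t u : ℕ) : 0 ≤ U N t u := by
  unfold U; split_ifs <;> positivity

lemma U_le (N t u : ℕ) : U N t u ≤ ((N : ℝ) ^ t)⁻¹ := by
  unfold U; split_ifs
  · exact le_rfl
  · positivity

lemma sum_ind {N L t : ℕ} (hN : 1 ≤ N) (ht : t ≤ L) (x : ℝ) :
    ∑ u : Fin (N ^ L), (if (u : ℕ) < N ^ t then x else 0) = (N : ℝ) ^ t * x := by
  rw [Fin.sum_univ_eq_sum_range (fun u => if u < N ^ t then x else 0) (N ^ L)]
  rw [← Finset.sum_filter]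
  have : (range (N ^ L)).filter (fun u => u < N ^ t) = range (N ^ t) := by
    ext u
    simp only [mem_filter, mem_range]
    have := Nat.pow_le_pow_right (n := N) (by omega) ht
    omega
  rw [this]
  simp

lemma sum_U {N L t : ℕ} (hN : 1 ≤ N) (ht : t ≤ L) :
    ∑ u : Fin (N ^ L), U N t u = 1 := by
  unfold U
  rw [sum_ind hN ht]
  have : (N : ℝ) ^ t ≠ 0 := by positivity
  field_simp

lemma UU_le {N : ℕ} (hN : 1 ≤ N) {i j l : ℕ} (h : l ≤ i + j) (u v : ℕ) :
    U N i u * U N j v ≤ ((N : ℝ) ^ l)⁻¹ := by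
  calc U N i u * U N j v ≤ ((N : ℝ) ^ i)⁻¹ * ((N : ℝ) ^ j)⁻¹ :=
        mul_le_mul (U_le ..) (U_le ..) (U_nonneg ..) (by positivity)
    _ = ((N : ℝ) ^ (i + j))⁻¹ := by rw [pow_add, mul_inv]
    _ ≤ _ := by
      apply inv_anti₀ (by positivity)
      apply pow_le_pow_right₀ _ h
      exact_mod_cast hN

/-- weight of the main level in the coupling -/
noncomputable def w0 (a J : ℕ) (θ : ℝ) : ℝ := 1 - 2 * a * θ - ∑ t ∈ range J, θ ^ (t + 1)

/-- the coupling, with low levels below `b` removed -/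
noncomputable def G (N a J : ℕ) (θ : ℝ) (b : ℕ) (u v : ℕ) : ℝ :=
  ∑ t ∈ Ico b a, (θ * (U N t u * U N a v) + θ * (U N a u * U N t v))
    + w0 a J θ * (U N a u * U N a v)
    + ∑ t ∈ range J, θ ^ (t + 1) * (U N (a + (t + 1)) u * U N (a + (t + 1)) v)

noncomputable def tau (a J : ℕ) (θ : ℝ) (t : ℕ) : ℝ :=
  if t < a then θ else if t = a then w0 a J θ + a * θ else θ ^ (t - a)

/-- marginal -/
noncomputable def marg (N a J : ℕ) (θ : ℝ) (u : ℕ) : ℝ :=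
  ∑ t ∈ range (a + J + 1), tau a J θ t * U N t u

lemma sum_tau_mul (a J : ℕ) (θ : ℝ) (f : ℕ → ℝ) :
    ∑ t ∈ range (a + J + 1), tau a J θ t * f t =
      ∑ t ∈ range a, θ * f t + (w0 a J θ + a * θ) * f a
        + ∑ t ∈ range J, θ ^ (t + 1) * f (a + (t + 1)) := by
  rw [add_assoc a J 1, Finset.sum_range_add, Finset.sum_range_succ', ← add_assoc, add_right_comm]
  congr 1
  · congr 1
    · apply Finset.sum_congr rfl
      intro t ht
      simp [tau, mem_range.mp ht]
    · simp [tau]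
  · apply Finset.sum_congr rfl
    intro t ht
    simp [tau]

lemma tau_sum (a J : ℕ) (θ : ℝ) : ∑ t ∈ range (a + J + 1), tau a J θ t = 1 := by
  have := sum_tau_mul a J θ (fun _ => 1)
  simp only [mul_one] at this
  rw [this]
  simp [w0]; ring

lemma G_sum_right {N a J : ℕ} (hN : 1 ≤ N) (θ : ℝ) (b u : ℕ) :
    ∑ v : Fin (N ^ (a + J)), G N a J θ b u v =
      ∑ t ∈ Ico b a, (θ * U N t u + θ * U N a u) + w0 a J θ * U N a u
        + ∑ t ∈ range J, θ ^ (t + 1) * U N (a + (t + 1)) u := by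
  unfold G
  rw [Finset.sum_add_distrib, Finset.sum_add_distrib, Finset.sum_comm]
  rw [Finset.sum_comm (t := range J)]
  congr 1
  · congr 1
    · apply Finset.sum_congr rfl
      intro t ht
      have ht := (mem_Ico.mp ht).2
      simp only [Finset.sum_add_distrib, ← Finset.mul_sum]
      rw [sum_U hN (by omega), sum_U hN (by omega)]; ring
    · simp only [← Finset.mul_sum]
      rw [sum_U hN (by omega)]; ring
  · apply Finset.sum_congr rfl
    intro t ht
    have ht := mem_range.mp ht
    simp only [← Finset.mul_sum]
    rw [sum_U hN (by omega)]; ring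

lemma G_symm (N a J : ℕ) (θ : ℝ) (b u v : ℕ) : G N a J θ b u v = G N a J θ b v u := by
  unfold G
  congr 1
  · congr 1
    · apply Finset.sum_congr rfl; intros; ring
    · ring
  · apply Finset.sum_congr rfl; intros; ring

lemma G_marg {N a J : ℕ} (hN : 1 ≤ N) (θ : ℝ) (u : ℕ) :
    ∑ v : Fin (N ^ (a + J)), G N a J θ 0 u v = marg N a J θ u := by
  rw [G_sum_right hN, marg, sum_tau_mul]
  simp only [Nat.Ico_zero_eq_range, Finset.sum_add_distrib, Finset.sum_const, card_range,
    nsmul_eq_mul]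
  ring

lemma G_marg' {N a J : ℕ} (hN : 1 ≤ N) (θ : ℝ) (v : ℕ) :
    ∑ u : Fin (N ^ (a + J)), G N a J θ 0 u v = marg N a J θ v := by
  rw [← G_marg hN]
  exact Finset.sum_congr rfl fun u _ => G_symm ..

lemma G_sum {N a J : ℕ} (hN : 1 ≤ N) (θ : ℝ) {b : ℕ} (hb : b ≤ a) :
    ∑ u : Fin (N ^ (a + J)), ∑ v : Fin (N ^ (a + J)), G N a J θ b u v = 1 - 2 * θ * b := by
  simp only [G_sum_right hN]
  rw [Finset.sum_add_distrib, Finset.sum_add_distrib, Finset.sum_comm]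
  rw [Finset.sum_comm (t := range J)]
  have e1 : ∑ t ∈ Ico b a, ∑ u : Fin (N ^ (a + J)), (θ * U N t u + θ * U N a u)
      = (a - b) * (2 * θ) := by
    rw [Finset.sum_congr rfl (g := fun _ => 2 * θ)]
    · simp [Nat.cast_sub hb]
    · intro t ht
      have ht := (mem_Ico.mp ht).2
      rw [Finset.sum_add_distrib, ← Finset.mul_sum, ← Finset.mul_sum, sum_U hN (by omega),
        sum_U hN (by omega)]; ring
  have e2 : ∑ t ∈ range J, ∑ u : Fin (N ^ (a + J)), θ ^ (t + 1) * U N (a + (t + 1)) u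
      = ∑ t ∈ range J, θ ^ (t + 1) := by
    apply Finset.sum_congr rfl
    intro t ht
    have ht := mem_range.mp ht
    rw [← Finset.mul_sum, sum_U hN (by omega), mul_one]
  rw [e1, e2, ← Finset.mul_sum, sum_U hN (by omega), w0]
  ring

lemma G_le {N a J : ℕ} (hN : 1 ≤ N) {θ : ℝ} (hθ : 0 ≤ θ) (hw : 0 ≤ w0 a J θ) {b l : ℕ}
    (hb : l ≤ b + a) (hl : l ≤ 2 * a) (u v : ℕ) :
    G N a J θ b u v ≤ ((N : ℝ) ^ l)⁻¹ := by
  have key : G N a J θ b u v ≤ ∑ t ∈ Ico b a, (θ * ((N : ℝ) ^ l)⁻¹ + θ * ((N : ℝ) ^ l)⁻¹)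
    + w0 a J θ * ((N : ℝ) ^ l)⁻¹ + ∑ t ∈ range J, θ ^ (t + 1) * ((N : ℝ) ^ l)⁻¹ := by
    unfold G
    apply add_le_add
    · apply add_le_add
      · apply Finset.sum_le_sum
        intro t ht
        have ht := mem_Ico.mp ht
        exact add_le_add (mul_le_mul_of_nonneg_left (UU_le hN (by omega) _ _) hθ)
          (mul_le_mul_of_nonneg_left (UU_le hN (by omega) _ _) hθ)
      · exact mul_le_mul_of_nonneg_left (UU_le hN (by omega) _ _) hw
    · apply Finset.sum_le_sum
      intro t ht
      exact mul_le_mul_of_nonneg_left (UU_le hN (by omega) _ _) (by positivity)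
  refine key.trans ?_
  rw [← Finset.sum_mul, Finset.sum_const, Nat.card_Ico, nsmul_eq_mul]
  have h2 : ((a - b : ℕ) : ℝ) ≤ a := by exact_mod_cast Nat.sub_le a b
  have h3 : (0 : ℝ) ≤ ((N : ℝ) ^ l)⁻¹ := by positivity
  have : ((a - b : ℕ) : ℝ) * (2 * θ) ≤ a * (2 * θ) := by gcongr
  calc _ = (((a - b : ℕ) : ℝ) * (2 * θ) + w0 a J θ + ∑ t ∈ range J, θ ^ (t + 1)) *
        ((N : ℝ) ^ l)⁻¹ := by ring
    _ ≤ 1 * ((N : ℝ) ^ l)⁻¹ := by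
      apply mul_le_mul_of_nonneg_right _ h3
      unfold w0; linarith
    _ = _ := one_mul _

lemma G_nonneg (N : ℕ) {a J : ℕ} {θ : ℝ} (hθ : 0 ≤ θ) (hw : 0 ≤ w0 a J θ) (b u v : ℕ) :
    0 ≤ G N a J θ b u v := by
  unfold G
  have := U_nonneg N
  have h1 : ∀ t, 0 ≤ θ * (U N t u * U N a v) + θ * (U N a u * U N t v) := fun t =>
    add_nonneg (mul_nonneg hθ (mul_nonneg (this _ _) (this _ _)))
      (mul_nonneg hθ (mul_nonneg (this _ _) (this _ _)))
  refine add_nonneg (add_nonneg (Finset.sum_nonneg fun t _ => h1 t)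
    (mul_nonneg hw (mul_nonneg (this _ _) (this _ _)))) (Finset.sum_nonneg fun t _ => ?_)
  exact mul_nonneg (by positivity) (mul_nonneg (this _ _) (this _ _))

lemma G_mono (N : ℕ) {a J : ℕ} {θ : ℝ} (hθ : 0 ≤ θ) (b u v : ℕ) :
    G N a J θ b u v ≤ G N a J θ 0 u v := by
  unfold G
  have := U_nonneg N
  gcongr
  · intro t _ _
    exact add_nonneg (mul_nonneg hθ (mul_nonneg (this _ _) (this _ _)))
      (mul_nonneg hθ (mul_nonneg (this _ _) (this _ _)))
  · omega

lemma G_ge (N : ℕ) {a J : ℕ} {θ : ℝ} (hθ : 0 ≤ θ) (hw : 0 ≤ w0 a J θ) {t : ℕ}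
    (ht : 1 ≤ t) (htJ : t ≤ J) (u v : ℕ) :
    θ ^ t * (U N (a + t) u * U N (a + t) v) ≤ G N a J θ 0 u v := by
  unfold G
  have := U_nonneg N
  have h1 : 0 ≤ ∑ t ∈ Ico 0 a, (θ * (U N t u * U N a v) + θ * (U N a u * U N t v)) :=
    Finset.sum_nonneg fun t _ => add_nonneg (mul_nonneg hθ (mul_nonneg (this _ _) (this _ _)))
      (mul_nonneg hθ (mul_nonneg (this _ _) (this _ _)))
  have h2 : 0 ≤ w0 a J θ * (U N a u * U N a v) :=
    (mul_nonneg hw (mul_nonneg (this _ _) (this _ _)))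
  have h3 := Finset.single_le_sum
    (f := fun t => θ ^ (t + 1) * (U N (a + (t + 1)) u * U N (a + (t + 1)) v)) (s := range J)
    (fun t _ => mul_nonneg (by positivity) (mul_nonneg (this _ _) (this _ _)))
    (mem_range.mpr (show t - 1 < J by omega))
  have e : t - 1 + 1 = t := by omega
  simp only [e] at h3
  linarith

end CatProof

namespace CatProof

lemma min_sum_le {κ : Type*} (s : Finset κ) (x : κ → ℝ) (hx : ∀ k ∈ s, 0 ≤ x k) {c : ℝ}
    (hc : 0 ≤ c) : min (∑ k ∈ s, x k) c ≤ ∑ k ∈ s, min (x k) c := by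
  induction s using Finset.induction_on with
  | empty => simp
  | insert k s hk ih =>
    rw [Finset.sum_insert hk, Finset.sum_insert hk]
    have h1 := ih fun k' hk' => hx k' (mem_insert_of_mem hk')
    have h2 := hx k (mem_insert_self k s)
    have h3 : 0 ≤ ∑ k ∈ s, x k := Finset.sum_nonneg fun k' hk' => hx k' (mem_insert_of_mem hk')
    refine le_trans ?_ (add_le_add le_rfl h1)
    rcases min_cases (x k) c with h | h <;> rcases min_cases (∑ k ∈ s, x k) c with h' | h' <;>
      rcases min_cases (x k + ∑ k ∈ s, x k) c with h'' | h'' <;> linarith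

section
variable {N a J : ℕ} {θ : ℝ}

lemma w0_ge (hθ : 0 ≤ θ) (hθ1 : θ ≤ 1) : 1 - (2 * a + J) * θ ≤ w0 a J θ := by
  have : ∑ t ∈ range J, θ ^ (t + 1) ≤ ∑ t ∈ range J, θ := by
    apply Finset.sum_le_sum
    intro t _
    rw [pow_succ]
    exact mul_le_of_le_one_left hθ (pow_le_one₀ hθ hθ1)
  simp at this
  unfold w0
  linarith

lemma w0_le (hθ : 0 ≤ θ) : w0 a J θ ≤ 1 - 2 * a * θ := by
  have : 0 ≤ ∑ t ∈ range J, θ ^ (t + 1) := Finset.sum_nonneg fun t _ => by positivity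
  unfold w0
  linarith

lemma tau_pos (hθ : 0 < θ) (hw : 0 < w0 a J θ) (t : ℕ) : 0 < tau a J θ t := by
  unfold tau; split_ifs <;> positivity

lemma tau_le (hθ : 0 ≤ θ) (hθ1 : θ ≤ 1) (t : ℕ) : tau a J θ t ≤ θ ^ (t - a) := by
  unfold tau
  split_ifs with h1 h2
  · rw [Nat.sub_eq_zero_of_le h1.le]; simpa using hθ1
  · subst h2
    have := w0_le (a := t) (J := J) hθ
    have : 0 ≤ t * θ := by positivity
    simp; linarith
  · exact le_rfl

lemma tau_mul_le (hθ : 0 < θ) (hθ1 : θ ≤ 1) (hw : 0 < w0 a J θ) (i j : ℕ) :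
    tau a J θ i * tau a J θ j ≤ θ ^ (i + j - 2 * a) := by
  calc _ ≤ θ ^ (i - a) * θ ^ (j - a) :=
        mul_le_mul (tau_le hθ.le hθ1 i) (tau_le hθ.le hθ1 j) (tau_pos hθ hw j).le (by positivity)
    _ = θ ^ ((i - a) + (j - a)) := by rw [pow_add]
    _ ≤ _ := pow_le_pow_of_le_one hθ.le hθ1 (by omega)

/-- contribution of a pair of levels -/
noncomputable def ee {ι : Type} [Fintype ι] (A : ι → ℝ) (N a J : ℕ) (θ c : ℝ) (i j : ℕ) : ℝ :=
  (N : ℝ) ^ (i + j) * ∑ k, min (A k * (tau a J θ i * tau a J θ j / (N : ℝ) ^ (i + j))) c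

lemma sum_min_UU (hN : 1 ≤ N) {L i j : ℕ} (hi : i ≤ L) (hj : j ≤ L) {x y c : ℝ}
    (hc : 0 ≤ c) :
    ∑ u : Fin (N ^ L), ∑ v : Fin (N ^ L), min (y * (x * (U N i u * U N j v))) c =
      (N : ℝ) ^ (i + j) * min (y * (x / (N : ℝ) ^ (i + j))) c := by
  have : ∀ u v : ℕ, min (y * (x * (U N i u * U N j v))) c =
      if u < N ^ i then (if v < N ^ j then min (y * (x / (N : ℝ) ^ (i + j))) c else 0) else 0 := by
    intro u v
    unfold U
    split_ifs
    · rw [pow_add, div_eq_mul_inv, mul_inv]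
    · simp [hc]
    · simp [hc]
    · simp [hc]
  simp only [this]
  have h2 : ∀ u : ℕ, ∑ v : Fin (N ^ L), (if u < N ^ i then
      (if (v : ℕ) < N ^ j then min (y * (x / (N : ℝ) ^ (i + j))) c else 0) else 0) =
      if u < N ^ i then (N : ℝ) ^ j * min (y * (x / (N : ℝ) ^ (i + j))) c else 0 := by
    intro u
    split_ifs
    · rw [sum_ind hN hj]
    · simp
  simp only [h2]
  rw [sum_ind hN hi, pow_add]; ring

lemma lhs_le {ι : Type} [Fintype ι] {A : ι → ℝ} (hA : ∀ k, 0 ≤ A k) (hN : 1 ≤ N) (hθ : 0 < θ)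
    (hw : 0 < w0 a J θ) {c : ℝ} (hc : 0 ≤ c) :
    ∑ k, ∑ u : Fin (N ^ (a + J)), ∑ v : Fin (N ^ (a + J)),
      min (A k * (marg N a J θ u * marg N a J θ v)) c ≤
    ∑ p ∈ range (a + J + 1) ×ˢ range (a + J + 1), ee A N a J θ c p.1 p.2 := by
  have h1 : ∀ k, ∀ u v : ℕ, min (A k * (marg N a J θ u * marg N a J θ v)) c ≤
      ∑ p ∈ range (a + J + 1) ×ˢ range (a + J + 1),
        min (A k * (tau a J θ p.1 * tau a J θ p.2 * (U N p.1 u * U N p.2 v))) c := by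
    intro k u v
    have : A k * (marg N a J θ u * marg N a J θ v) =
      ∑ p ∈ range (a + J + 1) ×ˢ range (a + J + 1),
        A k * (tau a J θ p.1 * tau a J θ p.2 * (U N p.1 u * U N p.2 v)) := by
      unfold marg
      rw [Finset.sum_mul_sum, ← Finset.sum_product', Finset.mul_sum]
      apply Finset.sum_congr rfl
      intros; ring
    rw [this]
    apply min_sum_le _ _ _ hc
    intro p _
    exact mul_nonneg (hA k) (mul_nonneg (mul_nonneg (tau_pos hθ hw _).le (tau_pos hθ hw _).le)
      (mul_nonneg (U_nonneg ..) (U_nonneg ..)))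
  calc _ ≤ ∑ k, ∑ u : Fin (N ^ (a + J)), ∑ v : Fin (N ^ (a + J)),
      ∑ p ∈ range (a + J + 1) ×ˢ range (a + J + 1),
        min (A k * (tau a J θ p.1 * tau a J θ p.2 * (U N p.1 u * U N p.2 v))) c :=
        Finset.sum_le_sum fun k _ => Finset.sum_le_sum fun u _ => Finset.sum_le_sum fun v _ =>
          h1 k u v
    _ = ∑ k, ∑ p ∈ range (a + J + 1) ×ˢ range (a + J + 1),
      ∑ u : Fin (N ^ (a + J)), ∑ v : Fin (N ^ (a + J)),
        min (A k * (tau a J θ p.1 * tau a J θ p.2 * (U N p.1 u * U N p.2 v))) c := by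
        apply Finset.sum_congr rfl
        intro k _
        symm
        rw [Finset.sum_comm]
        apply Finset.sum_congr rfl
        intro u _
        rw [Finset.sum_comm]
    _ = _ := by
        rw [Finset.sum_comm]
        apply Finset.sum_congr rfl
        intro p hp
        have hp := mem_product.mp hp
        have h1 := mem_range.mp hp.1
        have h2 := mem_range.mp hp.2
        unfold ee
        rw [Finset.mul_sum]
        apply Finset.sum_congr rfl
        intro k _
        exact sum_min_UU hN (by omega) (by omega) hc

lemma ee_le_tau {ι : Type} [Fintype ι] {A : ι → ℝ} (hA1 : ∑ k, A k = 1) (hN : 1 ≤ N)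
    (c : ℝ) (i j : ℕ) : ee A N a J θ c i j ≤ tau a J θ i * tau a J θ j := by
  unfold ee
  calc _ ≤ (N : ℝ) ^ (i + j) * ∑ k, (A k * (tau a J θ i * tau a J θ j / (N : ℝ) ^ (i + j))) := by
        gcongr; exact min_le_left _ _
    _ = _ := by
      rw [← Finset.sum_mul, hA1, one_mul]
      have : (N : ℝ) ^ (i + j) ≠ 0 := by positivity
      field_simp

lemma ee_le_card {ι : Type} [Fintype ι] {A : ι → ℝ}
    (c : ℝ) (i j : ℕ) : ee A N a J θ c i j ≤ c * Fintype.card ι * (N : ℝ) ^ (i + j) := by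
  unfold ee
  calc _ ≤ (N : ℝ) ^ (i + j) * ∑ k : ι, c := by
        gcongr; exact min_le_right _ _
    _ = _ := by
      simp; ring

lemma ee_le_mix {ι : Type} [Fintype ι] {A : ι → ℝ} (hN : 1 ≤ N) (hθ : 0 < θ)
    (hw : 0 < w0 a J θ) {c δ K : ℝ} (hc : 0 ≤ c)
    (hA : ∀ x, 0 ≤ x → ∑ k, min (A k) x ≤ δ + K * x)
    (i j : ℕ) : ee A N a J θ c i j ≤
      δ * (tau a J θ i * tau a J θ j) + c * K * (N : ℝ) ^ (i + j) := by
  unfold ee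
  have hp := mul_pos (tau_pos hθ hw i) (tau_pos hθ hw j)
  generalize tau a J θ i * tau a J θ j = w at *
  have hn : 0 < (N : ℝ) ^ (i + j) := by positivity
  generalize (N : ℝ) ^ (i + j) = n at *
  have hq : 0 < w / n := by positivity
  have : ∀ k, min (A k * (w / n)) c = min (A k) (c / (w / n)) * (w / n) := by
    intro k
    rw [min_mul_of_nonneg _ _ hq.le, div_mul_cancel₀ _ hq.ne']
  simp only [this]
  rw [← Finset.sum_mul]
  calc _ ≤ n * ((δ + K * (c / (w / n))) * (w / n)) := by
        gcongr
        exact hA _ (by positivity)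
    _ = _ := by field_simp

lemma rhs_ge {ι : Type} [Fintype ι] {B : ι → ℝ} (hB : ∀ k, 0 ≤ B k) {n : ℕ}
    (f g : Fin n → Fin n → ℝ) (hg : ∀ u v, 0 ≤ g u v) (hgf : ∀ u v, g u v ≤ f u v) {b κ c : ℝ}
    (hgb : ∀ u v, g u v ≤ b) (hκ : κ * b ≤ c) (hc : 0 ≤ c) :
    (∑ k with B k ≤ κ, B k) * (∑ u, ∑ v, g u v) ≤
      ∑ k, ∑ u, ∑ v, min (B k * f u v) c := by
  rw [Finset.sum_mul]
  refine le_trans ?_ (Finset.sum_le_sum_of_subset_of_nonneg (Finset.filter_subset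
    (fun k => B k ≤ κ) univ) ?_)
  · apply Finset.sum_le_sum
    intro k hk
    have hk := (mem_filter.mp hk).2
    simp only [Finset.mul_sum]
    refine Finset.sum_le_sum fun u _ => Finset.sum_le_sum fun v _ => le_min ?_ ?_
    · exact mul_le_mul_of_nonneg_left (hgf u v) (hB k)
    · exact (mul_le_mul hk (hgb u v) (hg u v) ((hB k).trans hk)).trans hκ
  · intro k _ _
    exact Finset.sum_nonneg fun u _ => Finset.sum_nonneg fun v _ =>
      le_min (mul_nonneg (hB k) ((hg u v).trans (hgf u v))) hc

end
end CatProof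

namespace CatProof
section
variable {N a J : ℕ} {θ : ℝ}

lemma head_bound {ι : Type} [Fintype ι] {A : ι → ℝ} (hA1 : ∑ k, A k = 1) (hN : 1 ≤ N)
    (hθ : 0 < θ) (hw : 0 < w0 a J θ) {c δ K : ℝ} (hc : 0 ≤ c) (hK : 0 ≤ K) (hδ : 0 ≤ δ)
    (hA : ∀ x, 0 ≤ x → ∑ k, min (A k) x ≤ δ + K * x) (l : ℕ)
    (S : Finset (ℕ × ℕ)) (hS : S ⊆ range (a + J + 1) ×ˢ range (a + J + 1))
    (hSl : ∀ p ∈ S, p.1 + p.2 ≤ l) :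
    ∑ p ∈ range (a + J + 1) ×ˢ range (a + J + 1), ee A N a J θ c p.1 p.2 ≤
      1 - ∑ p ∈ S, tau a J θ p.1 * tau a J θ p.2 + δ
        + ((a + J + 1 : ℕ) : ℝ) ^ 2 * (c * K * (N : ℝ) ^ l) := by
  have hF : ∑ p ∈ range (a + J + 1) ×ˢ range (a + J + 1), tau a J θ p.1 * tau a J θ p.2 = 1 := by
    rw [Finset.sum_product, ← Finset.sum_mul_sum, tau_sum, mul_one]
  have hT : ∀ p : ℕ × ℕ, 0 ≤ tau a J θ p.1 * tau a J θ p.2 := fun p =>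
    (mul_pos (tau_pos hθ hw _) (tau_pos hθ hw _)).le
  have hN' : (1 : ℝ) ≤ N := by exact_mod_cast hN
  calc _ ≤ ∑ p ∈ range (a + J + 1) ×ˢ range (a + J + 1),
      (tau a J θ p.1 * tau a J θ p.2 - (if p ∈ S then tau a J θ p.1 * tau a J θ p.2 else 0)
        + δ * (tau a J θ p.1 * tau a J θ p.2) + c * K * (N : ℝ) ^ l) := by
        apply Finset.sum_le_sum
        intro p hp
        have h0 : 0 ≤ δ * (tau a J θ p.1 * tau a J θ p.2) := mul_nonneg hδ (hT p)
        split_ifs with h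
        · have h1 := ee_le_mix (A := A) hN hθ hw hc hA p.1 p.2
          have h2 : c * K * (N : ℝ) ^ (p.1 + p.2) ≤ c * K * (N : ℝ) ^ l := by
            gcongr
            exact hSl p h
          linarith
        · have h1 := ee_le_tau (a := a) (J := J) (θ := θ) hA1 hN c p.1 p.2
          have : 0 ≤ c * K * (N : ℝ) ^ l := by positivity
          linarith
    _ = _ := by
      rw [Finset.sum_add_distrib, Finset.sum_add_distrib, Finset.sum_sub_distrib, hF,
        ← Finset.mul_sum, hF, ← Finset.sum_filter, Finset.sum_const, card_product, card_range]
      rw [Finset.filter_mem_eq_inter, Finset.inter_eq_right.mpr hS]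
      simp only [nsmul_eq_mul]
      push_cast
      ring

lemma Dbounds {a J : ℝ} (ha : 1 ≤ a) (hJ : 2 * a ≤ J) :
    16 ≤ (a + J + 1) ^ 2 ∧ 2 * a + J ≤ (a + J + 1) ^ 2 ∧ a * (a + J) ≤ (a + J + 1) ^ 2 := by
  refine ⟨?_, ?_, ?_⟩ <;> nlinarith [mul_nonneg (by linarith : 0 ≤ a) (by linarith : 0 ≤ J)]

set_option maxHeartbeats 2000000 in
theorem core {ι : Type} [Fintype ι] {A B : ι → ℝ} {δ δ2 K1 K2 : ℝ}
    (hA0 : ∀ k, 0 ≤ A k) (hA1 : ∑ k, A k = 1)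
    (hA : ∀ x, 0 ≤ x → ∑ k, min (A k) x ≤ δ + K1 * x)
    (hB0 : ∀ k, 0 ≤ B k) (hB1 : ∑ k, B k = 1)
    (hB : 1 - δ ≤ ∑ k with B k ≤ 1 / K2, B k)
    (hBm : ∀ k, δ2 ≤ B k * Fintype.card ι)
    (hδ : 0 ≤ δ) (hδ2 : 0 < δ2) (hK1 : 0 ≤ K1) (hK2 : 1 ≤ K2)
    (hN : 2 ≤ N) (ha : 1 ≤ a) (hθ : 0 < θ)
    (H1 : ((a + J + 1 : ℕ) : ℝ) ^ 2 * θ ≤ 1 / 8)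
    (H2 : ((a + J + 1 : ℕ) : ℝ) ^ 2 * δ ≤ θ ^ (a + 2) / 8)
    (H3 : ((a + J + 1 : ℕ) : ℝ) ^ 2 * 8 ≤ θ ^ (a + 2) * N)
    (H4 : (N : ℝ) ^ 2 * K1 ≤ K2)
    (H5 : K1 * N ≤ (N : ℝ) ^ a)
    (H6 : (Fintype.card ι : ℝ) ≤ (N : ℝ) ^ a)
    (H7 : 1 ≤ δ2 * (N : ℝ) ^ a)
    (H8 : 2 * a ≤ J)
    (H9 : ((a + J + 1 : ℕ) : ℝ) ^ 2 * θ ^ (J - 2 * a) ≤ δ2) {c : ℝ} (hc : 0 ≤ c) :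
    ∑ k, ∑ u : Fin (N ^ (a + J)), ∑ v : Fin (N ^ (a + J)),
      min (A k * (marg N a J θ u * marg N a J θ v)) c ≤
    ∑ k, ∑ u : Fin (N ^ (a + J)), ∑ v : Fin (N ^ (a + J)),
      min (B k * G N a J θ 0 u v) c := by
  have hN1 : 1 ≤ N := by omega
  have hNr : (1 : ℝ) ≤ N := by exact_mod_cast hN1
  have hN0 : (0 : ℝ) < N := by linarith
  set D : ℝ := ((a + J + 1 : ℕ) : ℝ) ^ 2 with hD
  have ha' : (1 : ℝ) ≤ a := by exact_mod_cast ha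
  have hJ' : (2 : ℝ) * a ≤ J := by exact_mod_cast H8
  have hDe : D = (a + J + 1) ^ 2 := by rw [hD]; push_cast; ring
  obtain ⟨hD16, hD2, hD3⟩ := Dbounds ha' hJ'
  rw [← hDe] at hD16 hD2 hD3
  have hθs : θ ≤ 1 / 128 := by nlinarith
  have hθ1 : θ ≤ 1 := by linarith
  have hw2 : 1 / 2 ≤ w0 a J θ := by
    have := w0_ge (a := a) (J := J) hθ.le hθ1
    have h3 : (2 * a + J) * θ ≤ D * θ := by
      gcongr
    linarith
  have hw : 0 < w0 a J θ := by linarith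
  have hτa : 1 - (a + J) * θ ≤ tau a J θ a := by
    have := w0_ge (a := a) (J := J) hθ.le hθ1
    simp only [tau, lt_irrefl, if_false, if_true]
    linarith
  have hθp : ∀ m n : ℕ, m ≤ n → θ ^ n ≤ θ ^ m := fun m n h => pow_le_pow_of_le_one hθ.le hθ1 h
  have hθa2 : θ ^ (a + 2) ≤ θ ^ 2 := hθp _ _ (by omega)
  have hθa1 : θ ^ (a + 2) ≤ θ := by simpa using hθp 1 (a + 2) (by omega)
  have hδs : 16 * δ ≤ θ ^ (a + 2) / 8 := by nlinarith
  have hL := lhs_le (A := A) (N := N) (a := a) (J := J) (θ := θ) hA0 hN1 hθ hw hc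
  have hNmono : ∀ m n : ℕ, m ≤ n → (N : ℝ) ^ m ≤ (N : ℝ) ^ n := fun m n h =>
    pow_le_pow_right₀ hNr h
  -- case 1
  by_cases c1 : 1 ≤ c * (N : ℝ) ^ a
  · have h1 : ∑ k, ∑ u : Fin (N ^ (a + J)), ∑ v : Fin (N ^ (a + J)),
        min (A k * (marg N a J θ u * marg N a J θ v)) c ≤ 1 := by
      calc _ ≤ ∑ k, ∑ u : Fin (N ^ (a + J)), ∑ v : Fin (N ^ (a + J)),
          (A k * (marg N a J θ u * marg N a J θ v)) :=
            Finset.sum_le_sum fun k _ => Finset.sum_le_sum fun u _ => Finset.sum_le_sum fun v _ =>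
              min_le_left _ _
        _ = 1 := by
          have hm : ∑ u : Fin (N ^ (a + J)), marg N a J θ u = 1 := by
            simp only [← G_marg hN1]
            rw [G_sum hN1 θ (Nat.zero_le _)]; simp
          simp only [← Finset.mul_sum, hm, mul_one, hA1]
    refine h1.trans ?_
    have h2 := rhs_ge (B := B) hB0 (κ := 1) (c := c) (b := ((N : ℝ) ^ a)⁻¹)
      (fun u v : Fin (N ^ (a + J)) => G N a J θ 0 u v)
      (fun u v : Fin (N ^ (a + J)) => G N a J θ 0 u v) (fun u v => G_nonneg N hθ.le hw.le _ _ _)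
      (fun u v => le_rfl) (fun u v => G_le hN1 hθ.le hw.le (by omega) (by omega) _ _)
      (by rw [one_mul, inv_le_iff_one_le_mul₀ (by positivity)]; exact c1) hc
    rw [G_sum hN1 θ (Nat.zero_le _)] at h2
    have h3 : (∑ k with B k ≤ 1, B k) = 1 := by
      rw [← hB1]
      congr 1
      apply Finset.filter_true_of_mem
      intro k _
      exact Finset.single_le_sum (fun i _ => hB0 i) (mem_univ k)
    rw [h3] at h2
    simpa using h2
  push Not at c1
  -- case 2
  by_cases c2 : ∃ l, l ≤ 2 * a ∧ 1 ≤ c * K2 * (N : ℝ) ^ l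
  · obtain ⟨hl2, hl⟩ := Nat.find_spec c2
    have hmin := fun m (h : m < Nat.find c2) => Nat.find_min c2 h
    generalize Nat.find c2 = l at *
    have hx : D * (c * K1 * (N : ℝ) ^ l) ≤ θ ^ (a + 2) / 8 := by
      have h1 : c * K1 * (N : ℝ) ^ l * N ≤ 1 := by
        rcases Nat.eq_zero_or_pos l with h | h
        · subst h
          have : c * (K1 * N) ≤ c * (N : ℝ) ^ a := by gcongr
          rw [pow_zero]; linarith
        · have := hmin (l - 1) (by omega)
          have h3 : c * K2 * (N : ℝ) ^ (l - 1) < 1 := by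
            by_contra h4
            exact this ⟨by omega, not_lt.mp h4⟩
          have h5 : (N : ℝ) ^ l = N ^ (l - 1) * N := by
            rw [← pow_succ]; congr 1; omega
          calc _ = c * ((N : ℝ) ^ 2 * K1) * (N : ℝ) ^ (l - 1) := by rw [h5]; ring
            _ ≤ c * K2 * (N : ℝ) ^ (l - 1) := by gcongr
            _ ≤ 1 := h3.le
      have h0 : 0 ≤ c * K1 * (N : ℝ) ^ l := by positivity
      have hp : 0 < θ ^ (a + 2) := by positivity
      generalize c * K1 * (N : ℝ) ^ l = x at *
      calc D * x = D * 8 * x / 8 := by ring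
        _ ≤ θ ^ (a + 2) * N * x / 8 := by gcongr
        _ = θ ^ (a + 2) * (x * N) / 8 := by ring
        _ ≤ θ ^ (a + 2) * 1 / 8 := by gcongr
        _ = _ := by ring
    have hR := rhs_ge (B := B) hB0 (κ := 1 / K2) (c := c) (b := ((N : ℝ) ^ l)⁻¹)
      (fun u v : Fin (N ^ (a + J)) => G N a J θ 0 u v)
      (fun u v : Fin (N ^ (a + J)) => G N a J θ (l - a) u v)
      (fun u v => G_nonneg N hθ.le hw.le _ _ _)
      (fun u v => G_mono N hθ.le _ _ _)
      (fun u v => G_le hN1 hθ.le hw.le (by omega) (by omega) _ _)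
      (by
        have hq : (0 : ℝ) < K2 * (N : ℝ) ^ l := by positivity
        rw [one_div, ← mul_inv, inv_le_iff_one_le_mul₀ hq, ← mul_assoc]; exact hl) hc
    rw [G_sum hN1 θ (by omega)] at hR
    refine hL.trans (le_trans ?_ hR)
    have haθ : 2 * θ * ((l - a : ℕ) : ℝ) ≤ 1 / 4 := by
      have h1 : ((l - a : ℕ) : ℝ) ≤ D := by
        have : ((l - a : ℕ) : ℝ) ≤ a := by exact_mod_cast (by omega : l - a ≤ a)
        linarith
      calc 2 * θ * ((l - a : ℕ) : ℝ) ≤ 2 * θ * D := by gcongr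
        _ = 2 * (D * θ) := by ring
        _ ≤ 2 * (1 / 8) := by gcongr
        _ = _ := by norm_num
    have hR2 : (1 - δ) * (1 - 2 * θ * ((l - a : ℕ) : ℝ)) ≤
        (∑ k with B k ≤ 1 / K2, B k) * (1 - 2 * θ * ((l - a : ℕ) : ℝ)) := by
      gcongr; linarith
    have hbn : 0 ≤ 2 * θ * ((l - a : ℕ) : ℝ) := by positivity
    have hR3 : 1 - δ - 2 * θ * ((l - a : ℕ) : ℝ) ≤
        (1 - δ) * (1 - 2 * θ * ((l - a : ℕ) : ℝ)) := by
      have := mul_nonneg hδ hbn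
      linarith
    refine le_trans ?_ (hR3.trans hR2)
    have hHB := head_bound (A := A) hA1 hN1 hθ hw hc hK1 hδ hA l
    have hθ2 : θ ^ 2 ≤ θ / 128 := by
      rw [pow_two]
      calc θ * θ ≤ θ * (1 / 128) := by gcongr
        _ = _ := by ring
    rcases Nat.lt_or_ge a l with h | h
    · rcases Nat.lt_or_ge l (2 * a) with h' | h'
      · have h3 := hHB ((range (l - a + 1) ×ˢ {a}) ∪ ({a} ×ˢ range (l - a + 1))) (by
          intro p hp
          simp only [mem_union, mem_product, mem_range, mem_singleton] at hp ⊢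
          omega) (by
          intro p hp
          simp only [mem_union, mem_product, mem_range, mem_singleton] at hp ⊢
          omega)
        rw [Finset.sum_union, Finset.sum_product (s := range (l - a + 1)),
          Finset.sum_product (s := {a})] at h3
        · simp only [Finset.sum_singleton, ← Finset.sum_mul, ← Finset.mul_sum] at h3
          have h4 : ∑ i ∈ range (l - a + 1), tau a J θ i = ((l - a : ℕ) + 1) * θ := by
            rw [Finset.sum_congr rfl (g := fun _ => θ)]
            · simp
            · intro i hi
              have hi := mem_range.mp hi
              simp [tau, show i < a by omega]
          rw [h4] at h3
          have h5 : (((l - a : ℕ) : ℝ) + 1) ≤ a := by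
            exact_mod_cast (by omega : l - a + 1 ≤ a)
          have h6 : 0 ≤ ((l - a : ℕ) : ℝ) := by positivity
          generalize ((l - a : ℕ) : ℝ) = y at *
          have h7 : (y + 1) * ((a + J) * θ) ≤ 1 / 8 := by
            calc (y + 1) * ((a + J) * θ) ≤ a * ((a + J) * θ) := by gcongr
              _ = (a * (a + J)) * θ := by ring
              _ ≤ D * θ := by
                gcongr
              _ ≤ _ := H1
          have h8 : (y + 1) - 1 / 8 ≤ (y + 1) * tau a J θ a := by nlinarith
          have h9 : θ * ((y + 1) - 1 / 8) ≤ θ * ((y + 1) * tau a J θ a) := by gcongr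
          linarith
        · rw [Finset.disjoint_left]
          intro p hp hp'
          simp only [mem_product, mem_range, mem_singleton] at hp hp'
          omega
      · have h3 := hHB {(a, a)} (by
          intro p hp
          simp only [mem_product, mem_range, mem_singleton] at hp ⊢
          subst hp
          simp) (by
          intro p hp
          simp only [mem_singleton] at hp
          subst hp; simp; omega)
        rw [Finset.sum_singleton] at h3
        simp only at h3
        have h4 : (a + J) * θ ≤ 1 / 8 := by
          refine le_trans ?_ H1
          gcongr
          linarith
        have h5 : 7 / 8 * (7 / 8) ≤ tau a J θ a * tau a J θ a := by
          apply mul_self_le_mul_self <;> linarith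
        linarith
    · have h3 := hHB {(0, 0)} (by
          intro p hp
          simp only [mem_product, mem_range, mem_singleton] at hp ⊢
          subst hp
          simp) (by
          intro p hp
          simp only [mem_singleton] at hp
          subst hp; simp)
      rw [Finset.sum_singleton] at h3
      have h4 : tau a J θ 0 = θ := by simp [tau, show 0 < a by omega]
      simp only [h4] at h3
      rw [Nat.sub_eq_zero_of_le h]
      simp only [Nat.cast_zero, mul_zero, sub_zero]
      nlinarith
  -- the sum of all pair contributions
  have hsum : ∀ X : ℝ, (∀ i j, i ≤ a + J → j ≤ a + J → D * ee A N a J θ c i j ≤ X) →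
      ∑ p ∈ range (a + J + 1) ×ˢ range (a + J + 1), ee A N a J θ c p.1 p.2 ≤ X := by
    intro X hX
    have hD0 : 0 < D := by linarith
    have := Finset.sum_le_card_nsmul (range (a + J + 1) ×ˢ range (a + J + 1))
      (fun p => ee A N a J θ c p.1 p.2) (X / D) (by
        intro p hp
        simp only [mem_product, mem_range] at hp
        rw [le_div_iff₀ hD0, mul_comm]
        exact hX _ _ (by omega) (by omega))
    refine this.trans (le_of_eq ?_)
    rw [card_product, card_range, nsmul_eq_mul]
    have : (((a + J + 1) * (a + J + 1) : ℕ) : ℝ) = D := by rw [hD]; push_cast; ring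
    rw [this]; field_simp
  have hlin : ∀ y z : ℝ, 0 ≤ y → y * N ≤ z → D * y ≤ θ * z / 8 := by
    intro y z hy hz
    calc D * y = D * 8 * y / 8 := by ring
        _ ≤ θ ^ (a + 2) * N * y / 8 := by gcongr
        _ ≤ θ * N * y / 8 := by gcongr
        _ = θ * (y * N) / 8 := by ring
        _ ≤ _ := by gcongr
  have hcard0 : (0 : ℝ) ≤ Fintype.card ι := by positivity
  have hD0 : 0 ≤ D := by linarith
  -- case 3
  by_cases c3 : ∃ t, 1 ≤ t ∧ t ≤ J ∧ θ ^ t ≤ c * K2 * (N : ℝ) ^ (2 * (a + t))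
  · obtain ⟨ht1, htJ, ht⟩ := Nat.find_spec c3
    have hmin := fun m (h : m < Nat.find c3) => Nat.find_min c3 h
    generalize Nat.find c3 = t at *
    obtain ⟨s, rfl⟩ : ∃ s, t = s + 1 := ⟨t - 1, by omega⟩
    have hlt : c * K2 * (N : ℝ) ^ (2 * (a + s)) ≤ θ ^ s := by
      rcases Nat.eq_zero_or_pos s with h | h
      · subst h
        by_contra h4
        push Not at h4
        exact c2 ⟨2 * a, le_rfl, by simpa using h4.le⟩
      · by_contra h4
        push Not at h4
        exact hmin s (by omega) ⟨h, by omega, h4.le⟩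
    have hR := rhs_ge (B := B) hB0 (κ := 1 / K2) (c := c)
      (b := θ ^ (s + 1) * ((N : ℝ) ^ (2 * (a + (s + 1))))⁻¹)
      (fun u v : Fin (N ^ (a + J)) => G N a J θ 0 u v)
      (fun u v : Fin (N ^ (a + J)) => θ ^ (s + 1) * (U N (a + (s + 1)) u * U N (a + (s + 1)) v))
      (fun u v => mul_nonneg (by positivity) (mul_nonneg (U_nonneg ..) (U_nonneg ..)))
      (fun u v => G_ge N hθ.le hw.le ht1 htJ _ _)
      (fun u v => mul_le_mul_of_nonneg_left (UU_le hN1 (by omega) _ _) (by positivity))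
      (by
        have : (0 : ℝ) < N ^ (2 * (a + (s + 1))) := by positivity
        rw [one_div, inv_mul_le_iff₀ (by positivity), mul_inv_le_iff₀ this]
        linarith) hc
    simp only [← Finset.mul_sum] at hR
    simp only [sum_U hN1 (show a + (s + 1) ≤ a + J by omega), mul_one] at hR
    refine hL.trans (le_trans ?_ hR)
    have hθs1 : 0 < θ ^ (s + 1) := by positivity
    have : θ ^ (s + 1) / 2 ≤ (∑ k with B k ≤ 1 / K2, B k) * θ ^ (s + 1) := by
      have : 1 / 2 ≤ (∑ k with B k ≤ 1 / K2, B k) := by linarith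
      nlinarith
    refine le_trans ?_ this
    apply hsum
    intro i j hi hj
    have hse : θ ^ (s + 1) = θ * θ ^ s := by rw [pow_succ, mul_comm]
    have hτ := tau_mul_le hθ hθ1 hw i j
    rcases Nat.lt_or_ge (i + j) (2 * a + 2 * (s + 1)) with h | h
    · rcases Nat.lt_or_ge (i + j + a) (2 * (a + s)) with h' | h'
      · have h1 := ee_le_card (A := A) (N := N) (a := a) (J := J) (θ := θ) c i j
        have h2 := hlin (c * Fintype.card ι * (N : ℝ) ^ (i + j)) (θ ^ s) (by positivity) (by
          calc c * Fintype.card ι * (N : ℝ) ^ (i + j) * N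
              ≤ c * (N : ℝ) ^ a * (N : ℝ) ^ (i + j) * N := by gcongr
            _ = c * 1 * (N : ℝ) ^ (a + (i + j) + 1) := by rw [pow_add, pow_add]; ring
            _ ≤ c * K2 * (N : ℝ) ^ (2 * (a + s)) := by
              gcongr
              omega
            _ ≤ _ := hlt)
        have h3 : D * ee A N a J θ c i j ≤ D * (c * Fintype.card ι * (N : ℝ) ^ (i + j)) := by
          gcongr
        linarith
      · have h1 := ee_le_mix (A := A) (N := N) (a := a) (J := J) (θ := θ) hN1 hθ hw hc hA i j
        have h2 := hlin (c * K1 * (N : ℝ) ^ (i + j)) (θ ^ s) (by positivity) (by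
          calc c * K1 * (N : ℝ) ^ (i + j) * N
              = c * K1 * (N : ℝ) ^ (i + j + 1) := by rw [pow_succ]; ring
            _ ≤ c * K1 * (N : ℝ) ^ (2 * (a + s) + 2) :=
              mul_le_mul_of_nonneg_left (hNmono _ _ (by omega)) (by positivity)
            _ = c * ((N : ℝ) ^ 2 * K1) * (N : ℝ) ^ (2 * (a + s)) := by rw [pow_add]; ring
            _ ≤ c * K2 * (N : ℝ) ^ (2 * (a + s)) := by gcongr
            _ ≤ _ := hlt)
        have h3 : D * ee A N a J θ c i j ≤ D * (δ * (tau a J θ i * tau a J θ j)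
            + c * K1 * (N : ℝ) ^ (i + j)) := by gcongr
        have h4 : D * δ * (tau a J θ i * tau a J θ j) ≤ θ ^ (s + 1) / 8 := by
          calc _ ≤ θ ^ (a + 2) / 8 * θ ^ (i + j - 2 * a) :=
                mul_le_mul H2 hτ (mul_pos (tau_pos hθ hw _) (tau_pos hθ hw _)).le (by positivity)
            _ = θ ^ (a + 2 + (i + j - 2 * a)) / 8 := by rw [pow_add]; ring
            _ ≤ _ := by
              have := hθp (s + 1) (a + 2 + (i + j - 2 * a)) (by omega)
              linarith
        linarith
    · have h1 := ee_le_tau (A := A) (N := N) (a := a) (J := J) (θ := θ) hA1 hN1 c i j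
      have h2 : ee A N a J θ c i j ≤ θ * θ ^ (s + 1) := by
        rw [mul_comm, ← pow_succ]
        exact (h1.trans hτ).trans (hθp _ _ (by omega))
      calc D * ee A N a J θ c i j ≤ D * (θ * θ ^ (s + 1)) := by gcongr
        _ = D * θ * θ ^ (s + 1) := by ring
        _ ≤ 1 / 8 * θ ^ (s + 1) := by gcongr
        _ ≤ _ := by linarith
  -- case 4
  have hlt : c * K2 * (N : ℝ) ^ (2 * (a + J)) ≤ θ ^ J := by
    by_contra h
    push Not at h
    exact c3 ⟨J, by omega, le_rfl, h.le⟩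
  set W : ℝ := (N : ℝ) ^ (a + J) with hW
  have hW0 : 0 < W := by positivity
  have hV0 : (0 : ℝ) < Fintype.card ι := by
    have : Nonempty ι := by
      by_contra hne
      rw [not_nonempty_iff] at hne
      simp at hA1
    exact_mod_cast Fintype.card_pos
  have hBG : ∀ k, ∀ u v : Fin (N ^ (a + J)),
      δ2 / Fintype.card ι * (θ ^ J * (W⁻¹ * W⁻¹)) ≤ B k * G N a J θ 0 u v := by
    intro k u v
    have h1 := G_ge N hθ.le hw.le (show 1 ≤ J by omega) le_rfl u v
    have hu : U N (a + J) u = W⁻¹ := by simp [U, hW]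
    have hv : U N (a + J) v = W⁻¹ := by simp [U, hW]
    rw [hu, hv] at h1
    have h2 : δ2 / Fintype.card ι ≤ B k := by
      rw [div_le_iff₀ hV0]; exact hBm k
    exact mul_le_mul h2 h1 (by positivity) (hB0 k)
  by_cases c4 : c ≤ δ2 / Fintype.card ι * (θ ^ J * (W⁻¹ * W⁻¹))
  · refine Finset.sum_le_sum fun k _ => Finset.sum_le_sum fun u _ => Finset.sum_le_sum fun v _ => ?_
    exact (min_le_right _ _).trans (le_min (c4.trans (hBG k u v)) le_rfl)
  · push Not at c4
    have hR : θ ^ J * δ2 ≤ ∑ k, ∑ u : Fin (N ^ (a + J)), ∑ v : Fin (N ^ (a + J)),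
        min (B k * G N a J θ 0 u v) c := by
      calc θ ^ J * δ2 = ∑ k : ι, ∑ u : Fin (N ^ (a + J)), ∑ v : Fin (N ^ (a + J)),
          δ2 / Fintype.card ι * (θ ^ J * (W⁻¹ * W⁻¹)) := by
            simp only [Finset.sum_const, card_univ, Fintype.card_fin, nsmul_eq_mul]
            push_cast
            rw [← hW]
            field_simp
        _ ≤ _ := Finset.sum_le_sum fun k _ => Finset.sum_le_sum fun u _ =>
            Finset.sum_le_sum fun v _ => le_min (hBG k u v) c4.le
    refine hL.trans (le_trans ?_ hR)
    apply hsum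
    intro i j hi hj
    have hτ := tau_mul_le hθ hθ1 hw i j
    rcases Nat.lt_or_ge (i + j + 2 * a) (2 * (a + J)) with h | h
    · have h1 := ee_le_card (A := A) (N := N) (a := a) (J := J) (θ := θ) c i j
      have hy0 : 0 ≤ c * Fintype.card ι * (N : ℝ) ^ (i + j) := by positivity
      have h2 : c * Fintype.card ι * (N : ℝ) ^ (i + j) * N * (N : ℝ) ^ a ≤ θ ^ J := by
        calc _ ≤ c * (N : ℝ) ^ a * (N : ℝ) ^ (i + j) * N * (N : ℝ) ^ a := by gcongr
          _ = c * 1 * (N : ℝ) ^ (a + (i + j) + 1 + a) := by rw [pow_add, pow_add, pow_add]; ring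
          _ ≤ c * K2 * (N : ℝ) ^ (2 * (a + J)) := by
            gcongr
            omega
          _ ≤ _ := hlt
      generalize c * Fintype.card ι * (N : ℝ) ^ (i + j) = y at *
      have hDN : D ≤ N := by
        have : θ ^ (a + 2) * N ≤ 1 * N := by
          gcongr; linarith
        linarith
      calc D * ee A N a J θ c i j ≤ D * y := by gcongr
        _ ≤ N * y * 1 := by rw [mul_one]; gcongr
        _ ≤ N * y * (δ2 * (N : ℝ) ^ a) := by gcongr
        _ = (y * N * (N : ℝ) ^ a) * δ2 := by ring
        _ ≤ _ := by gcongr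
    · have h1 := ee_le_tau (A := A) (N := N) (a := a) (J := J) (θ := θ) hA1 hN1 c i j
      have h2 : ee A N a J θ c i j ≤ θ ^ J * θ ^ (J - 2 * a) := by
        rw [← pow_add]
        exact (h1.trans hτ).trans (hθp _ _ (by omega))
      calc D * ee A N a J θ c i j ≤ D * (θ ^ J * θ ^ (J - 2 * a)) := by gcongr
        _ = θ ^ J * (D * θ ^ (J - 2 * a)) := by ring
        _ ≤ _ := by gcongr

end
end CatProof

namespace CatProof

/-- existence of a (not necessarily fully supported) bipartite catalyst -/
def Rel {ι : Type} [Fintype ι] (A B : ι → ℝ) : Prop :=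
  ∃ (σ1 σ2 : Type) (_ : Fintype σ1) (_ : Fintype σ2) (r : σ1 → σ2 → ℝ),
    (∀ u v, 0 ≤ r u v) ∧ ∑ u, ∑ v, r u v = 1 ∧
    ∀ c : ℝ, 0 ≤ c →
      ∑ k, ∑ u, ∑ v, min (A k * ((∑ v', r u v') * (∑ u', r u' v))) c ≤
        ∑ k, ∑ u, ∑ v, min (B k * r u v) c

/-- product mass function on tuples -/
def pw {ι : Type} (A : ι → ℝ) (n : ℕ) (F : Fin n → ι) : ℝ := ∏ j, A (F j)

/-- hybrid product mass function on tuples -/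
noncomputable def gg {ι : Type} (A B : ι → ℝ) (n i : ℕ) (F : Fin n → ι) : ℝ :=
  ∏ j : Fin n, if (j : ℕ) < i then A (F j) else B (F j)

lemma gg_cons {ι : Type} (A B : ι → ℝ) (k i : ℕ) (x : ι) (f : Fin k → ι) :
    gg A B (k + 1) (i + 1) (Fin.cons x f : Fin (k + 1) → ι) = A x * gg A B k i f := by
  simp [gg, Fin.prod_univ_succ]

lemma gg_snoc {ι : Type} (A B : ι → ℝ) (k i : ℕ) (hi : i ≤ k) (x : ι) (f : Fin k → ι) :
    gg A B (k + 1) i (Fin.snoc f x : Fin (k + 1) → ι) = B x * gg A B k i f := by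
  simp [gg, Fin.prod_univ_castSucc, not_lt.mpr hi, mul_comm]

lemma sum_prod_fun {ι : Type} [Fintype ι] (n : ℕ) (h : Fin n → ι → ℝ) :
    ∑ F : Fin n → ι, ∏ j, h j (F j) = ∏ j, ∑ x, h j x := by
  rw [Finset.prod_univ_sum]
  simp

lemma gg_sum {ι : Type} [Fintype ι] {A B : ι → ℝ} (hA : ∑ x, A x = 1) (hB : ∑ x, B x = 1)
    (k i : ℕ) : ∑ F, gg A B k i F = 1 := by
  unfold gg
  rw [sum_prod_fun k (fun j x => if (j : ℕ) < i then A x else B x)]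
  apply Finset.prod_eq_one
  intro j _
  split_ifs <;> assumption

lemma pw_sum {ι : Type} [Fintype ι] {A : ι → ℝ} (hA : ∑ x, A x = 1) 
    (k : ℕ) : ∑ F, pw A k F = 1 := by
  unfold pw
  rw [sum_prod_fun k (fun j x => A x)]
  exact Finset.prod_eq_one fun j _ => hA

lemma pw_nonneg {ι : Type} {A : ι → ℝ} (hA : ∀ x, 0 ≤ A x) (k : ℕ) (F : Fin k → ι) :
    0 ≤ pw A k F := Finset.prod_nonneg fun _ _ => hA _

lemma gg_nonneg {ι : Type} {A B : ι → ℝ} (hA : ∀ x, 0 ≤ A x) (hB : ∀ x, 0 ≤ B x) (k i : ℕ)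
    (F : Fin k → ι) : 0 ≤ gg A B k i F := by
  apply Finset.prod_nonneg
  intro j _
  split_ifs
  · exact hA _
  · exact hB _

lemma sum_cons {ι : Type} [Fintype ι] (k : ℕ) (Z : (Fin (k + 1) → ι) → ℝ) :
    ∑ x, ∑ f : Fin k → ι, Z (Fin.cons x f : Fin (k + 1) → ι) = ∑ F, Z F := by
  rw [← (Fin.consEquiv (fun _ : Fin (k + 1) => ι)).sum_comp, Fintype.sum_prod_type]
  rfl

lemma sum_snoc {ι : Type} [Fintype ι] (k : ℕ) (Z : (Fin (k + 1) → ι) → ℝ) :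
    ∑ x, ∑ f : Fin k → ι, Z (Fin.snoc f x : Fin (k + 1) → ι) = ∑ F, Z F := by
  rw [← (Fin.snocEquiv (fun _ : Fin (k + 1) => ι)).sum_comp, Fintype.sum_prod_type]
  rfl

theorem root {ι : Type} [Fintype ι] {A B : ι → ℝ} (hA0 : ∀ x, 0 ≤ A x) (hB0 : ∀ x, 0 ≤ B x)
    (hA : ∑ x, A x = 1) (hB : ∑ x, B x = 1) (k : ℕ)
    (h : Rel (pw A (k + 1)) (pw B (k + 1))) : Rel A B := by
  obtain ⟨σ1, σ2, _, _, r, hr0, hr1, hr⟩ := h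
  set r1 : σ1 → ℝ := fun u => ∑ v, r u v with hr1d
  set r2 : σ2 → ℝ := fun v => ∑ u, r u v with hr2d
  have s1 : ∑ u, r1 u = 1 := hr1
  have s2 : ∑ v, r2 v = 1 := by rw [← hr1, hr2d, Finset.sum_comm]
  have r10 : ∀ u, 0 ≤ r1 u := fun u => Finset.sum_nonneg fun v _ => hr0 u v
  have r20 : ∀ u, 0 ≤ r2 u := fun v => Finset.sum_nonneg fun u _ => hr0 u v
  have hk : (0 : ℝ) < k + 1 := by positivity
  set w : ℝ := (k + 1 : ℝ)⁻¹ with hw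
  have hw0 : 0 < w := by positivity
  let q : Fin (k + 1) → σ1 → σ2 → ℝ := fun i u v => if i = 0 then r u v else r1 u * r2 v
  let r' : Fin (k + 1) × (Fin k → ι) × σ1 → σ2 → ℝ := fun z v =>
    w * gg A B k z.1 z.2.1 * q z.1 z.2.2 v
  have hq0 : ∀ i u v, 0 ≤ q i u v := by
    intro i u v
    simp only [q]
    split_ifs
    · exact hr0 u v
    · exact mul_nonneg (r10 u) (r20 v)
  have hq1 : ∀ i u, ∑ v, q i u v = r1 u := by
    intro i u
    simp only [q]
    split_ifs
    · rfl
    · rw [← Finset.mul_sum, s2, mul_one]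
  have hq2 : ∀ i v, ∑ u, q i u v = r2 v := by
    intro i v
    simp only [q]
    split_ifs
    · rfl
    · rw [← Finset.sum_mul, s1, one_mul]
  have m1 : ∀ z, ∑ v, r' z v = w * gg A B k z.1 z.2.1 * r1 z.2.2 := by
    intro z
    simp only [r', ← Finset.mul_sum, hq1]
  have m2 : ∀ v, ∑ z, r' z v = r2 v := by
    intro v
    simp only [Fintype.sum_prod_type, r', ← Finset.mul_sum, hq2, ← Finset.sum_mul,
      gg_sum hA hB, mul_one]
    simp only [Finset.sum_const, card_univ, Fintype.card_fin, nsmul_eq_mul]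
    push_cast
    rw [hw, inv_mul_cancel_left₀ hk.ne']
  refine ⟨_, σ2, inferInstance, inferInstance, r', ?_, ?_, ?_⟩
  · intro z v
    exact mul_nonneg (mul_nonneg hw0.le (gg_nonneg hA0 hB0 _ _ _)) (hq0 _ _ _)
  · rw [Finset.sum_comm]
    simp only [m2, s2]
  intro c hc
  simp only [m1, m2]
  let Φ : ℕ → ℝ := fun i => ∑ F : Fin (k + 1) → ι, ∑ u, ∑ v,
    min (w * (gg A B (k + 1) i F * (r1 u * r2 v))) c
  let Ψ : ℝ := ∑ F : Fin (k + 1) → ι, ∑ u, ∑ v,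
    min (w * (gg A B (k + 1) 0 F * r u v)) c
  have hL : ∑ x, ∑ z : Fin (k + 1) × (Fin k → ι) × σ1, ∑ v,
      min (A x * (w * gg A B k z.1 z.2.1 * r1 z.2.2 * r2 v)) c
      = ∑ i : Fin (k + 1), Φ (i + 1) := by
    simp only [Fintype.sum_prod_type]
    rw [Finset.sum_comm]
    apply Finset.sum_congr rfl
    intro i _
    simp only [Φ]
    rw [← sum_cons]
    simp only [gg_cons]
    refine Finset.sum_congr rfl fun x _ => Finset.sum_congr rfl fun f _ =>
      Finset.sum_congr rfl fun u _ => Finset.sum_congr rfl fun v _ => ?_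
    congr 1
    ring
  have hR : ∑ x, ∑ z : Fin (k + 1) × (Fin k → ι) × σ1, ∑ v, min (B x * r' z v) c
      = ∑ i : Fin (k + 1), ∑ F : Fin (k + 1) → ι, ∑ u, ∑ v,
          min (w * (gg A B (k + 1) i F * q i u v)) c := by
    simp only [Fintype.sum_prod_type]
    rw [Finset.sum_comm]
    apply Finset.sum_congr rfl
    intro i _
    rw [← sum_snoc]
    simp only [gg_snoc A B k i (by omega), r']
    refine Finset.sum_congr rfl fun x _ => Finset.sum_congr rfl fun f _ =>
      Finset.sum_congr rfl fun u _ => Finset.sum_congr rfl fun v _ => ?_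
    congr 1
    ring
  rw [hL, hR, Fin.sum_univ_castSucc, Fin.sum_univ_succ, add_comm]
  apply add_le_add
  · have key := hr (c * (k + 1)) (by positivity)
    have hmin : ∀ z, min (w * z) c = w * min z (c * (k + 1)) := by
      intro z
      rw [mul_min_of_nonneg _ _ hw0.le]
      congr 1
      rw [hw]; field_simp
    simp only [Φ, q, hmin, ← Finset.mul_sum, if_true]
    have e1 : ∀ F, gg A B (k + 1) (((Fin.last k : Fin (k + 1)) : ℕ) + 1) F = pw A (k + 1) F := by
      intro F
      apply Finset.prod_congr rfl
      intro j _
      rw [if_pos]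
      simp
      omega
    have e2 : ∀ F, gg A B (k + 1) ((0 : Fin (k + 1)) : ℕ) F = pw B (k + 1) F := by
      intro F
      apply Finset.prod_congr rfl
      intro j _
      rw [if_neg]
      simp
    simp only [e1, e2]
    exact mul_le_mul_of_nonneg_left key hw0.le
  · apply le_of_eq
    apply Finset.sum_congr rfl
    intro i _
    simp only [Φ, q, Fin.succ_ne_zero, if_false, Fin.val_succ, Fin.val_castSucc]

end CatProof

namespace CatProof

lemma chernoff {ι : Type} [Fintype ι] {a y : ι → ℝ} (ha0 : ∀ i, 0 ≤ a i) (ha1 : ∑ i, a i = 1)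
    (hy : ∑ i, a i * y i < 0) :
    ∃ ρ : ℝ, 0 < ρ ∧ ρ < 1 ∧
      ∀ n : ℕ, ∑ F : Fin n → ι with 0 < ∑ j, y (F j), pw a n F ≤ ρ ^ n := by
  set m := ∑ i, a i * y i with hm
  set M := ∑ i, a i * y i ^ 2 with hM
  have hM0 : 0 ≤ M := Finset.sum_nonneg fun i _ => mul_nonneg (ha0 i) (sq_nonneg _)
  set Y := ∑ i, |y i| + 1 with hY
  have hY0 : 0 < Y := by
    have : 0 ≤ ∑ i, |y i| := Finset.sum_nonneg fun i _ => abs_nonneg _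
    linarith
  have hyY : ∀ i, |y i| ≤ Y := by
    intro i
    have := Finset.single_le_sum (f := fun i => |y i|) (fun i _ => abs_nonneg _) (mem_univ i)
    linarith
  set s := min (1 / Y) (-m / (M + 1)) with hs
  have hs0 : 0 < s := lt_min (by positivity) (div_pos (by linarith) (by linarith))
  have hsM : s * M < -m := by
    have h1 : s * (M + 1) ≤ -m := by
      rw [← le_div_iff₀ (by linarith)]
      exact min_le_right _ _
    linarith
  have hsy : ∀ i, |s * y i| ≤ 1 := by
    intro i
    rw [abs_mul, abs_of_pos hs0]
    calc s * |y i| ≤ 1 / Y * Y := mul_le_mul (min_le_left _ _) (hyY i) (abs_nonneg _) (by positivity)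
      _ = 1 := by field_simp
  have hφ : ∑ i, a i * Real.exp (s * y i) < 1 := by
    calc ∑ i, a i * Real.exp (s * y i) ≤ ∑ i, a i * (1 + s * y i + (s * y i) ^ 2) := by
          apply Finset.sum_le_sum
          intro i _
          apply mul_le_mul_of_nonneg_left _ (ha0 i)
          have := (abs_le.mp (Real.abs_exp_sub_one_sub_id_le (hsy i))).2
          linarith
      _ = ∑ i, a i + s * m + s ^ 2 * M := by
          rw [hm, hM, Finset.mul_sum, Finset.mul_sum, ← Finset.sum_add_distrib,
            ← Finset.sum_add_distrib]
          apply Finset.sum_congr rfl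
          intro i _
          ring
      _ = 1 + s * (m + s * M) := by rw [ha1]; ring
      _ < 1 := by
        have := mul_neg_of_pos_of_neg hs0 (by linarith : m + s * M < 0)
        linarith
  have hφ0 : 0 ≤ ∑ i, a i * Real.exp (s * y i) :=
    Finset.sum_nonneg fun i _ => mul_nonneg (ha0 i) (Real.exp_pos _).le
  refine ⟨max (∑ i, a i * Real.exp (s * y i)) (1 / 2), ?_, ?_, ?_⟩
  · exact lt_max_of_lt_right (by norm_num)
  · exact max_lt hφ (by norm_num)
  · intro n
    calc ∑ F : Fin n → ι with 0 < ∑ j, y (F j), pw a n F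
        ≤ ∑ F : Fin n → ι with 0 < ∑ j, y (F j), ∏ j, (a (F j) * Real.exp (s * y (F j))) := by
          apply Finset.sum_le_sum
          intro F hF
          have hF := (mem_filter.mp hF).2
          rw [Finset.prod_mul_distrib, ← Real.exp_sum, ← Finset.mul_sum]
          exact le_mul_of_one_le_right (pw_nonneg ha0 n F)
            (Real.one_le_exp (mul_pos hs0 hF).le)
      _ ≤ ∑ F : Fin n → ι, ∏ j, (a (F j) * Real.exp (s * y (F j))) := by
          apply Finset.sum_le_sum_of_subset_of_nonneg (filter_subset _ _)
          intro F _ _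
          exact Finset.prod_nonneg fun j _ => mul_nonneg (ha0 _) (Real.exp_pos _).le
      _ = (∑ i, a i * Real.exp (s * y i)) ^ n := by
          rw [sum_prod_fun n (fun _ i => a i * Real.exp (s * y i))]
          simp
      _ ≤ _ := pow_le_pow_left₀ hφ0 (le_max_left _ _) n

lemma sideA {ι : Type} [Fintype ι] {A : ι → ℝ} (hA0 : ∀ i, 0 ≤ A i) (hA1 : ∑ i, A i = 1)
    {h : ℝ} (hh : -∑ i, A i * Real.log (A i) < h) :
    ∃ ρ : ℝ, 0 < ρ ∧ ρ < 1 ∧ ∀ n : ℕ, ∀ x : ℝ, 0 ≤ x →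
      ∑ F : Fin n → ι, min (pw A n F) x ≤ ρ ^ n + Real.exp (h * n) * x := by
  obtain ⟨ρ, h0, h1, hρ⟩ := chernoff (y := fun i => -(Real.log (A i) + h)) hA0 hA1 (by
    have : ∑ i, A i * -(Real.log (A i) + h) = -∑ i, A i * Real.log (A i) - h * ∑ i, A i := by
      rw [Finset.mul_sum, ← Finset.sum_neg_distrib, ← Finset.sum_sub_distrib]
      exact Finset.sum_congr rfl fun i _ => by ring
    rw [this, hA1]; linarith)
  refine ⟨ρ, h0, h1, fun n x hx => ?_⟩
  calc ∑ F : Fin n → ι, min (pw A n F) x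
      ≤ ∑ F : Fin n → ι, ((if 0 < ∑ j, -(Real.log (A (F j)) + h) then pw A n F else 0)
          + Real.exp (h * n) * x * pw A n F) := by
        apply Finset.sum_le_sum
        intro F _
        have hp := pw_nonneg hA0 n F
        have h3 : 0 ≤ Real.exp (h * n) * x * pw A n F := by positivity
        split_ifs with hF
        · have := min_le_left (pw A n F) x
          linarith
        · rcases hp.eq_or_lt with h4 | h4
          · rw [← h4]; simp [hx]
          · have hne : ∀ j ∈ univ, A (F j) ≠ 0 := by
              rw [← Finset.prod_ne_zero_iff]; exact h4.ne'
            have hlog : Real.log (pw A n F) = ∑ j, Real.log (A (F j)) := Real.log_prod hne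
            have h5 : 0 ≤ Real.log (pw A n F) + h * n := by
              rw [hlog]
              simp only [Finset.sum_neg_distrib, Finset.sum_add_distrib, Finset.sum_const,
                card_univ, Fintype.card_fin, nsmul_eq_mul] at hF
              linarith
            have h6 : 1 ≤ Real.exp (h * n) * pw A n F := by
              rw [← Real.exp_log h4, ← Real.exp_add]
              apply Real.one_le_exp
              linarith
            have := min_le_right (pw A n F) x
            nlinarith
    _ = ∑ F : Fin n → ι with 0 < ∑ j, -(Real.log (A (F j)) + h), pw A n F
          + Real.exp (h * n) * x := by
        rw [Finset.sum_add_distrib, ← Finset.sum_filter, ← Finset.mul_sum, pw_sum hA1, mul_one]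
    _ ≤ _ := by
      have := hρ n
      linarith

lemma sideB {ι : Type} [Fintype ι] {B : ι → ℝ} (hB0 : ∀ i, 0 < B i) (hB1 : ∑ i, B i = 1)
    {h : ℝ} (hh : h < -∑ i, B i * Real.log (B i)) :
    ∃ ρ : ℝ, 0 < ρ ∧ ρ < 1 ∧ ∀ n : ℕ,
      1 - ρ ^ n ≤ ∑ F : Fin n → ι with pw B n F ≤ 1 / Real.exp (h * n), pw B n F := by
  obtain ⟨ρ, h0, h1, hρ⟩ := chernoff (y := fun i => Real.log (B i) + h) (fun i => (hB0 i).le) hB1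
    (by
    have : ∑ i, B i * (Real.log (B i) + h) = ∑ i, B i * Real.log (B i) + h * ∑ i, B i := by
      rw [Finset.mul_sum, ← Finset.sum_add_distrib]
      exact Finset.sum_congr rfl fun i _ => by ring
    rw [this, hB1]; linarith)
  refine ⟨ρ, h0, h1, fun n => ?_⟩
  have h2 := Finset.sum_filter_add_sum_filter_not univ
    (fun F : Fin n → ι => 0 < ∑ j, (Real.log (B (F j)) + h)) (pw B n)
  rw [pw_sum hB1] at h2
  have h3 := hρ n
  have h4 : ∑ F : Fin n → ι with ¬ 0 < ∑ j, (Real.log (B (F j)) + h), pw B n F ≤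
      ∑ F : Fin n → ι with pw B n F ≤ 1 / Real.exp (h * n), pw B n F := by
    apply Finset.sum_le_sum_of_subset_of_nonneg
    · intro F hF
      simp only [mem_filter, mem_univ, true_and] at hF ⊢
      have hp : 0 < pw B n F := Finset.prod_pos fun j _ => hB0 _
      have hlog : Real.log (pw B n F) = ∑ j, Real.log (B (F j)) :=
        Real.log_prod fun j _ => (hB0 _).ne'
      simp only [Finset.sum_add_distrib, Finset.sum_const,
                card_univ, Fintype.card_fin, nsmul_eq_mul] at hF
      rw [one_div, ← Real.exp_neg, ← Real.log_le_iff_le_exp hp, hlog]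
      linarith
    · intro F _ _
      exact pw_nonneg (fun i => (hB0 i).le) n F
  linarith

lemma ev {r s : ℝ} (C : ℝ) (hr : 0 ≤ r) (hs : r < s) :
    ∀ᶠ q : ℕ in Filter.atTop, C * r ^ q ≤ s ^ q := by
  have hs0 : 0 < s := by linarith
  have h1 : Filter.Tendsto (fun q : ℕ => C * (r / s) ^ q) Filter.atTop (nhds (C * 0)) :=
    (tendsto_pow_atTop_nhds_zero_of_lt_one (by positivity) ((div_lt_one hs0).mpr hs)).const_mul C
  rw [mul_zero] at h1
  filter_upwards [h1.eventually (gt_mem_nhds (zero_lt_one))] with q hq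
  rw [div_pow, ← mul_div_assoc, div_lt_one (by positivity)] at hq
  exact hq.le

lemma params {E1 E2 M β ρ : ℝ} (hE1 : 0 < E1) (hE : 4 * E1 ≤ E2) (hM : 0 < M) (hβ : 0 < β)
    (hρ0 : 0 < ρ) (hρ1 : ρ < 1) :
    ∃ (q a J : ℕ) (θ : ℝ), 1 ≤ q ∧ 1 ≤ a ∧ 0 < θ ∧
      ((a + J + 1 : ℕ) : ℝ) ^ 2 * θ ≤ 1 / 8 ∧
      ((a + J + 1 : ℕ) : ℝ) ^ 2 * ρ ^ q ≤ θ ^ (a + 2) / 8 ∧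
      ((a + J + 1 : ℕ) : ℝ) ^ 2 * 8 ≤ θ ^ (a + 2) * ((2 ^ q : ℕ) : ℝ) ∧
      ((2 ^ q : ℕ) : ℝ) ^ 2 * E1 ^ q ≤ E2 ^ q ∧
      E1 ^ q * ((2 ^ q : ℕ) : ℝ) ≤ ((2 ^ q : ℕ) : ℝ) ^ a ∧
      M ^ q ≤ ((2 ^ q : ℕ) : ℝ) ^ a ∧
      1 ≤ β ^ q * ((2 ^ q : ℕ) : ℝ) ^ a ∧
      2 * a ≤ J ∧
      ((a + J + 1 : ℕ) : ℝ) ^ 2 * θ ^ (J - 2 * a) ≤ β ^ q := by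
  obtain ⟨a0, ha0⟩ := pow_unbounded_of_one_lt (max M (max (2 * E1) (1 / β)))
    (one_lt_two : (1 : ℝ) < 2)
  set a := a0 + 1 with ha
  have ha1 : max M (max (2 * E1) (1 / β)) ≤ 2 ^ a := by
    refine ha0.le.trans ?_
    exact pow_le_pow_right₀ (by norm_num) (by omega)
  have haM : M ≤ 2 ^ a := (le_max_left _ _).trans ha1
  have haE : 2 * E1 ≤ 2 ^ a := (le_max_left _ _).trans ((le_max_right _ _).trans ha1)
  have haβ : 1 / β ≤ 2 ^ a := (le_max_right _ _).trans ((le_max_right _ _).trans ha1)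
  rw [div_le_iff₀ hβ] at haβ
  obtain ⟨x, hx0, hx1, hxρ, hx2⟩ : ∃ x : ℝ, 0 < x ∧ x < 1 ∧ ρ < x ^ (a + 2) ∧
      1 / 2 < x ^ (a + 2) := by
    set μ := (1 + max ρ (1 / 2)) / 2 with hμ
    have h1 : max ρ (1 / 2) < 1 := max_lt hρ1 (by norm_num)
    have h2 : ρ ≤ max ρ (1 / 2) := le_max_left _ _
    have h3 : 1 / 2 ≤ max ρ (1 / 2) := le_max_right _ _
    have hμ0 : 0 < μ := by linarith
    have h4 : (μ ^ (((a + 2 : ℕ) : ℝ)⁻¹)) ^ (a + 2) = μ :=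
      Real.rpow_inv_natCast_pow hμ0.le (by omega)
    refine ⟨μ ^ (((a + 2 : ℕ) : ℝ)⁻¹), Real.rpow_pos_of_pos hμ0 _, ?_, ?_, ?_⟩
    · exact Real.rpow_lt_one hμ0.le (by linarith) (by positivity)
    · rw [h4]; linarith
    · rw [h4]; linarith
  obtain ⟨n, hn⟩ := exists_pow_lt_of_lt_one hβ hx1
  set J := 2 * a + n with hJ
  set D : ℝ := ((a + J + 1 : ℕ) : ℝ) ^ 2 with hD
  obtain ⟨q, e1, e2, e3, e4, e5⟩ := ((ev (8 * D) hx0.le hx1).and ((ev (8 * D) hρ0.le hxρ).and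
    ((ev (8 * D) zero_le_one (by linarith : 1 < 2 * x ^ (a + 2))).and
    ((ev D (by positivity) hn).and (Filter.eventually_ge_atTop 1))))).exists
  have c2 : ((2 ^ q : ℕ) : ℝ) = 2 ^ q := by push_cast; rfl
  have sw : ∀ (z : ℝ) (m : ℕ), (z ^ q) ^ m = (z ^ m) ^ q := fun z m => pow_right_comm z q m
  refine ⟨q, a, J, x ^ q, e5, by omega, by positivity, ?_, ?_, ?_, ?_, ?_, ?_, ?_, by omega, ?_⟩
  · rw [one_pow] at e1; linarith
  · rw [sw]; linarith
  · rw [sw, c2, ← mul_pow, mul_comm _ (2 : ℝ)]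
    rw [one_pow] at e3; linarith
  · rw [c2, sw, ← mul_pow]
    exact pow_le_pow_left₀ (by positivity) (by linarith) q
  · rw [c2, sw, ← mul_pow]
    exact pow_le_pow_left₀ (by positivity) (by linarith) q
  · rw [c2, sw]
    exact pow_le_pow_left₀ hM.le haM q
  · rw [c2, sw, ← mul_pow]
    exact one_le_pow₀ (by linarith)
  · rw [sw, show J - 2 * a = n by omega]
    exact e4

theorem rel_of_entropy {ι : Type} [Fintype ι] {A B : ι → ℝ} (hA0 : ∀ i, 0 ≤ A i)
    (hA1 : ∑ i, A i = 1) (hB0 : ∀ i, 0 < B i) (hB1 : ∑ i, B i = 1)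
    (hH : -∑ i, A i * Real.log (A i) < -∑ i, B i * Real.log (B i)) : Rel A B := by
  have hne : Nonempty ι := by
    by_contra hne
    rw [not_nonempty_iff] at hne
    simp at hA1
  have hA01 : ∀ i, A i ≤ 1 := by
    intro i
    rw [← hA1]
    exact Finset.single_le_sum (fun i _ => hA0 i) (mem_univ i)
  have hHA : 0 ≤ -∑ i, A i * Real.log (A i) := by
    rw [← Finset.sum_neg_distrib]
    apply Finset.sum_nonneg
    intro i _
    have := mul_nonneg (hA0 i) (neg_nonneg.mpr (Real.log_nonpos (hA0 i) (hA01 i)))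
    linarith
  obtain ⟨h1, hh1, hh1'⟩ := exists_between hH
  obtain ⟨h2, hh2, hh2'⟩ := exists_between hh1'
  obtain ⟨ρ1, p1, p2, hρ1⟩ := sideA hA0 hA1 hh1
  obtain ⟨ρ2, p3, p4, hρ2⟩ := sideB hB0 hB1 hh2'
  obtain ⟨κ0, hκ0⟩ := exists_nat_ge (2 * Real.log 2 / (h2 - h1))
  set κ := κ0 + 1 with hκ
  have hκ1 : 2 * Real.log 2 ≤ κ * (h2 - h1) := by
    rw [← div_le_iff₀ (by linarith)]
    refine hκ0.trans ?_
    rw [hκ]; push_cast; linarith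
  obtain ⟨i0, -, hi0⟩ := Finset.exists_min_image univ B univ_nonempty
  have hcard : (0 : ℝ) < Fintype.card ι := by exact_mod_cast Fintype.card_pos
  set ρ := max ρ1 ρ2 with hρ
  have hρ0 : 0 < ρ := lt_max_of_lt_left p1
  have hρl : ρ < 1 := max_lt p2 p4
  obtain ⟨q, a, J, θ, hq, ha, hθ, c1, c2, c3, c4, c5, c6, c7, c8, c9⟩ :=
    params (E1 := Real.exp (h1 * κ)) (E2 := Real.exp (h2 * κ)) (M := (Fintype.card ι : ℝ) ^ κ)
      (β := (B i0 * Fintype.card ι) ^ κ) (ρ := ρ ^ κ) (Real.exp_pos _) (by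
        have : (4 : ℝ) = Real.exp (2 * Real.log 2) := by
          rw [two_mul, Real.exp_add, Real.exp_log (by norm_num)]; norm_num
        rw [this, ← Real.exp_add]
        apply Real.exp_le_exp.mpr
        linarith) (by positivity) (pow_pos (mul_pos (hB0 _) hcard) _) (by positivity)
        (pow_lt_one₀ hρ0.le hρl (by omega))
  have ex : ∀ h : ℝ, Real.exp (h * κ) ^ q = Real.exp (h * ((κ * q : ℕ) : ℝ)) := by
    intro h
    rw [← Real.exp_nat_mul]
    congr 1
    push_cast
    ring
  rw [ex] at c4 c5
  rw [ex] at c4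
  simp only [← pow_mul] at c2 c6 c7 c9
  obtain ⟨k, hk⟩ : ∃ k, κ * q = k + 1 := by
    have : 1 ≤ κ * q := Nat.one_le_iff_ne_zero.mpr (by
      apply Nat.mul_ne_zero <;> omega)
    exact ⟨κ * q - 1, by omega⟩
  rw [hk] at c2 c4 c5 c6 c7 c9
  apply root hA0 (fun i => (hB0 i).le) hA1 hB1 k
  have hc : (Fintype.card (Fin (k + 1) → ι) : ℝ) = (Fintype.card ι : ℝ) ^ (k + 1) := by
    simp
  have hN : 2 ≤ 2 ^ q := by
    calc 2 = 2 ^ 1 := rfl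
      _ ≤ 2 ^ q := Nat.pow_le_pow_right (by norm_num) hq
  have hN1 : 1 ≤ 2 ^ q := by omega
  have key := fun c (hc0 : 0 ≤ c) => core (A := pw A (k + 1)) (B := pw B (k + 1)) (N := 2 ^ q)
    (a := a) (J := J) (θ := θ)
    (δ := ρ ^ (k + 1)) (δ2 := (B i0 * Fintype.card ι) ^ (k + 1))
    (K1 := Real.exp (h1 * ((k + 1 : ℕ) : ℝ))) (K2 := Real.exp (h2 * ((k + 1 : ℕ) : ℝ)))
    (pw_nonneg hA0 _) (pw_sum hA1 _) (by
      intro x hx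
      have h3 := hρ1 (k + 1) x hx
      have h4 := pow_le_pow_left₀ p1.le (le_max_left ρ1 ρ2) (k + 1)
      linarith)
    (pw_nonneg (fun i => (hB0 i).le) _) (pw_sum hB1 _) (by
      have h3 := hρ2 (k + 1)
      have h4 := pow_le_pow_left₀ p3.le (le_max_right ρ1 ρ2) (k + 1)
      linarith)
    (by
      intro F
      rw [hc, mul_pow]
      apply mul_le_mul_of_nonneg_right _ (by positivity)
      have := Finset.prod_le_prod (s := univ) (f := fun _ : Fin (k + 1) => B i0)
        (g := fun j => B (F j)) (fun _ _ => (hB0 i0).le) (fun j _ => hi0 _ (mem_univ _))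
      simpa [pw] using this)
    (by positivity) (pow_pos (mul_pos (hB0 _) hcard) _) (Real.exp_pos _).le
    (Real.one_le_exp (mul_nonneg (by linarith) (by positivity)))
    hN ha hθ c1 c2 c3 c4 c5 (by rw [hc]; exact c6) c7 c8 c9 hc0
  have hw : 0 ≤ w0 a J θ := by
    have ha' : (1 : ℝ) ≤ a := by exact_mod_cast ha
    have hJ' : (2 : ℝ) * a ≤ J := by exact_mod_cast c8
    obtain ⟨hD16, hD2, hD3⟩ := Dbounds ha' hJ'
    have hDe : ((a + J + 1 : ℕ) : ℝ) ^ 2 = (a + J + 1) ^ 2 := by push_cast; ring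
    rw [hDe] at c1
    have hθ1 : θ ≤ 1 := by nlinarith
    have := w0_ge (a := a) (J := J) hθ.le hθ1
    have h3 := mul_le_mul_of_nonneg_right hD2 hθ.le
    linarith
  refine ⟨Fin ((2 ^ q) ^ (a + J)), Fin ((2 ^ q) ^ (a + J)), inferInstance, inferInstance,
    fun u v => G (2 ^ q) a J θ 0 u v, fun u v => G_nonneg _ hθ.le hw _ _ _, ?_, ?_⟩
  · rw [G_sum hN1 θ (Nat.zero_le _)]; simp
  · intro c hc0
    simp only [G_marg hN1, G_marg' hN1]
    exact key c hc0

end CatProof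

namespace CatProof

lemma threshold {α : Type} [Fintype α] (p : α → ℝ) (hp : ∀ x, 0 ≤ p x) (h1 : ∑ x, p x = 1) :
    ∀ k : ℕ, k ≤ Fintype.card α → ∃ (A : Finset α) (c : ℝ), A.card = k ∧ 0 ≤ c ∧
      (∀ x ∈ A, c ≤ p x) ∧ ∀ x, x ∉ A → p x ≤ c := by
  intro k
  induction k with
  | zero =>
    intro _
    refine ⟨∅, 1, rfl, zero_le_one, by simp, fun x _ => ?_⟩
    rw [← h1]
    exact Finset.single_le_sum (fun i _ => hp i) (mem_univ x)
  | succ k ih =>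
    intro hk
    obtain ⟨A, c, hA, hc, h2, h3⟩ := ih (by omega)
    have hne : (Aᶜ).Nonempty := by
      rw [← Finset.card_pos, Finset.card_compl]; omega
    obtain ⟨x0, hx0, hmax⟩ := Finset.exists_max_image Aᶜ p hne
    have hx0' : x0 ∉ A := by simpa using hx0
    refine ⟨insert x0 A, p x0, ?_, hp x0, ?_, ?_⟩
    · rw [Finset.card_insert_of_notMem hx0', hA]
    · intro x hx
      rcases Finset.mem_insert.mp hx with h | h
      · rw [h]
      · exact (h3 x0 hx0').trans (h2 x h)
    · intro x hx
      apply hmax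
      simp only [Finset.mem_insert, not_or] at hx
      simpa using hx.2

lemma maj_of_min (X Y : FinProb)
    (h : ∀ c : ℝ, 0 ≤ c → ∑ x, min (X.p x) c ≤ ∑ y, min (Y.p y) c) : Majorizes X Y := by
  intro k
  obtain ⟨A, c, hAk, hc, hA⟩ : ∃ (A : Finset X.α) (c : ℝ), A.card ≤ k ∧ 0 ≤ c ∧
      1 - ∑ x, min (X.p x) c + k * c ≤ ∑ x ∈ A, X.p x := by
    rcases Nat.lt_or_ge (Fintype.card X.α) k with hk | hk
    · refine ⟨univ, 0, by rw [card_univ]; omega, le_rfl, ?_⟩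
      have : ∑ x, min (X.p x) 0 = 0 :=
        Finset.sum_eq_zero fun x _ => min_eq_right (X.pos x).le
      rw [this, X.sum_one]; simp
    · obtain ⟨A, c, hA, hc, h2, h3⟩ := threshold X.p (fun x => (X.pos x).le) X.sum_one k hk
      refine ⟨A, c, hA.le, hc, ?_⟩
      have e1 : ∑ x, min (X.p x) c = k * c + ∑ x ∈ Aᶜ, X.p x := by
        rw [← Finset.sum_add_sum_compl A]
        congr 1
        · rw [Finset.sum_congr rfl (g := fun _ => c) fun x hx => min_eq_right (h2 x hx)]
          simp [hA]
        · exact Finset.sum_congr rfl fun x hx => min_eq_left (h3 x (by simpa using hx))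
      have e2 := Finset.sum_add_sum_compl A X.p
      rw [X.sum_one] at e2
      linarith
  have hX : ∑ x ∈ A, X.p x ≤ topSum X k :=
    Finset.le_sup' (fun A => ∑ x ∈ A, X.p x) (by simpa using hAk)
  apply Finset.sup'_le
  intro B hB
  have hBk : B.card ≤ k := (mem_filter.mp hB).2
  refine le_trans ?_ (hA.trans hX)
  have h1 := h c hc
  have h2 : ∑ y ∈ B, Y.p y ≤ ∑ y ∈ B, (Y.p y - min (Y.p y) c) + k * c := by
    calc ∑ y ∈ B, Y.p y ≤ ∑ y ∈ B, ((Y.p y - min (Y.p y) c) + c) := by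
          apply Finset.sum_le_sum
          intro y _
          have := min_le_right (Y.p y) c
          linarith
      _ = ∑ y ∈ B, (Y.p y - min (Y.p y) c) + B.card * c := by
          rw [Finset.sum_add_distrib]; simp
      _ ≤ _ := by
          have : (B.card : ℝ) ≤ k := by exact_mod_cast hBk
          have := mul_le_mul_of_nonneg_right this hc
          linarith
  have h3 : ∑ y ∈ B, (Y.p y - min (Y.p y) c) ≤ ∑ y, (Y.p y - min (Y.p y) c) := by
    apply Finset.sum_le_sum_of_subset_of_nonneg (Finset.subset_univ _)
    intro y _ _
    have := min_le_left (Y.p y) c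
    linarith
  have h4 : ∑ y, (Y.p y - min (Y.p y) c) = 1 - ∑ y, min (Y.p y) c := by
    rw [Finset.sum_sub_distrib, Y.sum_one]
  linarith

lemma sum_push (R : FinProb) {β : Type} [Fintype β] (f : R.α → β) (g : ℝ → ℝ) (g0 : g 0 = 0) :
    ∑ y, g ((R.push f).p y) =
      ∑ b, g (∑ x ∈ Finset.univ.filter fun x => f x = b, R.p x) := by
  apply Fintype.sum_of_injective (fun y : (R.push f).α => (y : Set.range f).1)
  · exact Subtype.val_injective
  · intro b hb
    rw [Finset.filter_false_of_mem, Finset.sum_empty, g0]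
    intro x _ hx
    exact hb ⟨⟨b, x, hx⟩, rfl⟩
  · intro y
    rfl

lemma sum_prodFP (P Q : FinProb) (g : ℝ → ℝ) :
    ∑ z, g ((P.prod Q).p z) = ∑ x, ∑ y, g (P.p x * Q.p y) :=
  Fintype.sum_prod_type (fun z : P.α × Q.α => g (P.p z.1 * Q.p z.2))

lemma sum_sub {β : Type} [Fintype β] (r : β → ℝ) (hr : ∀ b, 0 ≤ r b) (F : β → ℝ)
    (hF : ∀ b, r b = 0 → F b = 0) : ∑ z : {b // 0 < r b}, F z.1 = ∑ b, F b := by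
  apply Fintype.sum_of_injective (fun z : {b // 0 < r b} => z.1)
  · exact Subtype.val_injective
  · intro b hb
    apply hF
    by_contra h
    exact hb ⟨⟨b, lt_of_le_of_ne (hr b) (Ne.symm h)⟩, rfl⟩
  · intro y
    rfl

/-- restrict a mass function to its support -/
noncomputable def mkFP {β : Type} [Fintype β] (r : β → ℝ) (hr : ∀ b, 0 ≤ r b)
    (h1 : ∑ b, r b = 1) : FinProb where
  α := {b // 0 < r b}
  fin := inferInstance
  p := fun z => r z.1
  pos := fun z => z.2
  sum_one := by rw [sum_sub r hr r (fun _ h => h), h1]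

/-- mass of a fiber -/
noncomputable def fib {β γ : Type} [Fintype β] (r : β → ℝ) (f : β → γ) (c : γ) : ℝ :=
  ∑ b, if f b = c then r b else 0

lemma push_mk {β γ : Type} [Fintype β] [Fintype γ] (r : β → ℝ) (hr : ∀ b, 0 ≤ r b)
    (h1 : ∑ b, r b = 1) (f : β → γ) (g : ℝ → ℝ) (g0 : g 0 = 0) :
    ∑ y, g (((mkFP r hr h1).push fun z => f z.1).p y) = ∑ c, g (fib r f c) := by
  rw [sum_push _ _ g g0]
  apply Finset.sum_congr rfl
  intro c _
  congr 1
  rw [Finset.sum_filter]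
  exact sum_sub r hr (fun b => if f b = c then r b else 0) (fun b hb => by simp [hb])

end CatProof

theorem CatProof.main (P Q : FinProb)
    (h0 : H0 Q ≤ H0 P) (h1 : H1 Q < H1 P) :
    ∃ (R : FinProb) (σ₁ σ₂ σ₃ : Type) (_ : Fintype σ₁) (_ : Fintype σ₂) (_ : Fintype σ₃)
      (x₁ : R.α → σ₁) (x₂ : R.α → σ₂) (x₃ : R.α → σ₃),
      Majorizes (((Q.prod (R.push x₁)).prod (R.push x₂)).prod (R.push x₃))
        (P.prod (R.push fun u => (x₁ u, x₂ u, x₃ u))) := by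
  have neQ : Nonempty Q.α := by
    by_contra hne
    rw [not_nonempty_iff] at hne
    have := Q.sum_one
    simp at this
  have neP : Nonempty P.α := by
    by_contra hne
    rw [not_nonempty_iff] at hne
    have := P.sum_one
    simp at this
  have hcard : Fintype.card Q.α ≤ Fintype.card P.α := by
    have hq : (0 : ℝ) < Fintype.card Q.α := by exact_mod_cast Fintype.card_pos
    have hp : (0 : ℝ) < Fintype.card P.α := by exact_mod_cast Fintype.card_pos
    exact_mod_cast (Real.log_le_log_iff hq hp).mp h0
  obtain ⟨e⟩ := Function.Embedding.nonempty_of_card_le hcard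
  let A : P.α → ℝ := Function.extend e Q.p 0
  have hA : ∀ g : ℝ → ℝ, g 0 = 0 → ∑ q, g (Q.p q) = ∑ k, g (A k) := by
    intro g g0
    apply Fintype.sum_of_injective e e.injective
    · intro k hk
      have : A k = 0 := Function.extend_apply' _ _ _ hk
      rw [this, g0]
    · intro q
      have : A (e q) = Q.p q := e.injective.extend_apply _ _ _
      rw [this]
  have hA0 : ∀ k, 0 ≤ A k := by
    intro k
    by_cases hk : ∃ q, e q = k
    · obtain ⟨q, rfl⟩ := hk
      have : A (e q) = Q.p q := e.injective.extend_apply _ _ _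
      rw [this]; exact (Q.pos q).le
    · have : A k = 0 := Function.extend_apply' _ _ _ hk
      rw [this]
  have hA1 : ∑ k, A k = 1 := by
    rw [← hA (fun x => x) rfl]; exact Q.sum_one
  have hH : -∑ k, A k * Real.log (A k) < -∑ k, P.p k * Real.log (P.p k) := by
    rw [← hA (fun x => x * Real.log x) (by simp)]; exact h1
  obtain ⟨σ1, σ2, i1, i2, r, hr0, hr1, hr⟩ := rel_of_entropy hA0 hA1 P.pos P.sum_one hH
  let r' : σ1 × σ2 → ℝ := fun z => r z.1 z.2
  have hr0' : ∀ z, 0 ≤ r' z := fun z => hr0 _ _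
  have hr1' : ∑ z, r' z = 1 := by rw [Fintype.sum_prod_type]; exact hr1
  refine ⟨mkFP r' hr0' hr1', σ1, σ2, Unit, i1, i2, inferInstance, fun z => z.1.1, fun z => z.1.2,
    fun _ => (), ?_⟩
  apply maj_of_min
  intro c hc
  have m1 : ∀ u, fib r' (fun b => b.1) u = ∑ v, r u v := by
    intro u
    rw [fib, Fintype.sum_prod_type,
      Finset.sum_eq_single u]
    · simp [r']
    · intro b _ hb
      simp [hb]
    · simp
  have m2 : ∀ v, fib r' (fun b => b.2) v = ∑ u, r u v := by
    intro v
    rw [fib, Fintype.sum_prod_type_right,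
      Finset.sum_eq_single v]
    · simp [r']
    · intro b _ hb
      simp [hb]
    · simp
  have m3 : ∀ w : Unit, fib r' (fun _ => ()) w = 1 := by
    intro w
    rw [fib]
    simpa using hr1'
  have m4 : ∀ b : σ1 × σ2 × Unit,
      fib r' (fun z => (z.1, z.2, ())) b = r b.1 b.2.1 := by
    intro b
    rw [fib, Finset.sum_eq_single (b.1, b.2.1)]
    · simp [r']
    · intro z _ hz
      rw [if_neg]
      rintro rfl
      exact hz rfl
    · simp
  have g0 : min 0 c = 0 := min_eq_left hc
  rw [sum_prodFP _ _ (fun t => min t c), sum_prodFP _ _ (fun t => min t c)]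
  have e3 : ∀ t : ℝ, ∑ y, min (t * ((mkFP r' hr0' hr1').push fun _ => ()).p y) c = min t c := by
    intro t
    rw [push_mk r' hr0' hr1' (fun _ => ()) (fun s => min (t * s) c) (by simp [g0])]
    simp only [m3]
    simp
  simp only [e3]
  rw [sum_prodFP _ _ (fun t => min t c)]
  have e2 : ∀ t : ℝ, ∑ y, min (t * ((mkFP r' hr0' hr1').push fun z => z.1.2).p y) c =
      ∑ v, min (t * ∑ u, r u v) c := by
    intro t
    rw [push_mk r' hr0' hr1' (fun z => z.2) (fun s => min (t * s) c) (by simp [g0])]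
    simp only [m2]
  simp only [e2]
  rw [sum_prodFP _ _ (fun t => ∑ v, min (t * ∑ u, r u v) c)]
  have e1 : ∀ t : ℝ, ∑ y, ∑ v, min (t * ((mkFP r' hr0' hr1').push fun z => z.1.1).p y
      * ∑ u, r u v) c = ∑ u, ∑ v, min (t * (∑ v, r u v) * ∑ u, r u v) c := by
    intro t
    rw [push_mk r' hr0' hr1' (fun z => z.1)
      (fun s => ∑ v, min (t * s * ∑ u, r u v) c) (by simp [g0])]
    simp only [m1]
  simp only [e1]
  rw [hA (fun t => ∑ u, ∑ v, min (t * (∑ v, r u v) * ∑ u, r u v) c) (by simp [g0])]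
  have e4 : ∀ t : ℝ, ∑ y, min (t * ((mkFP r' hr0' hr1').push
      fun z => (z.1.1, z.1.2, ())).p y) c = ∑ u, ∑ v, min (t * r u v) c := by
    intro t
    rw [push_mk r' hr0' hr1' (fun z => (z.1, z.2, ())) (fun s => min (t * s) c)
      (by simp [g0])]
    simp only [m4, Fintype.sum_prod_type]
    simp
  simp only [e4]
  simpa only [mul_assoc] using hr c hc

/-- Müller–Pastena: if `H₀ Q ≤ H₀ P` and `H₁ Q < H₁ P`, then there are a finite probability
space `R` and random variables `x₁, x₂, x₃` over `R` such that
`Q ⊗ x₁⋆r ⊗ x₂⋆r ⊗ x₃⋆r` majorizes `P ⊗ (x₁, x₂, x₃)⋆r`. -/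
theorem exists_majorizing_catalyst (P Q : FinProb)
    (h0 : H0 Q ≤ H0 P) (h1 : H1 Q < H1 P) :
    ∃ (R : FinProb) (σ₁ σ₂ σ₃ : Type) (_ : Fintype σ₁) (_ : Fintype σ₂) (_ : Fintype σ₃)
      (x₁ : R.α → σ₁) (x₂ : R.α → σ₂) (x₃ : R.α → σ₃),
      Majorizes (((Q.prod (R.push x₁)).prod (R.push x₂)).prod (R.push x₃))
        (P.prod (R.push fun u => (x₁ u, x₂ u, x₃ u))) :=
  CatProof.main P Q h0 h1
end
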